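/- Let (𝒫, 𝒩) be a Beurling generalized number system with θ-well-behaved integers (N(x) = Ax + O(x^θ), A > 0, θ ∈ [0,1)). Suppose ζ(s) has no zeros in the region σ > 1 − d₁ (log log t)/(log t) for some d₁ > 0 and all t > t₀ ≥ e², and suppose that for some b > θ one has the zero-density estimate N(α, T) ≪ T^{c(1−α)} (log T)^L for all T > 2 and b ≤ α ≤ 1, with constants c > 0 and L > 0. Then for every λ > max{ b, 1 − d₁/(c d₁ + L) } and every constant c₀ > 0: ψ(x+h) − ψ(x) ∼ h as x → ∞, uniformly for h ≥ c₀ x^λ. -/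

import Mathlib

open Filter Topology

/-- A Beurling generalized prime number system: a nondecreasing sequence of
generalized primes, each `> 1`, tending to infinity. -/
structure BeurlingSystem where
  p : ℕ → ℝ
  one_lt_p : ∀ k, 1 < p k
  p_mono : Monotone p
  p_tendsto : Filter.Tendsto p Filter.atTop Filter.atTop

namespace BeurlingSystem

variable (S : BeurlingSystem)

/-- The numerical value of a generalized integer, encoded as the finitely supported
vector of exponents of the generalized primes. -/
noncomputable def val (n : ℕ →₀ ℕ) : ℝ := n.prod fun k e => S.p k ^ e

/-- The integer counting function `N(x)`. -/
noncomputable def cnt (x : ℝ) : ℝ := (Set.ncard {n : ℕ →₀ ℕ | S.val n ≤ x} : ℝ)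

/-- `χ(x, λ)`: the number of generalized integers within distance `λ` of `x`. -/
noncomputable def chi (x lam : ℝ) : ℝ := (Set.ncard {n : ℕ →₀ ℕ | |x - S.val n| ≤ lam} : ℝ)

/-- The integers are `θ`-well-behaved with density `A` and implied constant `K₀`:
`N(x) = A x + O(x^θ)`. -/
def WellBehaved (A θ K₀ : ℝ) : Prop :=
  0 < A ∧ 0 ≤ θ ∧ θ < 1 ∧ 0 ≤ K₀ ∧ ∀ x : ℝ, 1 ≤ x → |S.cnt x - A * x| ≤ K₀ * x ^ θ

/-- `ζ` is (the unique) analytic continuation of the Beurling zeta function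
to `{Re s > θ} \ {1}`. -/
def IsZeta (θ : ℝ) (ζ : ℂ → ℂ) : Prop :=
  DifferentiableOn ℂ ζ {s : ℂ | θ < s.re ∧ s ≠ 1} ∧
  ∀ s : ℂ, 1 < s.re → ζ s = ∑' n : ℕ →₀ ℕ, (S.val n : ℂ) ^ (-s)

/-- The von Mangoldt function: `log p` on prime powers `p^m`, `0` otherwise. -/
noncomputable def vonMangoldt (n : ℕ →₀ ℕ) : ℝ :=
  ∑ k ∈ n.support, if n.support = {k} then Real.log (S.p k) else 0

/-- The Chebyshev function `ψ(x)`. -/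
noncomputable def psi (x : ℝ) : ℝ :=
  ∑ᶠ n ∈ {n : ℕ →₀ ℕ | S.val n ≤ x}, S.vonMangoldt n

end BeurlingSystem

/-- The generalized divisor function: the number of ordered pairs of generalized
integers whose formal product equals `n`. -/
noncomputable def gDivisor (n : ℕ →₀ ℕ) : ℝ :=
  (Set.ncard {q : (ℕ →₀ ℕ) × (ℕ →₀ ℕ) | q.1 + q.2 = n} : ℝ)

/-- The generalized Möbius function. -/
noncomputable def gMoebius (n : ℕ →₀ ℕ) : ℝ :=
  if ∀ k ∈ n.support, n k ≤ 1 then (-1 : ℝ) ^ n.support.card else 0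

/-- The zero-counting function `N(α, T)` of the (continued) zeta function. -/
noncomputable def zeroCount (ζ : ℂ → ℂ) (α T : ℝ) : ℝ :=
  (Set.ncard {ρ : ℂ | ζ ρ = 0 ∧ ρ ≠ 1 ∧ α ≤ ρ.re ∧ |ρ.im| ≤ T} : ℝ)

/-! ### Factorisation of zeros and local bounds for logarithmic derivatives -/

theorem exists_eq_pow_mul_of_not_eventually_zero {f : ℂ → ℂ} {U : Set ℂ} (hU : IsOpen U)
    (hf : DifferentiableOn ℂ f U) {ρ : ℂ} (hρ : ρ ∈ U) (hne : ¬ ∀ᶠ z in 𝓝 ρ, f z = 0) :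
    ∃ (n : ℕ) (g : ℂ → ℂ), DifferentiableOn ℂ g U ∧ g ρ ≠ 0 ∧
      ∀ z, f z = (z - ρ) ^ n * g z := by
  obtain ⟨p, hp⟩ := hf.analyticAt (hU.mem_nhds hρ)
  refine ⟨p.order, (Function.swap dslope ρ)^[p.order] f, ?_, ?_, ?_⟩
  · have key : ∀ n : ℕ, DifferentiableOn ℂ ((Function.swap dslope ρ)^[n] f) U := by
      intro n
      induction n with
      | zero => exact hf
      | succ n ih =>
        rw [Function.iterate_succ_apply']
        exact (Complex.differentiableOn_dslope (hU.mem_nhds hρ)).mpr ih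
    exact key _
  · exact hp.iterate_dslope_fslope_ne_zero (fun h => hne (hp.locally_zero_iff.mpr h))
  · intro z
    simpa using hp.eq_pow_order_mul_iterate_dslope z

theorem exists_finset_zero_factorization {f : ℂ → ℂ} {U : Set ℂ} (hU : IsOpen U)
    (hUc : IsPreconnected U) (hf : DifferentiableOn ℂ f U) (hne : ∃ z ∈ U, f z ≠ 0)
    (Z : Finset ℂ) (hZ : ∀ ρ ∈ Z, ρ ∈ U) :
    ∃ (m : ℂ → ℕ) (g : ℂ → ℂ), DifferentiableOn ℂ g U ∧ (∀ ρ ∈ Z, g ρ ≠ 0) ∧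
      ∀ z, f z = (∏ ρ ∈ Z, (z - ρ) ^ (m ρ)) * g z := by
  classical
  induction Z using Finset.induction_on with
  | empty => exact ⟨fun _ => 0, f, hf, by simp, by simp⟩
  | insert ρ Z hρZ ih =>
    obtain ⟨m, g, hg, hgZ, hfg⟩ := ih (fun w hw => hZ w (Finset.mem_insert_of_mem hw))
    have hρU : ρ ∈ U := hZ ρ (Finset.mem_insert_self _ _)
    have hng : ¬ ∀ᶠ z in 𝓝 ρ, g z = 0 := by
      intro h
      have h1 : f =ᶠ[𝓝 ρ] 0 := by
        filter_upwards [h] with z hz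
        rw [hfg z, hz, mul_zero]; rfl
      obtain ⟨z, hz, hz'⟩ := hne
      exact hz' ((hf.analyticOnNhd hU).eqOn_zero_of_preconnected_of_eventuallyEq_zero hUc hρU h1 hz)
    obtain ⟨n, g', hg', hg'ρ, hgg'⟩ := exists_eq_pow_mul_of_not_eventually_zero hU hg hρU hng
    refine ⟨Function.update m ρ n, g', hg', ?_, ?_⟩
    · intro w hw
      rcases Finset.mem_insert.mp hw with rfl | hw
      · exact hg'ρ
      · intro h0
        exact hgZ w hw (by rw [hgg' w, h0, mul_zero])
    · intro z
      rw [Finset.prod_insert hρZ, hfg z, hgg' z, Function.update_self]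
      have : ∏ x ∈ Z, (z - x) ^ (Function.update m ρ n x) = ∏ x ∈ Z, (z - x) ^ (m x) := by
        refine Finset.prod_congr rfl fun x hx => ?_
        rw [Function.update_of_ne]
        rintro rfl
        exact hρZ hx
      rw [this]; ring

theorem norm_sq_sub_conj_mul_eq {R : ℝ} {z a : ℂ} (hz : ‖z‖ = R) :
    ‖(R : ℂ) ^ 2 - (starRingEnd ℂ) a * z‖ = R * ‖z - a‖ := by
  have h1 : (R : ℂ) ^ 2 = z * (starRingEnd ℂ) z := by
    rw [Complex.mul_conj, Complex.normSq_eq_norm_sq, hz]; push_cast; rfl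
  rw [h1, show z * (starRingEnd ℂ) z - (starRingEnd ℂ) a * z = z * (starRingEnd ℂ) (z - a) by
    rw [map_sub]; ring, norm_mul, RCLike.norm_conj, hz]

theorem norm_sq_sub_conj_mul_ge {R r : ℝ} {z a : ℂ} (hr : 0 ≤ r) (hz : ‖z‖ ≤ r) (ha : ‖a‖ ≤ r) :
    R ^ 2 - r ^ 2 ≤ ‖(R : ℂ) ^ 2 - (starRingEnd ℂ) a * z‖ := by
  have h1 : ‖(R : ℂ) ^ 2‖ = R ^ 2 := by rw [norm_pow]; simp
  have h2 : ‖(starRingEnd ℂ) a * z‖ ≤ r ^ 2 := by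
    rw [norm_mul, RCLike.norm_conj, sq]; gcongr
  have := norm_sub_norm_le ((R : ℂ) ^ 2) ((starRingEnd ℂ) a * z)
  linarith

/-- The zero-free part `h` times the outer parts of the Blaschke factors of the zeros in `D`. -/
noncomputable def blaschkeQuotient (h : ℂ → ℂ) (c : ℂ) (R : ℝ) (D : Finset ℂ) (m : ℂ → ℕ)
    (s : ℂ) : ℂ :=
  h s * ∏ ρ ∈ D, (((R : ℂ) ^ 2 - (starRingEnd ℂ) (ρ - c) * (s - c)) / R) ^ (m ρ)

section Local

variable {h : ℂ → ℂ} {U : Set ℂ} {c : ℂ} {R r M : ℝ} {D : Finset ℂ} {m : ℂ → ℕ}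

theorem differentiableOn_blaschkeQuotient (hh : DifferentiableOn ℂ h U) :
    DifferentiableOn ℂ (blaschkeQuotient h c R D m) U := by
  unfold blaschkeQuotient
  refine hh.mul ?_
  apply DifferentiableOn.fun_finsetProd
  intro i _
  fun_prop

theorem norm_blaschkeQuotient_le (hR : 0 < R) (hUR : Metric.closedBall c R ⊆ U)
    (hh : DifferentiableOn ℂ h U)
    (hM : ∀ s ∈ Metric.sphere c R, ‖(∏ ρ ∈ D, (s - ρ) ^ (m ρ)) * h s‖ ≤ M)
    {s : ℂ} (hs : s ∈ Metric.closedBall c R) : ‖blaschkeQuotient h c R D m s‖ ≤ M := by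
  have hd : DiffContOnCl ℂ (blaschkeQuotient h c R D m) (Metric.ball c R) := by
    apply DifferentiableOn.diffContOnCl
    rw [closure_ball c hR.ne']
    exact (differentiableOn_blaschkeQuotient hh).mono hUR
  refine Complex.norm_le_of_forall_mem_frontier_norm_le Metric.isBounded_ball hd ?_
    (by rwa [closure_ball c hR.ne'])
  intro z hz
  rw [frontier_ball c hR.ne'] at hz
  refine le_trans (le_of_eq ?_) (hM z hz)
  unfold blaschkeQuotient
  rw [norm_mul, norm_mul, norm_prod, norm_prod, mul_comm]
  congr 1
  refine Finset.prod_congr rfl fun ρ _ => ?_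
  have hz' : ‖z - c‖ = R := by simpa [dist_eq_norm] using hz
  rw [norm_pow, norm_pow, norm_div, norm_sq_sub_conj_mul_eq hz']
  congr 1
  rw [show z - c - (ρ - c) = z - ρ by ring]
  simp [abs_of_pos hR]
  field_simp

theorem norm_center_mul_pow_le (hr : 0 < r) (hR : 0 < R) 
    (hD : ∀ ρ ∈ D, ‖ρ - c‖ ≤ r) :
    ‖(∏ ρ ∈ D, (c - ρ) ^ (m ρ)) * h c‖ * (R / r) ^ (∑ ρ ∈ D, m ρ) ≤
      ‖blaschkeQuotient h c R D m c‖ := by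
  unfold blaschkeQuotient
  have h2 : ‖∏ ρ ∈ D, (((R : ℂ) ^ 2 - (starRingEnd ℂ) (ρ - c) * (c - c)) / R) ^ (m ρ)‖
      = R ^ (∑ ρ ∈ D, m ρ) := by
    rw [norm_prod, ← Finset.prod_pow_eq_pow_sum]
    refine Finset.prod_congr rfl fun ρ _ => ?_
    rw [norm_pow]
    congr 1
    simp only [sub_self, mul_zero, sub_zero]
    rw [norm_div, norm_pow]
    simp [abs_of_pos hR]
    field_simp
  have h3 : ‖∏ ρ ∈ D, (c - ρ) ^ (m ρ)‖ ≤ r ^ (∑ ρ ∈ D, m ρ) := by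
    rw [norm_prod, ← Finset.prod_pow_eq_pow_sum]
    refine Finset.prod_le_prod (fun _ _ => norm_nonneg _) fun ρ hρ => ?_
    rw [norm_pow]
    gcongr
    rw [norm_sub_rev]; exact hD ρ hρ
  rw [norm_mul, norm_mul, h2, div_pow]
  have h4 : 0 < r ^ (∑ ρ ∈ D, m ρ) := by positivity
  calc _ = ‖h c‖ * R ^ (∑ ρ ∈ D, m ρ) *
        (‖∏ ρ ∈ D, (c - ρ) ^ (m ρ)‖ / r ^ (∑ ρ ∈ D, m ρ)) := by field_simp
    _ ≤ ‖h c‖ * R ^ (∑ ρ ∈ D, m ρ) * 1 := by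
        gcongr
        exact (div_le_one h4).mpr h3
    _ = _ := by ring

/-- Jensen's inequality for the number of zeros in a disc. -/
theorem norm_center_mul_pow_card_le (hr : 0 < r) (hrR : r < R) (hUR : Metric.closedBall c R ⊆ U)
    (hh : DifferentiableOn ℂ h U) (hD : ∀ ρ ∈ D, ‖ρ - c‖ ≤ r)
    (hM : ∀ s ∈ Metric.sphere c R, ‖(∏ ρ ∈ D, (s - ρ) ^ (m ρ)) * h s‖ ≤ M) :
    ‖(∏ ρ ∈ D, (c - ρ) ^ (m ρ)) * h c‖ * (R / r) ^ (∑ ρ ∈ D, m ρ) ≤ M :=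
  (norm_center_mul_pow_le hr (hr.trans hrR) hD).trans
    (norm_blaschkeQuotient_le (hr.trans hrR) hUR hh hM
      (Metric.mem_closedBall_self (hr.trans hrR).le))

theorem sum_multiplicity_le (hr : 0 < r) (hrR : r < R) (hUR : Metric.closedBall c R ⊆ U)
    (hh : DifferentiableOn ℂ h U) (hD : ∀ ρ ∈ D, ‖ρ - c‖ ≤ r)
    (hM : ∀ s ∈ Metric.sphere c R, ‖(∏ ρ ∈ D, (s - ρ) ^ (m ρ)) * h s‖ ≤ M)
    {M₀ : ℝ} (hM₀ : 0 < M₀) (hc : M₀ ≤ ‖(∏ ρ ∈ D, (c - ρ) ^ (m ρ)) * h c‖) :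
    (∑ ρ ∈ D, (m ρ : ℝ)) * Real.log (R / r) ≤ Real.log (M / M₀) := by
  have h1 := norm_center_mul_pow_card_le hr hrR hUR hh hD hM
  have hRr : 0 < R / r := div_pos (hr.trans hrR) hr
  have h2 : (R / r) ^ (∑ ρ ∈ D, m ρ) ≤ M / M₀ := by
    rw [le_div_iff₀ hM₀, mul_comm]
    refine le_trans ?_ h1
    gcongr
  have h3 := Real.log_le_log (by positivity) h2
  rw [Real.log_pow] at h3
  push_cast at h3
  exact h3

theorem logDeriv_prod_pow {ι : Type*} (D : Finset ι) (m : ι → ℕ) (φ : ι → ℂ → ℂ) (s : ℂ)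
    (h0 : ∀ i ∈ D, φ i s ≠ 0) (hd : ∀ i ∈ D, DifferentiableAt ℂ (φ i) s) :
    logDeriv (fun z => ∏ i ∈ D, φ i z ^ m i) s = ∑ i ∈ D, m i * logDeriv (φ i) s := by
  rw [logDeriv_prod (f := fun i z => φ i z ^ m i) (fun i hi => pow_ne_zero _ (h0 i hi))
    (fun i hi => (hd i hi).pow _)]
  exact Finset.sum_congr rfl fun i hi => logDeriv_fun_pow (hd i hi) _

theorem norm_logDeriv_le_of_norm_le {k : ℂ → ℂ} {r' B : ℝ} (hr' : 0 ≤ r') (hr : r' < r)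
    (hk : DifferentiableOn ℂ k (Metric.ball c r)) (hk0 : ∀ s ∈ Metric.ball c r, k s ≠ 0)
    (hB : 0 < B) (hkB : ∀ s ∈ Metric.ball c r, ‖k s‖ ≤ ‖k c‖ * Real.exp B) {s : ℂ}
    (hs : s ∈ Metric.closedBall c r') :
    ‖logDeriv k s‖ ≤ (2 * B * r / ((r - r') / 2)) / ((r - r') / 2) := by
  have hr0 : 0 < r := hr'.trans_lt hr
  have hcb : c ∈ Metric.ball c r := Metric.mem_ball_self hr0
  have hl : DifferentiableOn ℂ (logDeriv k) (Metric.ball c r) :=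
    (hk.deriv Metric.isOpen_ball).div hk hk0
  obtain ⟨q0, hq0⟩ := hl.isExactOn_ball
  set q : ℂ → ℂ := fun z => q0 z - q0 c with hqdef
  have hq : ∀ z ∈ Metric.ball c r, HasDerivAt q (logDeriv k z) z :=
    fun z hz => (hq0 z hz).sub_const _
  have hqc : q c = 0 := by simp [hqdef]
  have hexp : ∀ z ∈ Metric.ball c r, Complex.exp (q z) * k c = k z := by
    have hconst : ∀ z ∈ Metric.ball c r,
        k z * Complex.exp (-q z) = k c * Complex.exp (-q c) := by
      intro z hz
      refine Metric.isOpen_ball.is_const_of_deriv_eq_zero (𝕜 := ℂ)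
        (f := fun z => k z * Complex.exp (-q z))
        (convex_ball c r).isPreconnected ?_ ?_ hz hcb
      · exact hk.mul (fun z hz => (hq z hz).differentiableAt.differentiableWithinAt.neg.cexp)
      · intro z hz
        have h1 : HasDerivAt k (deriv k z) z :=
          (hk.differentiableAt (Metric.isOpen_ball.mem_nhds hz)).hasDerivAt
        have h2 := h1.mul ((hq z hz).neg.cexp)
        have h3 := h2.deriv
        refine Eq.trans h3 ?_
        rw [logDeriv_apply]
        have := hk0 z hz
        field_simp
        simp
    intro z hz
    have := hconst z hz
    rw [hqc, neg_zero, Complex.exp_zero, mul_one] at this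
    rw [← this, mul_comm, mul_assoc, ← Complex.exp_add]
    simp
  have hre : ∀ z ∈ Metric.ball c r, (q z).re ≤ B := by
    intro z hz
    have h1 := hkB z hz
    rw [← hexp z hz, norm_mul, Complex.norm_exp, mul_comm] at h1
    have h2 : 0 < ‖k c‖ := norm_pos_iff.mpr (hk0 c hcb)
    exact Real.exp_le_exp.mp (le_of_mul_le_mul_left h1 h2)
  set e := (r - r') / 2 with he
  have he0 : 0 < e := by rw [he]; linarith
  have hqb : ∀ z ∈ Metric.sphere s e, ‖q z‖ ≤ 2 * B * r / e := by
    intro z hz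
    have hzc : ‖z - c‖ ≤ r - e := by
      have h1 : ‖z - s‖ = e := by simpa [dist_eq_norm] using hz
      have h2 : ‖s - c‖ ≤ r' := by simpa [dist_eq_norm] using hs
      calc ‖z - c‖ = ‖(z - s) + (s - c)‖ := by ring_nf
        _ ≤ e + r' := (norm_add_le _ _).trans (by linarith)
        _ = r - e := by rw [he]; ring
    have h3 := Complex.borelCaratheodory_zero (f := fun w => q (c + w)) (M := B) (R := r)
      (z := z - c) hB ?_ ?_ hr0 ?_ (by simp [hqc])
    · simp only [add_sub_cancel] at h3
      refine h3.trans ?_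
      have : e ≤ r - ‖z - c‖ := by linarith
      have : ‖z - c‖ ≤ r := by linarith
      gcongr
    · intro w hw
      have hw' : c + w ∈ Metric.ball c r := by simpa [dist_eq_norm] using hw
      have h4 := (hq _ hw').differentiableAt
      exact (h4.comp w (by fun_prop : DifferentiableAt ℂ (fun w => c + w) w)).differentiableWithinAt
    · intro w hw
      exact hre _ (by simpa [dist_eq_norm] using hw)
    · simp only [Metric.mem_ball, dist_zero_right]; linarith
  have hsb : Metric.closedBall s e ⊆ Metric.ball c r := by
    apply Metric.closedBall_subset_ball'
    have : dist s c ≤ r' := hs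
    rw [he]; linarith
  have hder := Complex.norm_deriv_le_of_forall_mem_sphere_norm_le (f := q) (c := s) he0 ?_ hqb
  · rwa [(hq s (hsb (Metric.mem_closedBall_self he0.le))).deriv] at hder
  · apply DifferentiableOn.diffContOnCl
    rw [closure_ball s he0.ne']
    exact fun z hz => (hq z (hsb hz)).differentiableAt.differentiableWithinAt

/-- A form of Landau's lemma: the logarithmic derivative of the zero-free part. -/
theorem exists_norm_logDeriv_le (r' r R : ℝ) (hr' : 0 < r') (hr : r' < r) (hrR : r < R) :
    ∃ C : ℝ, 0 < C ∧ ∀ (h : ℂ → ℂ) (U : Set ℂ) (c : ℂ) (D : Finset ℂ) (m : ℂ → ℕ) (M M₀ : ℝ),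
      IsOpen U → Metric.closedBall c R ⊆ U → DifferentiableOn ℂ h U →
      (∀ ρ ∈ D, ‖ρ - c‖ ≤ r) →
      (∀ s ∈ Metric.sphere c R, ‖(∏ ρ ∈ D, (s - ρ) ^ (m ρ)) * h s‖ ≤ M) →
      0 < M₀ → M₀ < M → M₀ ≤ ‖(∏ ρ ∈ D, (c - ρ) ^ (m ρ)) * h c‖ →
      (∀ s ∈ Metric.ball c r, h s ≠ 0) →
      ∀ s ∈ Metric.closedBall c r', ‖logDeriv h s‖ ≤ C * Real.log (M / M₀) := by
  have hr0 : 0 < r := hr'.trans hr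
  have hR0 : 0 < R := hr0.trans hrR
  have hlog : 0 < Real.log (R / r) := Real.log_pos ((one_lt_div hr0).mpr hrR)
  have hRr2 : 0 < R ^ 2 - r ^ 2 := by nlinarith
  refine ⟨2 * r / ((r - r') / 2) / ((r - r') / 2) + r / (R ^ 2 - r ^ 2) / Real.log (R / r), ?_, ?_⟩
  · have : 0 < r - r' := by linarith
    positivity
  intro h U c D m M M₀ hU hUR hh hD hM hM₀ hMM hc h0 s hs
  set B := Real.log (M / M₀) with hBdef
  have hB : 0 < B := Real.log_pos ((one_lt_div hM₀).mpr hMM)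
  set k := blaschkeQuotient h c R D m with hk
  have hbU : Metric.ball c r ⊆ U :=
    (Metric.ball_subset_closedBall.trans (Metric.closedBall_subset_closedBall hrR.le)).trans hUR
  have hsb : s ∈ Metric.ball c r := Metric.closedBall_subset_ball hr hs
  have hfac : ∀ z ∈ Metric.ball c r, ∀ ρ ∈ D,
      ((R : ℂ) ^ 2 - (starRingEnd ℂ) (ρ - c) * (z - c)) ≠ 0 := by
    intro z hz ρ hρ h1
    have hz' : ‖z - c‖ ≤ r := by
      have : dist z c < r := hz
      rw [dist_eq_norm] at this; exact this.le
    have := norm_sq_sub_conj_mul_ge (R := R) hr0.le hz' (hD ρ hρ)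
    rw [h1, norm_zero] at this
    linarith
  have hRC : (R : ℂ) ≠ 0 := by exact_mod_cast hR0.ne'
  have hk0 : ∀ z ∈ Metric.ball c r, k z ≠ 0 := by
    intro z hz
    rw [hk]; unfold blaschkeQuotient
    refine mul_ne_zero (h0 z hz) (Finset.prod_ne_zero_iff.mpr fun ρ hρ => pow_ne_zero _ ?_)
    exact div_ne_zero (hfac z hz ρ hρ) hRC
  have hkc : M₀ ≤ ‖k c‖ := by
    refine hc.trans (le_trans ?_ (norm_center_mul_pow_le hr0 hR0 hD))
    refine le_mul_of_one_le_right (norm_nonneg _) (one_le_pow₀ ?_)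
    exact ((one_lt_div hr0).mpr hrR).le
  have hkB : ∀ z ∈ Metric.ball c r, ‖k z‖ ≤ ‖k c‖ * Real.exp B := by
    intro z hz
    rw [hBdef, Real.exp_log (div_pos (hM₀.trans hMM) hM₀)]
    refine (norm_blaschkeQuotient_le hR0 hUR hh hM (Metric.closedBall_subset_closedBall hrR.le
      (Metric.ball_subset_closedBall hz))).trans ?_
    rw [mul_div_assoc', le_div_iff₀ hM₀, mul_comm]
    have : 0 < M := hM₀.trans hMM
    gcongr
  have h1 := norm_logDeriv_le_of_norm_le hr'.le hr
    ((differentiableOn_blaschkeQuotient hh).mono hbU) hk0 hB hkB hs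
  have hsum : (∑ ρ ∈ D, (m ρ : ℝ)) ≤ B / Real.log (R / r) := by
    rw [le_div_iff₀ hlog]
    exact sum_multiplicity_le hr0 hrR hUR hh hD hM hM₀ hc
  have hlk : logDeriv k s = logDeriv h s +
      ∑ ρ ∈ D, m ρ * (-(starRingEnd ℂ) (ρ - c) /
        ((R : ℂ) ^ 2 - (starRingEnd ℂ) (ρ - c) * (s - c))) := by
    have hd : ∀ ρ ∈ D, DifferentiableAt ℂ
        (fun z => ((R : ℂ) ^ 2 - (starRingEnd ℂ) (ρ - c) * (z - c)) / R) s := by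
      intro ρ _; fun_prop
    have hn : ∀ ρ ∈ D, ((R : ℂ) ^ 2 - (starRingEnd ℂ) (ρ - c) * (s - c)) / R ≠ 0 :=
      fun ρ hρ => div_ne_zero (hfac s hsb ρ hρ) hRC
    have h5 := logDeriv_prod_pow D m
      (fun ρ z => ((R : ℂ) ^ 2 - (starRingEnd ℂ) (ρ - c) * (z - c)) / R) s hn hd
    have h6 : k = fun z => h z *
        (fun z => ∏ ρ ∈ D, (((R : ℂ) ^ 2 - (starRingEnd ℂ) (ρ - c) * (z - c)) / R) ^ m ρ) z := rfl
    rw [h6, logDeriv_mul s (h0 s hsb) ?_ ?_ ?_, h5]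
    · congr 1
      refine Finset.sum_congr rfl fun ρ hρ => ?_
      congr 1
      have h7 : HasDerivAt (fun z => ((R : ℂ) ^ 2 - (starRingEnd ℂ) (ρ - c) * (z - c)) / R)
          ((-((starRingEnd ℂ) (ρ - c) * 1)) / R) s :=
        ((((hasDerivAt_id s).sub_const c).const_mul _).const_sub _).div_const _
      rw [logDeriv_apply, h7.deriv, mul_one]
      have := hfac s hsb ρ hρ
      field_simp
    · exact Finset.prod_ne_zero_iff.mpr fun ρ hρ => pow_ne_zero _ (hn ρ hρ)
    · exact hh.differentiableAt (hU.mem_nhds (hbU hsb))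
    · apply DifferentiableAt.fun_finsetProd
      intro i hi
      exact (hd i hi).pow _
  have hs' : ‖s - c‖ ≤ r := by
    have : dist s c < r := hsb
    rw [dist_eq_norm] at this; exact this.le
  have hbd : ‖∑ ρ ∈ D, (m ρ : ℂ) * (-(starRingEnd ℂ) (ρ - c) /
        ((R : ℂ) ^ 2 - (starRingEnd ℂ) (ρ - c) * (s - c)))‖ ≤
        B / Real.log (R / r) * (r / (R ^ 2 - r ^ 2)) := by
    refine (norm_sum_le _ _).trans ?_
    calc _ ≤ ∑ ρ ∈ D, (m ρ : ℝ) * (r / (R ^ 2 - r ^ 2)) := by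
          refine Finset.sum_le_sum fun ρ hρ => ?_
          rw [norm_mul, norm_div, norm_neg, RCLike.norm_conj, Complex.norm_natCast]
          have := norm_sq_sub_conj_mul_ge (R := R) hr0.le hs' (hD ρ hρ)
          have := hD ρ hρ
          gcongr
      _ = (∑ ρ ∈ D, (m ρ : ℝ)) * (r / (R ^ 2 - r ^ 2)) := by rw [Finset.sum_mul]
      _ ≤ _ := by gcongr
  have h8 : logDeriv h s = logDeriv k s - ∑ ρ ∈ D, m ρ * (-(starRingEnd ℂ) (ρ - c) /
        ((R : ℂ) ^ 2 - (starRingEnd ℂ) (ρ - c) * (s - c))) := by rw [hlk]; ring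
  rw [h8]
  refine (norm_sub_le _ _).trans ((add_le_add h1 hbd).trans (le_of_eq ?_))
  ring

end Local

/-- The two-sided Laplace transform `∫ w(v) e^{sv} dv`. -/
noncomputable def laplaceTransform (w : ℝ → ℝ) (s : ℂ) : ℂ :=
  ∫ v : ℝ, (w v : ℂ) * Complex.exp (s * v)

section LaplaceTransform

open MeasureTheory

lemma norm_ofReal_mul_exp_mul (x : ℝ) (s : ℂ) (v : ℝ) :
    ‖(x : ℂ) * Complex.exp (s * v)‖ = |x| * Real.exp (s.re * v) := by
  rw [norm_mul, Complex.norm_exp, Complex.norm_real, Real.norm_eq_abs]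
  simp

lemma HasCompactSupport.ofReal_mul {w : ℝ → ℝ} (hc : HasCompactSupport w) (g : ℝ → ℂ) :
    HasCompactSupport fun v => (w v : ℂ) * g v := by
  refine HasCompactSupport.intro hc.isCompact fun v hv => ?_
  rw [image_eq_zero_of_notMem_tsupport hv]
  simp

lemma integrable_ofReal_mul_of_hasCompactSupport {w : ℝ → ℝ} (hw : Continuous w)
    (hc : HasCompactSupport w) {g : ℝ → ℂ} (hg : Continuous g) :
    Integrable fun v => (w v : ℂ) * g v :=
  Continuous.integrable_of_hasCompactSupport (by fun_prop) (hc.ofReal_mul g)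

lemma laplaceTransform_deriv {w : ℝ → ℝ} (hw : ContDiff ℝ 1 w) (hc : HasCompactSupport w) (s : ℂ) :
    laplaceTransform (deriv w) s = -s * laplaceTransform w s := by
  have hcont : Continuous w := hw.continuous
  have hd : Continuous (deriv w) := hw.continuous_deriv le_rfl
  have i1 : Integrable fun v : ℝ => (w v : ℂ) * Complex.exp (s * v) :=
    integrable_ofReal_mul_of_hasCompactSupport hcont hc (by fun_prop)
  have i2 : Integrable fun v : ℝ => ((deriv w v : ℝ) : ℂ) * Complex.exp (s * v) :=
    integrable_ofReal_mul_of_hasCompactSupport hd hc.deriv (by fun_prop)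
  have key := integral_eq_zero_of_hasDerivAt_of_integrable
    (f := fun v : ℝ => (w v : ℂ) * Complex.exp (s * v))
    (f' := fun v : ℝ => ((deriv w v : ℝ) : ℂ) * Complex.exp (s * v)
      + s * ((w v : ℂ) * Complex.exp (s * v))) ?_ (i2.add (i1.const_mul s)) i1
  · rw [integral_add i2 (i1.const_mul s), integral_const_mul] at key
    unfold laplaceTransform
    linear_combination key
  · intro v
    have h1 : HasDerivAt (fun v : ℝ => (w v : ℂ)) ((deriv w v : ℝ) : ℂ) v :=
      ((hw.differentiable (by norm_num)).differentiableAt.hasDerivAt).ofReal_comp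
    have h2 : HasDerivAt (fun v : ℝ => Complex.exp (s * v)) (Complex.exp (s * v) * (s * 1)) v :=
      (((hasDerivAt_id (v : ℂ)).const_mul s).cexp).comp_ofReal
    refine (h1.mul h2).congr_deriv ?_
    ring

lemma laplaceTransform_iteratedDeriv {w : ℝ → ℝ} (hw : ∀ n : ℕ, ContDiff ℝ n w)
    (hc : HasCompactSupport w) (s : ℂ) (K : ℕ) :
    laplaceTransform (iteratedDeriv K w) s = (-s) ^ K * laplaceTransform w s := by
  have hcK : ∀ K : ℕ, HasCompactSupport (iteratedDeriv K w) := by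
    intro K
    induction K with
    | zero => simpa using hc
    | succ K ih => rw [iteratedDeriv_succ]; exact ih.deriv
  induction K with
  | zero => simp
  | succ K ih =>
    have h1 : ContDiff ℝ 1 (iteratedDeriv K w) := by
      have := hw (1 + K)
      push_cast at this
      rw [iteratedDeriv_eq_iterate]
      exact_mod_cast ContDiff.iterate_deriv' 1 K (by exact_mod_cast this)
    rw [iteratedDeriv_succ, laplaceTransform_deriv h1 (hcK K), ih]
    ring

lemma differentiableAt_laplaceTransform {w : ℝ → ℝ} (hw : Continuous w) (hc : HasCompactSupport w) (s : ℂ) :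
    DifferentiableAt ℂ (laplaceTransform w) s := by
  have hmeas : ∀ z : ℂ, AEStronglyMeasurable (fun v : ℝ => (w v : ℂ) * Complex.exp (z * v)) :=
    fun z => (by fun_prop : Continuous fun v : ℝ => (w v : ℂ) * Complex.exp (z * v)).aestronglyMeasurable
  have := hasDerivAt_integral_of_dominated_loc_of_deriv_le (μ := volume)
    (F := fun (z : ℂ) (v : ℝ) => (w v : ℂ) * Complex.exp (z * v))
    (F' := fun (z : ℂ) (v : ℝ) => (w v : ℂ) * (Complex.exp (z * v) * v)) (x₀ := s)
    (bound := fun v => |w v| * (Real.exp ((|s.re| + 1) * |v|) * |v|))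
    (s := Metric.ball s 1) (Metric.ball_mem_nhds s one_pos)
    (Eventually.of_forall hmeas)
    (integrable_ofReal_mul_of_hasCompactSupport hw hc (by fun_prop))
    ((by fun_prop : Continuous fun v : ℝ =>
      (w v : ℂ) * (Complex.exp (s * v) * v)).aestronglyMeasurable)
    (Eventually.of_forall fun v z hz => ?_) ?_ (Eventually.of_forall fun v z hz => ?_)
  · exact this.2.differentiableAt
  · rw [norm_mul, norm_mul, Complex.norm_exp, Complex.norm_real, Complex.norm_real,
      Real.norm_eq_abs, Real.norm_eq_abs]
    gcongr
    have h1 : (z * v).re = z.re * v := by simp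
    rw [h1]
    have h2 : |z.re| ≤ |s.re| + 1 := by
      have := (Complex.abs_re_le_norm (z - s)).trans (mem_ball_iff_norm.1 hz).le
      rw [Complex.sub_re] at this
      have := abs_sub_abs_le_abs_sub z.re s.re
      linarith
    calc z.re * v ≤ |z.re * v| := le_abs_self _
      _ = |z.re| * |v| := abs_mul _ _
      _ ≤ _ := by gcongr
  · refine Continuous.integrable_of_hasCompactSupport (by fun_prop) ?_
    refine HasCompactSupport.intro hc.isCompact fun v hv => ?_
    rw [image_eq_zero_of_notMem_tsupport hv]
    simp
  · have h2 : HasDerivAt (fun z : ℂ => Complex.exp (z * v)) (Complex.exp (z * v) * (1 * v)) z :=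
      ((hasDerivAt_id z).mul_const (v : ℂ)).cexp
    simpa using h2.const_mul (w v : ℂ)

lemma norm_laplaceTransform_le_integral (w : ℝ → ℝ) (s : ℂ) :
    ‖laplaceTransform w s‖ ≤ ∫ v, |w v| * Real.exp (s.re * v) := by
  refine (norm_integral_le_integral_norm _).trans_eq ?_
  simp_rw [norm_ofReal_mul_exp_mul]

/-- Fourier inversion for the Laplace transform on a vertical line. -/
lemma integral_laplaceTransform_mul_exp {w : ℝ → ℝ} (hw : Continuous w) (hc : HasCompactSupport w)
    (σ : ℝ) (hi : Integrable fun t : ℝ => laplaceTransform w (σ + t * Complex.I)) (v : ℝ) :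
    ∫ t : ℝ, laplaceTransform w (σ + t * Complex.I) * Complex.exp (-(σ + t * Complex.I) * v)
      = 2 * Real.pi * w v := by
  have hpi := Real.pi_pos
  set g : ℝ → ℂ := fun v => (w v : ℂ) * Complex.exp (σ * v) with hg
  have hF : FourierTransform.fourier g
      = fun ξ : ℝ => laplaceTransform w (σ + ((-2 * Real.pi) * ξ : ℝ) * Complex.I) := by
    funext ξ
    rw [Real.fourier_real_eq_integral_exp_smul]
    unfold laplaceTransform
    congr 1
    funext v
    rw [hg, smul_eq_mul, mul_left_comm, ← Complex.exp_add]
    congr 2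
    push_cast
    ring
  have hinv := Continuous.fourierInv_fourier_eq (f := g) (by fun_prop)
    (integrable_ofReal_mul_of_hasCompactSupport hw hc (by fun_prop))
    (by rw [hF]; exact hi.comp_mul_left' (by nlinarith))
  have h1 := congrFun hinv v
  rw [Real.fourierInv_eq', hF] at h1
  have h2 := Measure.integral_comp_mul_left (fun t : ℝ =>
    laplaceTransform w (σ + t * Complex.I) * Complex.exp (-(σ + t * Complex.I) * v)) (-2 * Real.pi)
  have h3 : ∫ x : ℝ, (fun t : ℝ => laplaceTransform w (σ + t * Complex.I)
      * Complex.exp (-(σ + t * Complex.I) * v)) (-2 * Real.pi * x)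
      = Complex.exp (-σ * v) * g v := by
    rw [← h1, ← integral_const_mul]
    congr 1
    funext ξ
    simp only [smul_eq_mul, inner]
    rw [mul_left_comm, mul_comm (laplaceTransform _ _), ← mul_assoc, ← Complex.exp_add]
    congr 2
    push_cast
    simp
    ring
  rw [h3] at h2
  have h4 : Complex.exp (-σ * v) * g v = w v := by
    rw [hg, mul_left_comm, ← Complex.exp_add]
    simp
  rw [h4, abs_of_neg (by rw [inv_lt_zero]; linarith)] at h2
  have : (Real.pi : ℂ) ≠ 0 := by exact_mod_cast hpi.ne'
  rw [h2, Complex.real_smul, ← mul_assoc]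
  symm
  convert one_mul _ using 2
  push_cast
  field_simp

end LaplaceTransform

/-- A smooth window equal to `1` on `[a + δ, b]` and supported in `[a, b + δ]`. -/
noncomputable def smoothWindow (a b δ : ℝ) (v : ℝ) : ℝ :=
  Real.smoothTransition ((v - a) / δ) - Real.smoothTransition ((v - b) / δ)

section SmoothWindow

open MeasureTheory

variable {a b δ : ℝ}

lemma smoothWindow_contDiff (a b δ : ℝ) (n : ℕ) : ContDiff ℝ n (smoothWindow a b δ) := by
  have h : ContDiff ℝ n Real.smoothTransition := by
    exact_mod_cast Real.smoothTransition.contDiff (n := (n : ℕ∞))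
  exact (h.comp (by fun_prop)).sub (h.comp (by fun_prop))

lemma smoothWindow_continuous (a b δ : ℝ) : Continuous (smoothWindow a b δ) :=
  (smoothWindow_contDiff a b δ 0).continuous

lemma smoothWindow_nonneg (hab : a ≤ b) (hδ : 0 < δ) (v : ℝ) : 0 ≤ smoothWindow a b δ v :=
  sub_nonneg.2 (Real.smoothTransition.monotone (by gcongr))

lemma smoothWindow_le_one (v : ℝ) : smoothWindow a b δ v ≤ 1 := by
  have h1 := Real.smoothTransition.le_one ((v - a) / δ)
  have h2 := Real.smoothTransition.nonneg ((v - b) / δ)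
  unfold smoothWindow
  linarith

lemma smoothWindow_of_le (hab : a ≤ b) (hδ : 0 < δ) {v : ℝ} (hv : v ≤ a) :
    smoothWindow a b δ v = 0 := by
  unfold smoothWindow
  rw [Real.smoothTransition.zero_of_nonpos (div_nonpos_of_nonpos_of_nonneg (by linarith) hδ.le),
    Real.smoothTransition.zero_of_nonpos (div_nonpos_of_nonpos_of_nonneg (by linarith) hδ.le),
    sub_zero]

lemma smoothWindow_of_ge (hab : a ≤ b) (hδ : 0 < δ) {v : ℝ} (hv : b + δ ≤ v) :
    smoothWindow a b δ v = 0 := by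
  unfold smoothWindow
  rw [Real.smoothTransition.one_of_one_le ((one_le_div hδ).2 (by linarith)),
    Real.smoothTransition.one_of_one_le ((one_le_div hδ).2 (by linarith)), sub_self]

lemma smoothWindow_eq_one (hδ : 0 < δ) {v : ℝ} (h1 : a + δ ≤ v) (h2 : v ≤ b) :
    smoothWindow a b δ v = 1 := by
  unfold smoothWindow
  rw [Real.smoothTransition.one_of_one_le ((one_le_div hδ).2 (by linarith)),
    Real.smoothTransition.zero_of_nonpos (div_nonpos_of_nonpos_of_nonneg (by linarith) hδ.le),
    sub_zero]

lemma smoothWindow_eq_zero_of_notMem (hab : a ≤ b) (hδ : 0 < δ) {v : ℝ}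
    (hv : v ∉ Set.Icc a (b + δ)) : smoothWindow a b δ v = 0 := by
  rw [Set.mem_Icc, not_and_or, not_le, not_le] at hv
  rcases hv with hv | hv
  · exact smoothWindow_of_le hab hδ hv.le
  · exact smoothWindow_of_ge hab hδ hv.le

lemma smoothWindow_hasCompactSupport (hab : a ≤ b) (hδ : 0 < δ) :
    HasCompactSupport (smoothWindow a b δ) :=
  HasCompactSupport.intro (isCompact_Icc (a := a) (b := b + δ))
    fun _ hv => smoothWindow_eq_zero_of_notMem hab hδ hv

lemma integral_abs_mul_le_of_support_Icc {f g : ℝ → ℝ} {a b B M : ℝ} (hab : a ≤ b) (hB : 0 ≤ B)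
    (hf : ∀ v, |f v| ≤ B) (hf0 : ∀ v ∉ Set.Icc a b, f v = 0) (hg0 : ∀ v, 0 ≤ g v)
    (hg : ∀ v ∈ Set.Icc a b, g v ≤ M) : ∫ v, |f v| * g v ≤ B * M * (b - a) := by
  have h1 : ∫ v, |f v| * g v = ∫ v in Set.Icc a b, |f v| * g v := by
    rw [setIntegral_eq_integral_of_forall_compl_eq_zero]
    intro v hv
    rw [hf0 v hv]
    simp
  rw [h1]
  refine (le_abs_self _).trans ?_
  have := norm_setIntegral_le_of_norm_le_const (f := fun v => |f v| * g v) (s := Set.Icc a b)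
    (μ := volume) (C := B * M) (by simp) (fun v hv => ?_)
  · simpa [hab] using this
  · rw [Real.norm_eq_abs, abs_mul, abs_abs, abs_of_nonneg (hg0 v)]
    exact mul_le_mul (hf v) (hg v hv) (hg0 v) hB

lemma norm_laplaceTransform_smoothWindow_le (hab : a ≤ b) (hδ : 0 < δ) {s : ℂ} {M : ℝ}
    (hM : ∀ v ∈ Set.Icc a (b + δ), Real.exp (s.re * v) ≤ M) :
    ‖laplaceTransform (smoothWindow a b δ) s‖ ≤ (b - a + δ) * M := by
  refine (norm_laplaceTransform_le_integral _ _).trans ?_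
  refine (integral_abs_mul_le_of_support_Icc (a := a) (b := b + δ) (B := 1) (by linarith)
    zero_le_one (fun v => ?_) (fun v hv => smoothWindow_eq_zero_of_notMem hab hδ hv)
    (fun v => (Real.exp_pos _).le) hM).trans_eq (by ring)
  rw [abs_of_nonneg (smoothWindow_nonneg hab hδ v)]
  exact smoothWindow_le_one v

lemma iteratedDeriv_smoothTransition_eq_zero {K : ℕ} (hK : K ≠ 0) {u : ℝ}
    (hu : u ∉ Set.Icc (0 : ℝ) 1) : iteratedDeriv K Real.smoothTransition u = 0 := by
  have hconst : ∀ c : ℝ, Real.smoothTransition =ᶠ[𝓝 u] (fun _ => c) →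
      iteratedDeriv K Real.smoothTransition u = 0 := by
    intro c h
    rw [h.iteratedDeriv_eq]
    simp [iteratedDeriv_const, hK]
  rw [Set.mem_Icc, not_and_or, not_le, not_le] at hu
  rcases hu with hu | hu
  · refine hconst 0 ?_
    filter_upwards [Iio_mem_nhds hu] with x hx
    exact Real.smoothTransition.zero_of_nonpos (le_of_lt hx)
  · refine hconst 1 ?_
    filter_upwards [Ioi_mem_nhds hu] with x hx
    exact Real.smoothTransition.one_of_one_le (le_of_lt hx)

lemma exists_abs_iteratedDeriv_smoothTransition_le (K : ℕ) :
    ∃ B : ℝ, 0 ≤ B ∧ ∀ u, |iteratedDeriv K Real.smoothTransition u| ≤ B := by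
  rcases eq_or_ne K 0 with rfl | hK
  · refine ⟨1, zero_le_one, fun u => ?_⟩
    rw [iteratedDeriv_zero, abs_of_nonneg (Real.smoothTransition.nonneg u)]
    exact Real.smoothTransition.le_one u
  · have hcont : Continuous (iteratedDeriv K Real.smoothTransition) :=
      (Real.smoothTransition.contDiff (n := (K : ℕ∞))).continuous_iteratedDeriv K (by simp)
    obtain ⟨B, hB⟩ := isCompact_Icc (a := (0 : ℝ)) (b := 1) |>.exists_bound_of_continuousOn
      hcont.continuousOn
    have hB0 : 0 ≤ B := (norm_nonneg _).trans (hB 0 (by simp))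
    refine ⟨B, hB0, fun u => ?_⟩
    by_cases hu : u ∈ Set.Icc (0 : ℝ) 1
    · exact hB u hu
    · rw [iteratedDeriv_smoothTransition_eq_zero hK hu]
      simpa using hB0

lemma iteratedDeriv_smoothWindow (a b δ : ℝ) (K : ℕ) (v : ℝ) :
    iteratedDeriv K (smoothWindow a b δ) v =
      δ⁻¹ ^ K * iteratedDeriv K Real.smoothTransition ((v - a) / δ)
        - δ⁻¹ ^ K * iteratedDeriv K Real.smoothTransition ((v - b) / δ) := by
  have h : ContDiff ℝ K Real.smoothTransition := by
    exact_mod_cast Real.smoothTransition.contDiff (n := (K : ℕ∞))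
  have key : ∀ c : ℝ, iteratedDeriv K (fun v => Real.smoothTransition ((v - c) / δ)) v
      = δ⁻¹ ^ K * iteratedDeriv K Real.smoothTransition ((v - c) / δ) := by
    intro c
    have h1 : (fun v => Real.smoothTransition ((v - c) / δ))
        = fun v => (fun x => Real.smoothTransition (δ⁻¹ * x)) (v - c) := by
      funext v
      simp only
      congr 1
      ring
    rw [h1, iteratedDeriv_comp_sub_const K (fun x => Real.smoothTransition (δ⁻¹ * x)) c,
      iteratedDeriv_comp_const_mul h]
    simp only
    congr 2
    ring
  unfold smoothWindow
  have hcd : ∀ c : ℝ, ContDiffAt ℝ K (fun v => Real.smoothTransition ((v - c) / δ)) v :=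
    fun c => (h.comp (by fun_prop : ContDiff ℝ K fun v : ℝ => (v - c) / δ)).contDiffAt
  rw [iteratedDeriv_fun_sub (hcd a) (hcd b), key, key]

lemma exists_norm_laplaceTransform_smoothWindow_le_pow (K : ℕ) (hK : K ≠ 0) :
    ∃ C : ℝ, 0 ≤ C ∧ ∀ (a b δ M : ℝ) (s : ℂ), a ≤ b → 0 < δ →
      (∀ v ∈ Set.Icc a (b + δ), Real.exp (s.re * v) ≤ M) →
      ‖s‖ ^ K * ‖laplaceTransform (smoothWindow a b δ) s‖ ≤ C * M * δ⁻¹ ^ (K - 1) := by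
  obtain ⟨B, hB0, hB⟩ := exists_abs_iteratedDeriv_smoothTransition_le K
  refine ⟨2 * B, by positivity, fun a b δ M s hab hδ hM => ?_⟩
  have h1 := laplaceTransform_iteratedDeriv (smoothWindow_contDiff a b δ)
    (smoothWindow_hasCompactSupport hab hδ) s K
  have h2 := norm_laplaceTransform_le_integral (iteratedDeriv K (smoothWindow a b δ)) s
  rw [h1, norm_mul, norm_pow, norm_neg] at h2
  refine h2.trans ?_
  have hS : Continuous (iteratedDeriv K Real.smoothTransition) :=
    (Real.smoothTransition.contDiff (n := (K : ℕ∞))).continuous_iteratedDeriv K (by simp)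
  set f : ℝ → ℝ → ℝ := fun c v => δ⁻¹ ^ K * iteratedDeriv K Real.smoothTransition ((v - c) / δ)
    with hf
  have hf0 : ∀ c, ∀ v ∉ Set.Icc c (c + δ), f c v = 0 := by
    intro c v hv
    rw [hf]
    simp only
    rw [iteratedDeriv_smoothTransition_eq_zero hK, mul_zero]
    contrapose! hv
    rw [Set.mem_Icc, le_div_iff₀ hδ, div_le_iff₀ hδ] at hv
    exact ⟨by linarith [hv.1], by linarith [hv.2]⟩
  have hfb : ∀ c v, |f c v| ≤ δ⁻¹ ^ K * B := by
    intro c v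
    rw [hf, abs_mul, abs_of_nonneg (by positivity : (0 : ℝ) ≤ δ⁻¹ ^ K)]
    gcongr
    exact hB _
  have hfi : ∀ c, Integrable fun v => |f c v| * Real.exp (s.re * v) := by
    intro c
    refine Continuous.integrable_of_hasCompactSupport (by fun_prop) ?_
    refine HasCompactSupport.intro (isCompact_Icc (a := c) (b := c + δ)) fun v hv => ?_
    rw [hf0 c v hv]
    simp
  have hsum : ∫ v, |iteratedDeriv K (smoothWindow a b δ) v| * Real.exp (s.re * v)
      ≤ (∫ v, |f a v| * Real.exp (s.re * v)) + ∫ v, |f b v| * Real.exp (s.re * v) := by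
    rw [← integral_add (hfi a) (hfi b)]
    refine integral_mono_of_nonneg (Eventually.of_forall fun v => by positivity)
      ((hfi a).add (hfi b)) (Eventually.of_forall fun v => ?_)
    simp only
    rw [iteratedDeriv_smoothWindow, ← add_mul]
    gcongr
    exact abs_sub _ _
  have hI : ∀ c, a ≤ c → c ≤ b → ∫ v, |f c v| * Real.exp (s.re * v) ≤ B * M * δ⁻¹ ^ (K - 1) := by
    intro c hac hcb
    refine (integral_abs_mul_le_of_support_Icc (by linarith) (by positivity) (hfb c) (hf0 c)
      (fun v => (Real.exp_pos _).le) (fun v hv => hM v ⟨hac.trans hv.1, hv.2.trans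
        (by linarith)⟩)).trans_eq ?_
    obtain ⟨k, rfl⟩ := Nat.exists_eq_succ_of_ne_zero hK
    simp only [Nat.succ_eq_add_one, Nat.add_sub_cancel, pow_succ, add_sub_cancel_left]
    field_simp
  have := hI a le_rfl hab
  have := hI b hab le_rfl
  linarith

lemma integrable_laplaceTransform_smoothWindow (hab : a ≤ b) (hδ : 0 < δ) (σ : ℝ) :
    Integrable fun t : ℝ => laplaceTransform (smoothWindow a b δ) (σ + t * Complex.I) := by
  obtain ⟨C, hC0, hC⟩ := exists_norm_laplaceTransform_smoothWindow_le_pow 2 two_ne_zero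
  obtain ⟨M, hM⟩ := (isCompact_Icc (a := a) (b := b + δ)).exists_bound_of_continuousOn
    (f := fun v => Real.exp (σ * v)) (by fun_prop)
  have hM' : ∀ v ∈ Set.Icc a (b + δ), Real.exp (σ * v) ≤ M := fun v hv =>
    (le_abs_self _).trans (hM v hv)
  have hcont : Continuous fun t : ℝ => laplaceTransform (smoothWindow a b δ) (σ + t * Complex.I) := by
    have : Continuous (laplaceTransform (smoothWindow a b δ)) :=
      continuous_iff_continuousAt.2 fun s => (differentiableAt_laplaceTransform
        (smoothWindow_continuous a b δ) (smoothWindow_hasCompactSupport hab hδ) s).continuousAt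
    fun_prop
  refine Integrable.mono' (integrable_inv_one_add_sq.const_mul
    ((b - a + δ) * M + C * M * δ⁻¹)) hcont.aestronglyMeasurable (Eventually.of_forall fun t => ?_)
  have hre : ((σ : ℂ) + t * Complex.I).re = σ := by simp
  have h1 := norm_laplaceTransform_smoothWindow_le (s := σ + t * Complex.I) (M := M) hab hδ
    (by rw [hre]; exact hM')
  have h2 := hC a b δ M (σ + t * Complex.I) hab hδ (by rw [hre]; exact hM')
  have h3 : t ^ 2 ≤ ‖(σ : ℂ) + t * Complex.I‖ ^ 2 := by
    rw [← Complex.normSq_eq_norm_sq, Complex.normSq_apply]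
    simp
    nlinarith
  have h4 := mul_le_mul_of_nonneg_right h3
    (norm_nonneg (laplaceTransform (smoothWindow a b δ) (σ + t * Complex.I)))
  rw [← div_eq_mul_inv, le_div_iff₀ (by positivity)]
  simp at h2
  linarith

lemma integral_laplaceTransform_smoothWindow_mul_exp (hab : a ≤ b) (hδ : 0 < δ) (σ v : ℝ) :
    ∫ t : ℝ, laplaceTransform (smoothWindow a b δ) (σ + t * Complex.I)
      * Complex.exp (-(σ + t * Complex.I) * v) = 2 * Real.pi * smoothWindow a b δ v :=
  integral_laplaceTransform_mul_exp (smoothWindow_continuous a b δ)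
    (smoothWindow_hasCompactSupport hab hδ) σ
    (integrable_laplaceTransform_smoothWindow hab hδ σ) v

end SmoothWindow

namespace BeurlingSystem

open MeasureTheory

variable (S : BeurlingSystem)

lemma p_pos (k : ℕ) : 0 < S.p k := zero_lt_one.trans (S.one_lt_p k)

lemma val_zero : S.val 0 = 1 := by simp [val]

lemma val_add (m n : ℕ →₀ ℕ) : S.val (m + n) = S.val m * S.val n :=
  Finsupp.prod_add_index' (by simp) (fun _ _ _ => pow_add _ _ _)

lemma val_single (k e : ℕ) : S.val (Finsupp.single k e) = S.p k ^ e :=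
  Finsupp.prod_single_index (pow_zero _)

lemma one_le_val (n : ℕ →₀ ℕ) : 1 ≤ S.val n :=
  Finset.one_le_prod fun k _ => one_le_pow₀ (S.one_lt_p k).le

lemma val_pos (n : ℕ →₀ ℕ) : 0 < S.val n := zero_lt_one.trans_le (S.one_le_val n)

lemma val_mono {m n : ℕ →₀ ℕ} (h : m ≤ n) : S.val m ≤ S.val n := by
  rw [← add_tsub_cancel_of_le h, val_add]
  exact le_mul_of_one_le_right (S.val_pos m).le (S.one_le_val _)

lemma pow_le_val (n : ℕ →₀ ℕ) (k : ℕ) : S.p k ^ n k ≤ S.val n := by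
  rw [← val_single]
  exact S.val_mono (Finsupp.single_le_iff.2 le_rfl)

lemma p_le_val {n : ℕ →₀ ℕ} {k : ℕ} (hk : k ∈ n.support) : S.p k ≤ S.val n :=
  (le_self_pow₀ (S.one_lt_p k).le (Finsupp.mem_support_iff.1 hk)).trans (S.pow_le_val n k)

lemma one_lt_val {n : ℕ →₀ ℕ} (hn : n ≠ 0) : 1 < S.val n := by
  obtain ⟨k, hk⟩ := Finsupp.support_nonempty_iff.2 hn
  exact (S.one_lt_p k).trans_le (S.p_le_val hk)

lemma log_val_nonneg (n : ℕ →₀ ℕ) : 0 ≤ Real.log (S.val n) := Real.log_nonneg (S.one_le_val n)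

lemma log_val (n : ℕ →₀ ℕ) : Real.log (S.val n) = ∑ k ∈ n.support, n k * Real.log (S.p k) := by
  unfold val Finsupp.prod
  rw [Real.log_prod fun k _ => (pow_pos (S.p_pos k) _).ne']
  simp

lemma finite_val_le (x : ℝ) : {n : ℕ →₀ ℕ | S.val n ≤ x}.Finite := by
  obtain ⟨K, hK⟩ := eventually_atTop.1 (S.p_tendsto.eventually_gt_atTop x)
  obtain ⟨E, hE⟩ := pow_unbounded_of_one_lt x (S.one_lt_p 0)
  refine (Set.finite_Iic (∑ k ∈ Finset.range K, Finsupp.single k E)).subset fun n hn => ?_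
  rw [Set.mem_Iic]
  intro k
  rw [Set.mem_ofPred_eq] at hn
  by_cases hk : k ∈ n.support
  · have hkK : k < K := by
      by_contra! h
      exact absurd ((S.p_le_val hk).trans hn) (not_le.2 (hK k h))
    have hkE : n k ≤ E := by
      by_contra! h
      have h1 : S.p 0 ^ E ≤ S.p 0 ^ n k := pow_le_pow_right₀ (S.one_lt_p 0).le h.le
      have h2 : S.p 0 ^ n k ≤ S.p k ^ n k :=
        pow_le_pow_left₀ (S.p_pos 0).le (S.p_mono (Nat.zero_le k)) _
      linarith [S.pow_le_val n k]
    rw [Finsupp.finsetSum_apply]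
    simpa [Finsupp.single_apply, hkK] using hkE
  · rw [Finsupp.notMem_support_iff.1 hk]
    exact Nat.zero_le _

lemma vonMangoldt_single {k j : ℕ} (hj : j ≠ 0) :
    S.vonMangoldt (Finsupp.single k j) = Real.log (S.p k) := by
  unfold vonMangoldt
  rw [Finsupp.support_single k hj]
  simp

lemma vonMangoldt_eq_zero {n : ℕ →₀ ℕ} (h : ∀ k j, j ≠ 0 → n ≠ Finsupp.single k j) :
    S.vonMangoldt n = 0 := by
  refine Finset.sum_eq_zero fun k hk => if_neg fun hs => ?_
  exact h k (n k) (Finsupp.mem_support_iff.1 hk) (Finsupp.support_eq_singleton.1 hs).2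

lemma vonMangoldt_nonneg (n : ℕ →₀ ℕ) : 0 ≤ S.vonMangoldt n := by
  refine Finset.sum_nonneg fun k _ => ?_
  split_ifs
  · exact Real.log_nonneg (S.one_lt_p k).le
  · exact le_rfl

lemma sum_antidiagonal_vonMangoldt (n : ℕ →₀ ℕ) :
    ∑ q ∈ Finset.HasAntidiagonal.antidiagonal n, S.vonMangoldt q.1 = Real.log (S.val n) := by
  rw [log_val]
  have h1 : ∑ k ∈ n.support, (n k : ℝ) * Real.log (S.p k)
      = ∑ x ∈ n.support.sigma fun k => Finset.Icc 1 (n k), Real.log (S.p x.1) := by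
    rw [Finset.sum_sigma]
    simp
  rw [h1]
  symm
  refine Finset.sum_of_injOn
    (fun x : (_ : ℕ) × ℕ => (Finsupp.single x.1 x.2, n - Finsupp.single x.1 x.2)) ?_ ?_ ?_ ?_
  · rintro ⟨k, j⟩ hx ⟨k', j'⟩ hx' h
    simp only [Prod.mk.injEq, Finset.coe_sigma, Set.mem_sigma_iff, Finset.mem_coe,
      Finset.mem_Icc] at h hx hx'
    rw [Finsupp.single_eq_single_iff] at h
    rcases h.1 with h | h
    · rw [h.1, h.2]
    · omega
  · rintro ⟨k, j⟩ hx
    simp only [Finset.coe_sigma, Set.mem_sigma_iff, Finset.mem_coe, Finset.mem_Icc] at hx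
    simp only [Finset.mem_coe, Finset.HasAntidiagonal.mem_antidiagonal]
    exact add_tsub_cancel_of_le (Finsupp.single_le_iff.2 hx.2.2)
  · rintro ⟨q, r⟩ hq hne
    refine S.vonMangoldt_eq_zero fun k j hj hqk => hne ?_
    simp only at hqk
    rw [Finset.HasAntidiagonal.mem_antidiagonal] at hq
    simp only at hq
    refine ⟨⟨k, j⟩, ?_, ?_⟩
    · have hjk : j ≤ n k := by
        rw [← hq, hqk]
        simp
      simp only [Finset.coe_sigma, Set.mem_sigma_iff, Finset.mem_coe, Finset.mem_Icc,
        Finsupp.mem_support_iff]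
      exact ⟨fun h => hj (Nat.le_zero.1 (hjk.trans_eq h)), Nat.one_le_iff_ne_zero.2 hj, hjk⟩
    · simp only [hqk, ← hq, add_tsub_cancel_left]
  · rintro ⟨k, j⟩ hx
    simp only [Finset.mem_sigma, Finset.mem_Icc] at hx
    exact (S.vonMangoldt_single (Nat.one_le_iff_ne_zero.1 hx.2.1)).symm

lemma vonMangoldt_le_log (n : ℕ →₀ ℕ) : S.vonMangoldt n ≤ Real.log (S.val n) := by
  rw [← sum_antidiagonal_vonMangoldt]
  exact Finset.single_le_sum (f := fun q : (ℕ →₀ ℕ) × (ℕ →₀ ℕ) => S.vonMangoldt q.1)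
    (a := (n, 0)) (fun q _ => S.vonMangoldt_nonneg q.1) (by simp)

/-- Formal Dirichlet series over the generalized integers. -/
noncomputable def dirichlet (a : (ℕ →₀ ℕ) → ℝ) (s : ℂ) : ℂ :=
  ∑' n, (a n : ℂ) * (S.val n : ℂ) ^ (-s)

lemma norm_val_cpow (n : ℕ →₀ ℕ) (s : ℂ) : ‖(S.val n : ℂ) ^ (-s)‖ = S.val n ^ (-s.re) := by
  rw [Complex.norm_cpow_eq_rpow_re_of_pos (S.val_pos n)]
  simp

lemma val_cpow (n : ℕ →₀ ℕ) (s : ℂ) :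
    (S.val n : ℂ) ^ (-s) = Complex.exp (-s * Real.log (S.val n)) := by
  rw [Complex.cpow_def_of_ne_zero (by exact_mod_cast (S.val_pos n).ne'),
    ← Complex.ofReal_log (S.val_pos n).le, mul_comm]

lemma indicator_cnt (x : ℝ) (z : ℂ) :
    HasSum (fun n => {n : ℕ →₀ ℕ | S.val n ≤ x}.indicator (fun _ => z) n) (S.cnt x * z) := by
  classical
  have h := hasSum_sum_of_ne_finset_zero (L := SummationFilter.unconditional _)
    (f := fun n => {n : ℕ →₀ ℕ | S.val n ≤ x}.indicator (fun _ => z) n)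
    (s := (S.finite_val_le x).toFinset) (fun n hn => by
      rw [Set.indicator_of_notMem]
      simpa using hn)
  convert h using 1
  rw [Finset.sum_congr rfl (g := fun _ => z) (fun n hn => by
    rw [Set.indicator_of_mem]
    simpa using hn)]
  simp [cnt, Set.ncard_eq_toFinset_card _ (S.finite_val_le x)]

lemma cnt_mono : Monotone S.cnt := fun x y hxy => by
  unfold cnt
  exact_mod_cast Set.ncard_le_ncard (fun n (hn : _ ≤ x) => le_trans hn hxy) (S.finite_val_le y)

variable {S} {C : ℝ}

lemma summable_val_rpow (hC : ∀ x, 1 ≤ x → S.cnt x ≤ C * x) {σ : ℝ} (hσ : 1 < σ) :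
    Summable fun n => S.val n ^ (-σ) := by
  classical
  have hint : ∀ c : ℝ, 0 < c → ∫ t in Set.Ioi c, σ * t ^ (-σ - 1) = c ^ (-σ) := by
    intro c hc
    rw [integral_const_mul, integral_Ioi_rpow_of_lt (by linarith) hc]
    have : -σ - 1 + 1 = -σ := by ring
    rw [this]
    field_simp
  have hI : ∀ c : ℝ, 0 < c → IntegrableOn (fun t : ℝ => σ * t ^ (-σ - 1)) (Set.Ioi c) := fun c hc =>
    (integrableOn_Ioi_rpow_of_lt (by linarith) hc).const_mul σ
  refine summable_of_sum_le (c := ∫ t in Set.Ioi (1 : ℝ), (C * σ) * t ^ (-σ))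
    (fun n => Real.rpow_nonneg (S.val_pos n).le _) fun u => ?_
  have h1 : ∀ n ∈ u, S.val n ^ (-σ)
      = ∫ t in Set.Ioi (1 : ℝ), (Set.Ioi (S.val n)).indicator (fun t => σ * t ^ (-σ - 1)) t := by
    intro n _
    rw [setIntegral_indicator measurableSet_Ioi, Set.Ioi_inter_Ioi, sup_eq_right.2 (S.one_le_val n),
      hint _ (S.val_pos n)]
  rw [Finset.sum_congr rfl h1, ← integral_finsetSum _ fun n _ =>
    (hI 1 one_pos).indicator measurableSet_Ioi]
  refine setIntegral_mono_on (integrable_finsetSum _ fun n _ =>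
    (hI 1 one_pos).indicator measurableSet_Ioi)
    ((integrableOn_Ioi_rpow_of_lt (by linarith) one_pos).const_mul _) measurableSet_Ioi
    fun t ht => ?_
  have ht0 : 0 < t := zero_lt_one.trans ht
  have h2 : ∀ n ∈ u, (Set.Ioi (S.val n)).indicator (fun t => σ * t ^ (-σ - 1)) t
      ≤ if S.val n ≤ t then σ * t ^ (-σ - 1) else 0 := by
    intro n _
    rw [Set.indicator_apply]
    have : 0 ≤ σ * t ^ (-σ - 1) := by positivity
    by_cases h : S.val n < t
    · simp [h, h.le]
    · rw [if_neg (by simpa using h)]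
      split_ifs
      · exact this
      · exact le_rfl
  refine (Finset.sum_le_sum h2).trans ?_
  rw [← Finset.sum_filter, Finset.sum_const, nsmul_eq_mul]
  have h3 : ((u.filter fun n => S.val n ≤ t).card : ℝ) ≤ S.cnt t := by
    unfold cnt
    rw [Set.ncard_eq_toFinset_card _ (S.finite_val_le t)]
    exact_mod_cast Finset.card_le_card fun n hn => by simpa using (Finset.mem_filter.1 hn).2
  calc _ ≤ (C * t) * (σ * t ^ (-σ - 1)) := by
        gcongr
        exact h3.trans (hC t (le_of_lt ht))
    _ = _ := by
      rw [Real.rpow_sub_one ht0.ne']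
      field_simp

lemma summable_log_mul_val_rpow (hC : ∀ x, 1 ≤ x → S.cnt x ≤ C * x) {σ : ℝ} (hσ : 1 < σ) :
    Summable fun n => Real.log (S.val n) * S.val n ^ (-σ) := by
  set η := (σ - 1) / 2 with hη
  have hη0 : 0 < η := by linarith
  refine Summable.of_nonneg_of_le (fun n => mul_nonneg (S.log_val_nonneg n)
    (Real.rpow_nonneg (S.val_pos n).le _)) (fun n => ?_)
    ((summable_val_rpow hC (σ := 1 + η) (by linarith)).mul_left (1 / η))
  have h1 := Real.log_le_rpow_div (S.val_pos n).le hη0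
  calc _ ≤ (S.val n ^ η / η) * S.val n ^ (-σ) := by
        gcongr
        exact Real.rpow_nonneg (S.val_pos n).le _
    _ = (1 / η) * (S.val n ^ η * S.val n ^ (-σ)) := by ring
    _ = _ := by
      rw [← Real.rpow_add (S.val_pos n)]
      congr 2
      rw [hη]
      ring

section Dirichlet

variable {a : (ℕ →₀ ℕ) → ℝ}

lemma summable_dirichlet (ha : ∀ σ : ℝ, 1 < σ → Summable fun n => |a n| * S.val n ^ (-σ)) {s : ℂ}
    (hs : 1 < s.re) : Summable fun n => ‖(a n : ℂ) * (S.val n : ℂ) ^ (-s)‖ := by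
  refine (ha _ hs).congr fun n => ?_
  rw [norm_mul, norm_val_cpow, Complex.norm_real, Real.norm_eq_abs]

lemma hasDerivAt_dirichlet (ha : ∀ σ : ℝ, 1 < σ → Summable fun n => |a n| * S.val n ^ (-σ)) {s : ℂ}
    (hs : 1 < s.re) :
    HasDerivAt (S.dirichlet a) (-S.dirichlet (fun n => a n * Real.log (S.val n)) s) s := by
  set σ := (1 + s.re) / 2 with hσ
  have hU : IsOpen {z : ℂ | σ < z.re} := isOpen_lt continuous_const Complex.continuous_re
  have hsU : s ∈ {z : ℂ | σ < z.re} := by simp [hσ]; linarith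
  have hder : ∀ n z, HasDerivAt (fun z : ℂ => (a n : ℂ) * (S.val n : ℂ) ^ (-z))
      (-(((a n * Real.log (S.val n) : ℝ) : ℂ) * (S.val n : ℂ) ^ (-z))) z := by
    intro n z
    have h := ((hasDerivAt_id z).neg.mul_const ((Real.log (S.val n) : ℝ) : ℂ)).cexp.const_mul
      (a n : ℂ)
    simp only [Pi.neg_apply, id] at h
    simp_rw [val_cpow]
    refine h.congr_deriv ?_
    push_cast
    ring
  have hd : ∀ n, DifferentiableOn ℂ (fun z : ℂ => (a n : ℂ) * (S.val n : ℂ) ^ (-z))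
      {z : ℂ | σ < z.re} := fun n z _ => (hder n z).differentiableAt.differentiableWithinAt
  have hle : ∀ n (z : ℂ), z ∈ {z : ℂ | σ < z.re} →
      ‖(a n : ℂ) * (S.val n : ℂ) ^ (-z)‖ ≤ |a n| * S.val n ^ (-σ) := by
    intro n z hz
    rw [norm_mul, norm_val_cpow, Complex.norm_real, Real.norm_eq_abs]
    gcongr
    · exact S.one_le_val n
    · exact le_of_lt hz
  have hsum := ha σ (by linarith)
  have h1 := (Complex.differentiableOn_tsum_of_summable_norm hsum hd hU hle).differentiableAt
    (hU.mem_nhds hsU)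
  have h2 := Complex.hasSum_deriv_of_summable_norm hsum hd hU hle hsU
  have h3 : deriv (S.dirichlet a) s = -S.dirichlet (fun n => a n * Real.log (S.val n)) s := by
    unfold dirichlet
    rw [← tsum_neg, ← h2.tsum_eq]
    exact tsum_congr fun n => (hder n s).deriv
  rw [← h3]
  exact h1.hasDerivAt

lemma norm_dirichlet_le (ha : ∀ σ : ℝ, 1 < σ → Summable fun n => |a n| * S.val n ^ (-σ)) {s : ℂ}
    (hs : 1 < s.re) (ha0 : ∀ n, 0 ≤ a n) : ‖S.dirichlet a s‖ ≤ (S.dirichlet a s.re).re := by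
  have hs' : 1 < (s.re : ℂ).re := by simpa using hs
  unfold dirichlet
  rw [Complex.re_tsum (summable_dirichlet ha hs').of_norm]
  refine (norm_tsum_le_tsum_norm (summable_dirichlet ha hs)).trans_eq (tsum_congr fun n => ?_)
  rw [norm_mul, norm_val_cpow, Complex.norm_real, Real.norm_eq_abs, abs_of_nonneg (ha0 n)]
  rw [← Complex.ofReal_neg, ← Complex.ofReal_cpow (S.val_pos n).le, ← Complex.ofReal_mul,
    Complex.ofReal_re]

lemma re_dirichlet (ha : ∀ σ : ℝ, 1 < σ → Summable fun n => |a n| * S.val n ^ (-σ)) {s : ℂ}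
    (hs : 1 < s.re) : HasSum (fun n => a n * S.val n ^ (-s.re) * Real.cos (s.im * Real.log (S.val n)))
      (S.dirichlet a s).re := by
  have h := Complex.hasSum_re (summable_dirichlet ha hs).of_norm.hasSum
  refine h.congr_fun fun n => ?_
  rw [Complex.re_ofReal_mul, val_cpow, Complex.exp_re, mul_assoc, Real.rpow_def_of_pos (S.val_pos n)]
  simp
  ring_nf
  simp

end Dirichlet

lemma abs_one_summable (hC : ∀ x, 1 ≤ x → S.cnt x ≤ C * x) (σ : ℝ) (hσ : 1 < σ) :
    Summable fun n => |(1 : ℝ)| * S.val n ^ (-σ) := by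
  simpa using summable_val_rpow hC hσ

lemma abs_vonMangoldt_summable (hC : ∀ x, 1 ≤ x → S.cnt x ≤ C * x) (σ : ℝ) (hσ : 1 < σ) :
    Summable fun n => |S.vonMangoldt n| * S.val n ^ (-σ) := by
  refine Summable.of_nonneg_of_le (fun n => by have := S.val_pos n; positivity) (fun n => ?_)
    (summable_log_mul_val_rpow hC hσ)
  rw [abs_of_nonneg (S.vonMangoldt_nonneg n)]
  exact mul_le_mul_of_nonneg_right (S.vonMangoldt_le_log n) (Real.rpow_nonneg (S.val_pos n).le _)

lemma vonMangoldt_div_log_nonneg (n : ℕ →₀ ℕ) : 0 ≤ S.vonMangoldt n / Real.log (S.val n) :=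
  div_nonneg (S.vonMangoldt_nonneg n) (S.log_val_nonneg n)

lemma abs_vonMangoldt_div_log_summable (hC : ∀ x, 1 ≤ x → S.cnt x ≤ C * x) (σ : ℝ) (hσ : 1 < σ) :
    Summable fun n => |S.vonMangoldt n / Real.log (S.val n)| * S.val n ^ (-σ) := by
  refine Summable.of_nonneg_of_le (fun n => by have := S.val_pos n; positivity) (fun n => ?_)
    (summable_val_rpow hC hσ)
  rw [abs_of_nonneg (vonMangoldt_div_log_nonneg n)]
  exact mul_le_of_le_one_left (Real.rpow_nonneg (S.val_pos n).le _)
    (div_le_one_of_le₀ (S.vonMangoldt_le_log n) (S.log_val_nonneg n))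

lemma tsum_mul_tsum_eq_tsum_sum_antidiagonal {f g : (ℕ →₀ ℕ) → ℂ}
    (hf : Summable fun n => ‖f n‖) (hg : Summable fun n => ‖g n‖) :
    (∑' n, f n) * ∑' n, g n
      = ∑' n, ∑ q ∈ Finset.HasAntidiagonal.antidiagonal n, f q.1 * g q.2 :=
  hf.of_norm.tsum_mul_tsum_eq_tsum_sum_antidiagonal hg.of_norm
    (summable_mul_of_summable_norm hf hg)

lemma dirichlet_log_eq_mul (hC : ∀ x, 1 ≤ x → S.cnt x ≤ C * x) {s : ℂ} (hs : 1 < s.re) :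
    S.dirichlet (fun n => 1 * Real.log (S.val n)) s
      = S.dirichlet S.vonMangoldt s * S.dirichlet (fun _ => 1) s := by
  have h1 := summable_dirichlet (abs_vonMangoldt_summable hC) hs
  have h2 := summable_dirichlet (abs_one_summable hC) hs
  have h3 := tsum_mul_tsum_eq_tsum_sum_antidiagonal h1 h2
  unfold dirichlet
  refine Eq.trans (tsum_congr fun n => ?_) h3.symm
  have h4 : ∀ q ∈ Finset.HasAntidiagonal.antidiagonal n,
      (S.vonMangoldt q.1 : ℂ) * (S.val q.1 : ℂ) ^ (-s) * (((1 : ℝ) : ℂ) * (S.val q.2 : ℂ) ^ (-s))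
        = (S.vonMangoldt q.1 : ℂ) * (S.val n : ℂ) ^ (-s) := by
    intro q hq
    rw [Finset.HasAntidiagonal.mem_antidiagonal] at hq
    rw [← hq, val_add, Complex.ofReal_mul,
      Complex.mul_cpow_ofReal_nonneg (S.val_pos _).le (S.val_pos _).le]
    push_cast
    ring
  rw [Finset.sum_congr rfl h4, ← Finset.sum_mul, ← Complex.ofReal_sum,
    sum_antidiagonal_vonMangoldt]
  simp only [one_mul]

lemma hasDerivAt_dirichlet_one (hC : ∀ x, 1 ≤ x → S.cnt x ≤ C * x) {s : ℂ} (hs : 1 < s.re) :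
    HasDerivAt (S.dirichlet fun _ => 1)
      (-(S.dirichlet S.vonMangoldt s * S.dirichlet (fun _ => 1) s)) s := by
  rw [← dirichlet_log_eq_mul hC hs]
  exact hasDerivAt_dirichlet (abs_one_summable hC) hs

lemma hasDerivAt_dirichlet_vonMangoldt_div_log (hC : ∀ x, 1 ≤ x → S.cnt x ≤ C * x) {s : ℂ}
    (hs : 1 < s.re) :
    HasDerivAt (S.dirichlet fun n => S.vonMangoldt n / Real.log (S.val n))
      (-S.dirichlet S.vonMangoldt s) s := by
  have h := hasDerivAt_dirichlet (abs_vonMangoldt_div_log_summable hC) hs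
  convert h using 4 with n
  rcases eq_or_ne n 0 with rfl | hn
  · simp [vonMangoldt]
  · exact (div_mul_cancel₀ _ (Real.log_pos (S.one_lt_val hn)).ne').symm

lemma exists_dirichlet_one_eq_exp (hC : ∀ x, 1 ≤ x → S.cnt x ≤ C * x) :
    ∃ c : ℂ, c ≠ 0 ∧ ∀ s : ℂ, 1 < s.re → S.dirichlet (fun _ => 1) s
      = c * Complex.exp (S.dirichlet (fun n => S.vonMangoldt n / Real.log (S.val n)) s) := by
  set H := S.dirichlet fun n => S.vonMangoldt n / Real.log (S.val n) with hH
  set U : Set ℂ := {s | 1 < s.re}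
  have hU : IsOpen U := isOpen_lt continuous_const Complex.continuous_re
  have hd : ∀ s ∈ U, HasDerivAt (fun s => S.dirichlet (fun _ => 1) s * Complex.exp (-H s)) 0 s := by
    intro s hs
    refine ((hasDerivAt_dirichlet_one hC hs).mul
      (hasDerivAt_dirichlet_vonMangoldt_div_log hC hs).neg.cexp).congr_deriv ?_
    simp only [Pi.neg_apply, ← hH]
    ring
  have hconv : Convex ℝ U := convex_halfSpace_re_gt 1
  have h2 : (2 : ℂ) ∈ U := by simp [U]
  have hconst : ∀ s ∈ U, S.dirichlet (fun _ => 1) s * Complex.exp (-H s)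
      = S.dirichlet (fun _ => 1) 2 * Complex.exp (-H 2) := fun s hs =>
    hU.is_const_of_deriv_eq_zero hconv.isPreconnected
      (fun z hz => (hd z hz).differentiableAt.differentiableWithinAt)
      (fun z hz => (hd z hz).deriv) hs h2
  refine ⟨S.dirichlet (fun _ => 1) 2 * Complex.exp (-H 2),
    mul_ne_zero ?_ (Complex.exp_ne_zero _), fun s hs => ?_⟩
  · have h := re_dirichlet (abs_one_summable hC) (s := 2) (by simp)
    have h0 : 0 < (S.dirichlet (fun _ => 1) 2).re := by
      rw [← h.tsum_eq]
      refine h.summable.tsum_pos (fun n => ?_) 0 ?_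
      · have := S.val_pos n
        simp
        positivity
      · simp [val_zero]
    intro h1
    rw [h1] at h0
    simp at h0
  · rw [← hconst s hs, mul_assoc, ← Complex.exp_add]
    simp

end BeurlingSystem

namespace BeurlingSystem

open MeasureTheory

variable {S : BeurlingSystem} {C A θ K₀ : ℝ}

lemma exists_le_norm_dirichlet_one_mul (hC : ∀ x, 1 ≤ x → S.cnt x ≤ C * x) :
    ∃ c : ℝ, 0 < c ∧ ∀ s : ℂ, 1 < s.re →
      c ≤ ‖S.dirichlet (fun _ => 1) s‖ * ‖S.dirichlet (fun _ => 1) (s.re : ℂ)‖ := by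
  obtain ⟨c, hc0, hc⟩ := exists_dirichlet_one_eq_exp hC
  refine ⟨‖c‖ * ‖c‖, by positivity, fun s hs => ?_⟩
  have hs' : 1 < (s.re : ℂ).re := by simpa using hs
  rw [hc s hs, hc _ hs', norm_mul, norm_mul, Complex.norm_exp, Complex.norm_exp,
    mul_mul_mul_comm, ← Real.exp_add]
  refine le_mul_of_one_le_right (by positivity) (Real.one_le_exp ?_)
  have h1 := norm_dirichlet_le (abs_vonMangoldt_div_log_summable hC) hs vonMangoldt_div_log_nonneg
  have h2 := Complex.abs_re_le_norm
    (S.dirichlet (fun n => S.vonMangoldt n / Real.log (S.val n)) s)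
  have h3 := neg_abs_le (S.dirichlet (fun n => S.vonMangoldt n / Real.log (S.val n)) s).re
  linarith

lemma exists_le_norm_three_four_one (hC : ∀ x, 1 ≤ x → S.cnt x ≤ C * x) :
    ∃ c : ℝ, 0 < c ∧ ∀ σ t : ℝ, 1 < σ →
      c ≤ ‖S.dirichlet (fun _ => 1) (σ : ℂ)‖ ^ 3
        * ‖S.dirichlet (fun _ => 1) (σ + t * Complex.I)‖ ^ 4
        * ‖S.dirichlet (fun _ => 1) (σ + (2 * t : ℝ) * Complex.I)‖ := by
  obtain ⟨c, hc0, hc⟩ := exists_dirichlet_one_eq_exp hC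
  refine ⟨‖c‖ ^ 8, by positivity, fun σ t hσ => ?_⟩
  set a : (ℕ →₀ ℕ) → ℝ := fun n => S.vonMangoldt n / Real.log (S.val n) with ha
  have hsum := abs_vonMangoldt_div_log_summable hC
  have e0 := re_dirichlet (a := a) (S := S) hsum (s := (σ : ℂ)) (by simpa using hσ)
  have e1 := re_dirichlet (a := a) (S := S) hsum (s := σ + t * Complex.I) (by simpa using hσ)
  have e2 := re_dirichlet (a := a) (S := S) hsum (s := σ + (2 * t : ℝ) * Complex.I)
    (by simpa using hσ)
  have hpos : 0 ≤ 3 * (S.dirichlet a (σ : ℂ)).re + 4 * (S.dirichlet a (σ + t * Complex.I)).re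
      + (S.dirichlet a (σ + (2 * t : ℝ) * Complex.I)).re := by
    refine HasSum.nonneg (fun n => ?_) (((e0.mul_left 3).add (e1.mul_left 4)).add e2)
    have h1 : 0 ≤ a n := vonMangoldt_div_log_nonneg n
    have h2 : 0 ≤ S.val n ^ (-σ) := Real.rpow_nonneg (S.val_pos n).le _
    simp
    rw [mul_assoc 2 t, Real.cos_two_mul]
    have h3 : 0 ≤ a n * S.val n ^ (-σ) * (2 * (Real.cos (t * Real.log (S.val n)) + 1) ^ 2) := by
      positivity
    linarith
  rw [hc _ (by simpa using hσ), hc (σ + t * Complex.I) (by simpa using hσ),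
    hc (σ + (2 * t : ℝ) * Complex.I) (by simpa using hσ)]
  simp only [norm_mul, Complex.norm_exp, mul_pow, ← Real.exp_nat_mul]
  have : ‖c‖ ^ 8 * 1 ≤ ‖c‖ ^ 8 * Real.exp (3 * (S.dirichlet a (σ : ℂ)).re
      + 4 * (S.dirichlet a (σ + t * Complex.I)).re
      + (S.dirichlet a (σ + (2 * t : ℝ) * Complex.I)).re) := by
    gcongr
    exact Real.one_le_exp hpos
  rw [mul_one] at this
  refine this.trans_eq ?_
  rw [Real.exp_add, Real.exp_add]
  push_cast
  ring

section Continuation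

/-- The remainder `N(y) - Ay`. -/
noncomputable def remainder (S : BeurlingSystem) (A y : ℝ) : ℝ := S.cnt y - A * y

/-- `∫_Y^∞ (N(y) - Ay) y^{-s-1} dy`, written as a Mellin transform. -/
noncomputable def remainderIntegral (S : BeurlingSystem) (A Y : ℝ) (s : ℂ) : ℂ :=
  mellin ((Set.Ioi Y).indicator fun y => (S.remainder A y : ℂ)) (-s)

/-- The analytic function `(s - 1) ζ(s)`. -/
noncomputable def regularizedZeta (S : BeurlingSystem) (A : ℝ) (s : ℂ) : ℂ :=
  A * s + s * (s - 1) * S.remainderIntegral A 1 s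

lemma WellBehaved.cnt_le (h : S.WellBehaved A θ K₀) {x : ℝ} (hx : 1 ≤ x) :
    S.cnt x ≤ (A + K₀) * x := by
  obtain ⟨-, h0, h1, hK, hE⟩ := h
  have h2 := (abs_le.1 (hE x hx)).2
  have h3 : x ^ θ ≤ x := by
    simpa using Real.rpow_le_rpow_of_exponent_le hx h1.le
  nlinarith

lemma locallyIntegrable_remainder (S : BeurlingSystem) (A : ℝ) :
    LocallyIntegrable fun y => (S.remainder A y : ℂ) := by
  have h1 : LocallyIntegrable S.cnt := S.cnt_mono.locallyIntegrable
  have h2 : LocallyIntegrable fun y => A * y :=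
    (by fun_prop : Continuous fun y : ℝ => A * y).locallyIntegrable
  intro x
  obtain ⟨s, hs, hi⟩ := (h1.sub h2) x
  exact ⟨s, hs, hi.ofReal⟩

lemma WellBehaved.isBigO_remainder (h : S.WellBehaved A θ K₀) {Y : ℝ} :
    (Set.Ioi Y).indicator (fun y => (S.remainder A y : ℂ)) =O[atTop] fun y => y ^ (-(-θ)) := by
  refine Asymptotics.IsBigO.of_bound K₀ ?_
  filter_upwards [eventually_ge_atTop 1] with y hy
  have h1 : 0 ≤ y ^ θ := Real.rpow_nonneg (by linarith) _
  rw [neg_neg, Real.norm_eq_abs, abs_of_nonneg h1]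
  refine (norm_indicator_le_norm_self _ _).trans ?_
  rw [Complex.norm_real, Real.norm_eq_abs]
  exact h.2.2.2.2 y hy

lemma isBigO_remainder_zero {Y : ℝ} (hY : 1 ≤ Y) (b : ℝ) :
    (Set.Ioi Y).indicator (fun y => (S.remainder A y : ℂ)) =O[𝓝[>] 0] fun y : ℝ => y ^ (-b) := by
  refine Asymptotics.IsBigO.of_bound 1 ?_
  have : Set.Iio (1 : ℝ) ∈ 𝓝[>] (0 : ℝ) := mem_nhdsWithin_of_mem_nhds (Iio_mem_nhds one_pos)
  filter_upwards [this] with y hy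
  rw [Set.indicator_of_notMem (by simp at hy ⊢; linarith)]
  simp

lemma WellBehaved.differentiableAt_remainderIntegral (h : S.WellBehaved A θ K₀) {Y : ℝ}
    (hY : 1 ≤ Y) {s : ℂ} (hs : θ < s.re) :
    DifferentiableAt ℂ (S.remainderIntegral A Y) s := by
  have h1 : DifferentiableAt ℂ
      (mellin ((Set.Ioi Y).indicator fun y => (S.remainder A y : ℂ))) (-s) :=
    mellin_differentiableAt_of_isBigO_rpow (a := -θ) (b := -s.re - 1)
      ((locallyIntegrable_remainder S A).indicator measurableSet_Ioi |>.locallyIntegrableOn _)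
      h.isBigO_remainder (by simpa using hs) (isBigO_remainder_zero hY _) (by simp)
  exact h1.comp s differentiableAt_id.neg

lemma remainderIntegral_eq {Y : ℝ} (hY : 1 ≤ Y) (s : ℂ) :
    S.remainderIntegral A Y s = ∫ y in Set.Ioi Y, (S.remainder A y : ℂ) * (y : ℂ) ^ (-s - 1) := by
  unfold remainderIntegral mellin
  have : ∀ t : ℝ, (t : ℂ) ^ (-s - 1) • (Set.Ioi Y).indicator (fun y => (S.remainder A y : ℂ)) t
      = (Set.Ioi Y).indicator (fun y : ℝ => (S.remainder A y : ℂ) * (y : ℂ) ^ (-s - 1)) t := by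
    intro t
    by_cases ht : t ∈ Set.Ioi Y
    · rw [Set.indicator_of_mem ht, Set.indicator_of_mem ht, smul_eq_mul, mul_comm]
    · rw [Set.indicator_of_notMem ht, Set.indicator_of_notMem ht, smul_zero]
  simp_rw [this]
  rw [setIntegral_indicator measurableSet_Ioi, Set.Ioi_inter_Ioi, sup_eq_right.2 (by linarith)]

lemma WellBehaved.integrableOn_remainder (h : S.WellBehaved A θ K₀) {Y : ℝ} (hY : 1 ≤ Y) {s : ℂ}
    (hs : θ < s.re) :
    IntegrableOn (fun y : ℝ => (S.remainder A y : ℂ) * (y : ℂ) ^ (-s - 1)) (Set.Ioi Y) := by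
  have h1 : MellinConvergent ((Set.Ioi Y).indicator fun y => (S.remainder A y : ℂ)) (-s) :=
    mellinConvergent_of_isBigO_rpow (a := -θ) (b := -s.re - 1)
      ((locallyIntegrable_remainder S A).indicator measurableSet_Ioi |>.locallyIntegrableOn _)
      h.isBigO_remainder (by simpa using hs) (isBigO_remainder_zero hY _) (by simp)
  refine (h1.mono_set (Set.Ioi_subset_Ioi (by linarith : (0 : ℝ) ≤ Y))).congr_fun (fun y hy => ?_)
    measurableSet_Ioi
  simp only
  rw [Set.indicator_of_mem hy, smul_eq_mul, mul_comm]

lemma WellBehaved.norm_remainderIntegral_le (h : S.WellBehaved A θ K₀) {Y : ℝ} (hY : 1 ≤ Y) {s : ℂ}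
    (hs : θ < s.re) : ‖S.remainderIntegral A Y s‖ ≤ K₀ * Y ^ (θ - s.re) / (s.re - θ) := by
  have hY0 : 0 < Y := by linarith
  rw [remainderIntegral_eq hY]
  refine (norm_integral_le_of_norm_le (g := fun y => K₀ * y ^ (θ - s.re - 1))
    ((integrableOn_Ioi_rpow_of_lt (by linarith) hY0).const_mul K₀) ?_).trans_eq ?_
  · refine (ae_restrict_mem measurableSet_Ioi).mono fun y hy => ?_
    have hy1 : 1 ≤ y := hY.trans (le_of_lt hy)
    have hy0 : 0 < y := by linarith
    rw [norm_mul, Complex.norm_cpow_eq_rpow_re_of_pos hy0, Complex.norm_real, Real.norm_eq_abs]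
    have h1 := h.2.2.2.2 y hy1
    have h2 : θ - s.re - 1 = θ + (-s - 1).re := by simp; ring
    rw [h2, Real.rpow_add hy0, ← mul_assoc]
    gcongr
    exact h1
  · rw [integral_const_mul, integral_Ioi_rpow_of_lt (by linarith) hY0]
    have h1 : θ - s.re - 1 + 1 = -(s.re - θ) := by ring
    have h2 : θ - s.re = -(s.re - θ) := by ring
    rw [h1, h2]
    have : s.re - θ ≠ 0 := by linarith
    field_simp

lemma hasSum_max_cpow (hC : ∀ x, 1 ≤ x → S.cnt x ≤ C * x) {Y : ℝ} (hY : 1 ≤ Y) {s : ℂ}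
    (hs : 1 < s.re) :
    HasSum (fun n => ((max Y (S.val n) : ℝ) : ℂ) ^ (-s))
      (∫ y in Set.Ioi Y, (S.cnt y : ℂ) * (s * (y : ℂ) ^ (-s - 1))) := by
  have hY0 : 0 < Y := by linarith
  have hs0 : s ≠ 0 := by
    rintro rfl
    simp at hs
    linarith
  have hset : ∀ {E : Type} [NormedAddCommGroup E] [NormedSpace ℝ E] (g : ℝ → E) (v : ℝ),
      ∫ y in Set.Ioi Y, (Set.Ici v).indicator g y = ∫ y in Set.Ioi (max Y v), g y := by
    intro E _ _ g v
    rw [setIntegral_indicator measurableSet_Ici]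
    rcases le_or_gt v Y with h | h
    · rw [max_eq_left h, Set.inter_eq_left.2]
      exact fun y hy => h.trans (le_of_lt hy)
    · rw [max_eq_right h.le, Set.inter_eq_right.2 (show Set.Ici v ⊆ Set.Ioi Y from fun y hy => h.trans_le hy),
        integral_Ici_eq_integral_Ioi]
  have hgi : ∀ c : ℝ, 0 < c → IntegrableOn (fun y : ℝ => s * (y : ℂ) ^ (-s - 1)) (Set.Ioi c) :=
    fun c hc => (integrableOn_Ioi_cpow_of_lt (by simp; linarith) hc).const_mul s
  have h := hasSum_integral_of_summable_integral_norm (μ := volume.restrict (Set.Ioi Y))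
    (F := fun n (y : ℝ) => (Set.Ici (S.val n)).indicator (fun y : ℝ => s * (y : ℂ) ^ (-s - 1)) y)
    (fun n => (hgi Y hY0).indicator measurableSet_Ici) ?_
  · have e1 : (fun n => ((max Y (S.val n) : ℝ) : ℂ) ^ (-s)) = fun n => ∫ y in Set.Ioi Y,
        (Set.Ici (S.val n)).indicator (fun y : ℝ => s * (y : ℂ) ^ (-s - 1)) y := by
      funext n
      have hm : 0 < max Y (S.val n) := lt_max_of_lt_left hY0
      rw [hset, integral_const_mul, integral_Ioi_cpow_of_lt (by simp; linarith) hm]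
      have : -s - 1 + 1 = -s := by ring
      rw [this]
      field_simp
    have e2 : ∫ y in Set.Ioi Y, (S.cnt y : ℂ) * (s * (y : ℂ) ^ (-s - 1)) = ∫ y in Set.Ioi Y, ∑' n,
        (Set.Ici (S.val n)).indicator (fun y : ℝ => s * (y : ℂ) ^ (-s - 1)) y := by
      refine integral_congr_ae (Eventually.of_forall fun y => ?_)
      exact (S.indicator_cnt y _).tsum_eq.symm
    rw [e1, e2]
    exact h
  · refine Summable.of_nonneg_of_le (fun n => integral_nonneg fun y => norm_nonneg _)
      (fun n => ?_) ((summable_val_rpow hC hs).mul_left (‖s‖ / s.re))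
    have hm : 0 < max Y (S.val n) := lt_max_of_lt_left hY0
    simp_rw [norm_indicator_eq_indicator_norm]
    rw [hset]
    have : ∀ y ∈ Set.Ioi (max Y (S.val n)), ‖s * (y : ℂ) ^ (-s - 1)‖ = ‖s‖ * y ^ (-s.re - 1) := by
      intro y hy
      rw [norm_mul, Complex.norm_cpow_eq_rpow_re_of_pos (hm.trans hy)]
      simp
    rw [setIntegral_congr_fun measurableSet_Ioi this, integral_const_mul,
      integral_Ioi_rpow_of_lt (by linarith) hm]
    have h1 : -s.re - 1 + 1 = -s.re := by ring
    rw [h1]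
    have h2 : max Y (S.val n) ^ (-s.re) ≤ S.val n ^ (-s.re) :=
      Real.rpow_le_rpow_of_nonpos (S.val_pos n) (le_max_right _ _) (by linarith)
    calc _ = ‖s‖ / s.re * max Y (S.val n) ^ (-s.re) := by field_simp
      _ ≤ _ := by gcongr

/-- The truncated form of the analytic continuation of `ζ`. -/
noncomputable def truncatedZeta (S : BeurlingSystem) (A Y : ℝ) (s : ℂ) : ℂ :=
  ∑ n ∈ (S.finite_val_le Y).toFinset, ((S.val n : ℂ) ^ (-s) - (Y : ℂ) ^ (-s))
    + s * A * (Y : ℂ) ^ (1 - s) / (s - 1) + s * S.remainderIntegral A Y s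

lemma WellBehaved.dirichlet_one_eq (h : S.WellBehaved A θ K₀) {Y : ℝ} (hY : 1 ≤ Y) {s : ℂ}
    (hs : 1 < s.re) : S.dirichlet (fun _ => 1) s = S.truncatedZeta A Y s := by
  have hC : ∀ x, 1 ≤ x → S.cnt x ≤ (A + K₀) * x := fun x hx => h.cnt_le hx
  have hY0 : 0 < Y := by linarith
  have hθ := h.2.2.1
  have h1 := hasSum_max_cpow hC hY hs
  have h2 : HasSum (fun n => (S.val n : ℂ) ^ (-s) - ((max Y (S.val n) : ℝ) : ℂ) ^ (-s))
      (∑ n ∈ (S.finite_val_le Y).toFinset, ((S.val n : ℂ) ^ (-s) - (Y : ℂ) ^ (-s))) := by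
    have h3 := hasSum_sum_of_ne_finset_zero (L := SummationFilter.unconditional _)
      (f := fun n => (S.val n : ℂ) ^ (-s) - ((max Y (S.val n) : ℝ) : ℂ) ^ (-s))
      (s := (S.finite_val_le Y).toFinset) (fun n hn => by
        simp only [Set.Finite.mem_toFinset, Set.mem_ofPred_eq, not_le] at hn
        rw [max_eq_right hn.le, sub_self])
    convert h3 using 1
    refine Finset.sum_congr rfl fun n hn => ?_
    simp only [Set.Finite.mem_toFinset, Set.mem_ofPred_eq] at hn
    rw [max_eq_left hn]
  have h3 := (h2.add h1).tsum_eq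
  have h4 : ∫ y in Set.Ioi Y, (S.cnt y : ℂ) * (s * (y : ℂ) ^ (-s - 1))
      = s * A * (Y : ℂ) ^ (1 - s) / (s - 1) + s * S.remainderIntegral A Y s := by
    have h5 : ∀ y ∈ Set.Ioi Y, (S.cnt y : ℂ) * (s * (y : ℂ) ^ (-s - 1))
        = s * A * (y : ℂ) ^ (-s) + s * ((S.remainder A y : ℂ) * (y : ℂ) ^ (-s - 1)) := by
      intro y hy
      have hy0 : (y : ℂ) ≠ 0 := by exact_mod_cast (hY0.trans hy).ne'
      have h6 : (y : ℂ) ^ (-s) = (y : ℂ) ^ (-s - 1) * y := by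
        rw [Complex.cpow_sub _ _ hy0, Complex.cpow_one]
        field_simp
      rw [h6]
      unfold remainder
      push_cast
      ring
    rw [setIntegral_congr_fun measurableSet_Ioi h5, integral_add
      ((integrableOn_Ioi_cpow_of_lt (by simp; linarith) hY0).const_mul _)
      ((h.integrableOn_remainder hY (by linarith)).const_mul _), integral_const_mul,
      integral_const_mul, ← remainderIntegral_eq hY, integral_Ioi_cpow_of_lt (by simp; linarith) hY0]
    congr 1
    have h7 : -s + 1 = 1 - s := by ring
    have h8 : s - 1 ≠ 0 := by
      intro h
      have := congrArg Complex.re h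
      simp at this
      linarith
    have h9 : 1 - s ≠ 0 := by
      intro h
      exact h8 (by linear_combination -h)
    rw [h7]
    field_simp
    ring
  unfold dirichlet truncatedZeta
  rw [add_assoc, ← h4, ← h3]
  refine tsum_congr fun n => ?_
  push_cast
  ring

end Continuation

end BeurlingSystem

lemma isPreconnected_halfPlane_sdiff_one {θ : ℝ} (hθ : θ < 1) :
    IsPreconnected {s : ℂ | θ < s.re ∧ s ≠ 1} := by
  have h1 : IsPreconnected {s : ℂ | θ < s.re ∧ 0 < s.im} :=
    ((convex_halfSpace_re_gt θ).inter (convex_halfSpace_im_gt 0)).isPreconnected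
  have h2 : IsPreconnected {s : ℂ | θ < s.re ∧ s.im < 0} :=
    ((convex_halfSpace_re_gt θ).inter (convex_halfSpace_im_lt 0)).isPreconnected
  have h3 : IsPreconnected {s : ℂ | 1 < s.re} := (convex_halfSpace_re_gt 1).isPreconnected
  have h4 : IsPreconnected {s : ℂ | θ < s.re ∧ s.re < 1} :=
    ((convex_halfSpace_re_gt θ).inter (convex_halfSpace_re_lt 1)).isPreconnected
  have h5 := ((h1.union (2 + Complex.I) (by simp; linarith) (by simp) h3).union (2 - Complex.I)
    (by simp) (by simp; linarith) h2).union (((1 + θ) / 2 : ℝ) + Complex.I)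
    (Or.inl (Or.inl ⟨by simp; linarith, by simp⟩)) (by simp; constructor <;> linarith) h4
  convert h5 using 1
  ext s
  simp only [Set.mem_ofPred_eq, Set.mem_union]
  constructor
  · rintro ⟨ha, hb⟩
    rcases lt_trichotomy s.im 0 with h | h | h
    · tauto
    · rcases lt_trichotomy s.re 1 with h' | h' | h'
      · tauto
      · exact absurd (Complex.ext (by simpa using h') (by simpa using h)) hb
      · tauto
    · tauto
  · rintro (((h | h) | h) | h)
    · exact ⟨h.1, fun h' => by simp [h'] at h⟩
    · exact ⟨by linarith, fun h' => by simp [h'] at h⟩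
    · exact ⟨h.1, fun h' => by simp [h'] at h⟩
    · exact ⟨h.1, fun h' => by simp [h'] at h⟩

namespace BeurlingSystem

open MeasureTheory

variable {S : BeurlingSystem} {A θ K₀ : ℝ} {ζ : ℂ → ℂ}

lemma WellBehaved.differentiableAt_truncatedZeta (h : S.WellBehaved A θ K₀) {Y : ℝ} (hY : 1 ≤ Y)
    {s : ℂ} (hs : θ < s.re) (hs1 : s ≠ 1) : DifferentiableAt ℂ (S.truncatedZeta A Y) s := by
  have hY0 : (Y : ℂ) ≠ 0 := by
    have : Y ≠ 0 := by linarith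
    exact_mod_cast this
  have h1 : ∀ c : ℂ, c ≠ 0 → DifferentiableAt ℂ (fun s : ℂ => c ^ (-s)) s := fun c hc =>
    differentiableAt_id.neg.const_cpow (Or.inl hc)
  have h2 : DifferentiableAt ℂ (fun s : ℂ => (Y : ℂ) ^ (1 - s)) s :=
    DifferentiableAt.const_cpow (by fun_prop) (Or.inl hY0)
  have h3 := h.differentiableAt_remainderIntegral hY hs
  unfold truncatedZeta
  refine DifferentiableAt.add (DifferentiableAt.add ?_ ?_) (differentiableAt_id.mul h3)
  · refine DifferentiableAt.fun_sum fun n _ => (h1 _ ?_).sub (h1 _ hY0)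
    exact_mod_cast (S.val_pos n).ne'
  · exact DifferentiableAt.div (by fun_prop) (by fun_prop) (sub_ne_zero.2 hs1)

lemma IsZeta.eq_dirichlet (hζ : S.IsZeta θ ζ) {s : ℂ} (hs : 1 < s.re) :
    ζ s = S.dirichlet (fun _ => 1) s := by
  rw [hζ.2 s hs]
  unfold dirichlet
  simp

lemma IsZeta.eq_truncatedZeta (h : S.WellBehaved A θ K₀) (hζ : S.IsZeta θ ζ) {Y : ℝ} (hY : 1 ≤ Y)
    {s : ℂ} (hs : θ < s.re) (hs1 : s ≠ 1) : ζ s = S.truncatedZeta A Y s := by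
  have hU : IsOpen {s : ℂ | θ < s.re ∧ s ≠ 1} :=
    (isOpen_lt continuous_const Complex.continuous_re).inter isOpen_ne
  refine AnalyticOnNhd.eqOn_of_preconnected_of_eventuallyEq (hζ.1.analyticOnNhd hU)
    (DifferentiableOn.analyticOnNhd (fun z hz =>
      (h.differentiableAt_truncatedZeta hY hz.1 hz.2).differentiableWithinAt) hU)
    (isPreconnected_halfPlane_sdiff_one h.2.2.1) (z₀ := 2) ?_ ?_ ⟨hs, hs1⟩
  · have := h.2.2.1
    simp
    linarith
  · have : {s : ℂ | 1 < s.re} ∈ 𝓝 (2 : ℂ) :=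
      (isOpen_lt continuous_const Complex.continuous_re).mem_nhds (by simp)
    filter_upwards [this] with z hz
    rw [hζ.eq_dirichlet hz, h.dirichlet_one_eq hY hz]

lemma truncatedZeta_one_mul (A : ℝ) {s : ℂ} (hs1 : s ≠ 1) :
    (s - 1) * S.truncatedZeta A 1 s = S.regularizedZeta A s := by
  have h1 : ∑ n ∈ (S.finite_val_le 1).toFinset, ((S.val n : ℂ) ^ (-s) - ((1 : ℝ) : ℂ) ^ (-s)) = 0 := by
    refine Finset.sum_eq_zero fun n hn => ?_
    simp only [Set.Finite.mem_toFinset, Set.mem_ofPred_eq] at hn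
    rw [le_antisymm hn (S.one_le_val n), sub_self]
  have h2 : s - 1 ≠ 0 := sub_ne_zero.2 hs1
  unfold truncatedZeta regularizedZeta
  rw [h1]
  simp only [Complex.ofReal_one, Complex.one_cpow]
  field_simp
  ring

lemma IsZeta.regularizedZeta_eq (h : S.WellBehaved A θ K₀) (hζ : S.IsZeta θ ζ) {s : ℂ}
    (hs : θ < s.re) (hs1 : s ≠ 1) : S.regularizedZeta A s = (s - 1) * ζ s := by
  rw [IsZeta.eq_truncatedZeta h hζ le_rfl hs hs1, truncatedZeta_one_mul A hs1]

lemma ne_one_of_one_lt_re {s : ℂ} (hs : 1 < s.re) : s ≠ 1 := by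
  rintro rfl
  simp at hs

lemma WellBehaved.regularizedZeta_eq (h : S.WellBehaved A θ K₀) {s : ℂ} (hs : 1 < s.re) :
    S.regularizedZeta A s = (s - 1) * S.dirichlet (fun _ => 1) s := by
  rw [h.dirichlet_one_eq le_rfl hs, truncatedZeta_one_mul A (ne_one_of_one_lt_re hs)]

lemma regularizedZeta_one (S : BeurlingSystem) (A : ℝ) : S.regularizedZeta A 1 = A := by
  simp [regularizedZeta]

lemma IsZeta.regularizedZeta_eq_zero_iff (h : S.WellBehaved A θ K₀) (hζ : S.IsZeta θ ζ) {s : ℂ}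
    (hs : θ < s.re) : S.regularizedZeta A s = 0 ↔ ζ s = 0 ∧ s ≠ 1 := by
  rcases eq_or_ne s 1 with rfl | h1
  · have := h.1.ne'
    simp [regularizedZeta_one, this]
  · rw [IsZeta.regularizedZeta_eq h hζ hs h1]
    simp [sub_ne_zero.2 h1, h1]

lemma WellBehaved.differentiableAt_regularizedZeta (h : S.WellBehaved A θ K₀) {s : ℂ}
    (hs : θ < s.re) : DifferentiableAt ℂ (S.regularizedZeta A) s := by
  have h3 := h.differentiableAt_remainderIntegral le_rfl hs
  unfold regularizedZeta
  fun_prop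

lemma isOpen_lt_re (θ : ℝ) : IsOpen {s : ℂ | θ < s.re} :=
  isOpen_lt continuous_const Complex.continuous_re

lemma WellBehaved.exists_norm_regularizedZeta_le (h : S.WellBehaved A θ K₀) {θ' : ℝ}
    (hθ' : θ < θ') : ∃ C : ℝ, 0 < C ∧ ∀ s : ℂ, θ' ≤ s.re →
      ‖S.regularizedZeta A s‖ ≤ C * (1 + ‖s‖) ^ 2 := by
  have hA := h.1
  have hK := h.2.2.2.1
  have h0 : 0 < θ' - θ := by linarith
  refine ⟨A + K₀ / (θ' - θ), by positivity, fun s hs => ?_⟩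
  have h1 := h.norm_remainderIntegral_le le_rfl (s := s) (by linarith)
  rw [Real.one_rpow, mul_one] at h1
  have h2 : K₀ / (s.re - θ) ≤ K₀ / (θ' - θ) := by gcongr
  have h3 : ‖s * (s - 1)‖ ≤ (1 + ‖s‖) ^ 2 := by
    rw [norm_mul]
    have := norm_sub_le s 1
    rw [norm_one] at this
    nlinarith [norm_nonneg s, norm_nonneg (s - 1)]
  unfold regularizedZeta
  refine (norm_add_le _ _).trans ?_
  rw [norm_mul, norm_mul (s * (s - 1)), Complex.norm_real, Real.norm_eq_abs, abs_of_pos hA, add_mul]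
  refine add_le_add ?_ ?_
  · gcongr
    nlinarith [norm_nonneg s]
  · rw [mul_comm]
    gcongr
    exact h1.trans h2

lemma regularizedZeta_conj (S : BeurlingSystem) (A : ℝ) (s : ℂ) :
    S.regularizedZeta A ((starRingEnd ℂ) s) = (starRingEnd ℂ) (S.regularizedZeta A s) := by
  unfold regularizedZeta
  rw [remainderIntegral_eq le_rfl, remainderIntegral_eq le_rfl]
  have : ∫ y in Set.Ioi (1 : ℝ), (S.remainder A y : ℂ) * (y : ℂ) ^ (-(starRingEnd ℂ) s - 1)
      = (starRingEnd ℂ) (∫ y in Set.Ioi (1 : ℝ), (S.remainder A y : ℂ) * (y : ℂ) ^ (-s - 1)) := by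
    rw [← integral_conj]
    refine setIntegral_congr_fun measurableSet_Ioi fun y hy => ?_
    have hy0 : (0 : ℝ) < y := one_pos.trans hy
    have hy1 : (y : ℂ) ≠ 0 := by exact_mod_cast hy0.ne'
    simp only [map_mul, Complex.conj_ofReal]
    rw [Complex.cpow_def_of_ne_zero hy1, Complex.cpow_def_of_ne_zero hy1, ← Complex.exp_conj,
      map_mul, ← Complex.ofReal_log hy0.le, Complex.conj_ofReal]
    simp
  rw [this]
  simp

lemma WellBehaved.dirichlet_one_ne_zero (h : S.WellBehaved A θ K₀) {s : ℂ} (hs : 1 < s.re) :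
    S.dirichlet (fun _ => 1) s ≠ 0 := by
  obtain ⟨c, hc0, hc⟩ := exists_dirichlet_one_eq_exp (S := S) fun x hx => h.cnt_le hx
  rw [hc s hs]
  exact mul_ne_zero hc0 (Complex.exp_ne_zero _)

lemma WellBehaved.regularizedZeta_ne_zero (h : S.WellBehaved A θ K₀) {s : ℂ} (hs : 1 < s.re) :
    S.regularizedZeta A s ≠ 0 := by
  rw [h.regularizedZeta_eq hs]
  exact mul_ne_zero (sub_ne_zero.2 (ne_one_of_one_lt_re hs)) (h.dirichlet_one_ne_zero hs)

lemma WellBehaved.logDeriv_regularizedZeta (h : S.WellBehaved A θ K₀) {s : ℂ} (hs : 1 < s.re) :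
    logDeriv (S.regularizedZeta A) s = 1 / (s - 1) - S.dirichlet S.vonMangoldt s := by
  have h1 : S.regularizedZeta A =ᶠ[𝓝 s] fun z => (z - 1) * S.dirichlet (fun _ => 1) z := by
    filter_upwards [(isOpen_lt_re 1).mem_nhds hs] with z hz
    exact h.regularizedZeta_eq hz
  have h2 := hasDerivAt_dirichlet_one (S := S) (fun x hx => h.cnt_le hx) hs
  have h3 : HasDerivAt (S.regularizedZeta A) (1 * S.dirichlet (fun _ => 1) s
      + (s - 1) * -(S.dirichlet S.vonMangoldt s * S.dirichlet (fun _ => 1) s)) s :=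
    (((hasDerivAt_id s).sub_const 1).mul h2).congr_of_eventuallyEq h1
  rw [logDeriv_apply, h3.deriv, h.regularizedZeta_eq hs]
  have h4 := h.dirichlet_one_ne_zero hs
  have h5 := sub_ne_zero.2 (ne_one_of_one_lt_re hs)
  field_simp
  ring

lemma WellBehaved.exists_dirichlet_one_le (h : S.WellBehaved A θ K₀) :
    ∃ C : ℝ, 0 < C ∧ ∀ σ : ℝ, 1 < σ → σ ≤ 4 →
      ‖S.dirichlet (fun _ => 1) (σ : ℂ)‖ ≤ C / (σ - 1) := by
  obtain ⟨C, hC0, hC⟩ := h.exists_norm_regularizedZeta_le h.2.2.1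
  refine ⟨C * 25, by positivity, fun σ h1 h2 => ?_⟩
  have h3 := hC (σ : ℂ) (by simpa using h1.le)
  rw [h.regularizedZeta_eq (by simpa using h1), norm_mul] at h3
  have h4 : ‖(σ : ℂ) - 1‖ = σ - 1 := by
    rw [← Complex.ofReal_one, ← Complex.ofReal_sub, Complex.norm_real, Real.norm_eq_abs,
      abs_of_pos (by linarith)]
  rw [h4, Complex.norm_real, Real.norm_eq_abs, abs_of_pos (by linarith)] at h3
  rw [le_div_iff₀ (by linarith), mul_comm]
  refine h3.trans ?_
  gcongr
  nlinarith

lemma WellBehaved.exists_le_norm_regularizedZeta (h : S.WellBehaved A θ K₀) :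
    ∃ c : ℝ, 0 < c ∧ ∀ s : ℂ, 1 < s.re → s.re ≤ 4 →
      c * ((s.re - 1) * ‖s - 1‖) ≤ ‖S.regularizedZeta A s‖ := by
  obtain ⟨c, hc0, hc⟩ := exists_le_norm_dirichlet_one_mul (S := S) fun x hx => h.cnt_le hx
  obtain ⟨C, hC0, hC⟩ := h.exists_dirichlet_one_le
  refine ⟨c / C, by positivity, fun s h1 h2 => ?_⟩
  have h3 := hc s h1
  have h4 := hC s.re h1 h2
  rw [h.regularizedZeta_eq h1, norm_mul]
  have h5 : c ≤ ‖S.dirichlet (fun _ => 1) s‖ * (C / (s.re - 1)) :=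
    h3.trans (by gcongr)
  have h6 : 0 < s.re - 1 := by linarith
  have h7 : c / C * (s.re - 1) ≤ ‖S.dirichlet (fun _ => 1) s‖ := by
    rw [div_mul_eq_mul_div, div_le_iff₀ hC0]
    rw [mul_div_assoc', le_div_iff₀ h6] at h5
    exact h5
  calc _ = (c / C * (s.re - 1)) * ‖s - 1‖ := by ring
    _ ≤ ‖S.dirichlet (fun _ => 1) s‖ * ‖s - 1‖ := by gcongr
    _ = _ := mul_comm _ _

lemma WellBehaved.exists_norm_dirichlet_vonMangoldt_le (h : S.WellBehaved A θ K₀) :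
    ∃ C : ℝ, 0 < C ∧ ∀ s : ℂ, 1 < s.re → s.re ≤ 2 →
      ‖S.dirichlet S.vonMangoldt s‖ ≤ C / (s.re - 1) := by
  have hcont : ContinuousOn (fun σ : ℝ => logDeriv (S.regularizedZeta A) (σ : ℂ)) (Set.Icc 1 2) := by
    have hd : DifferentiableOn ℂ (S.regularizedZeta A) {s | θ < s.re} := fun z hz =>
      (h.differentiableAt_regularizedZeta hz).differentiableWithinAt
    intro σ hσ
    have hσθ : (σ : ℂ) ∈ {s : ℂ | θ < s.re} := by
      have := h.2.2.1
      have := hσ.1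
      simp
      linarith
    have hne : S.regularizedZeta A (σ : ℂ) ≠ 0 := by
      rcases hσ.1.eq_or_lt with h1 | h1
      · rw [← h1, Complex.ofReal_one, regularizedZeta_one]
        exact_mod_cast h.1.ne'
      · exact h.regularizedZeta_ne_zero (by simpa using h1)
    have h1 : ContinuousAt (logDeriv (S.regularizedZeta A)) (σ : ℂ) :=
      ((hd.analyticAt ((isOpen_lt_re θ).mem_nhds hσθ)).deriv.continuousAt).div
        (hd.analyticAt ((isOpen_lt_re θ).mem_nhds hσθ)).continuousAt hne
    exact (ContinuousAt.comp (f := fun σ : ℝ => (σ : ℂ)) h1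
      Complex.continuous_ofReal.continuousAt).continuousWithinAt
  obtain ⟨C, hC⟩ := isCompact_Icc.exists_bound_of_continuousOn hcont
  have hC0 : 0 ≤ C := (norm_nonneg _).trans (hC 1 (by simp))
  refine ⟨1 + C, by positivity, fun s h1 h2 => ?_⟩
  have hsum := abs_vonMangoldt_summable (S := S) fun x hx => h.cnt_le hx
  have h3 := norm_dirichlet_le hsum h1 S.vonMangoldt_nonneg
  have h4 := (Complex.re_le_norm (S.dirichlet S.vonMangoldt (s.re : ℂ)))
  have h5 := h.logDeriv_regularizedZeta (s := (s.re : ℂ)) (by simpa using h1)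
  have h6 := hC s.re ⟨h1.le, h2⟩
  have h7 : S.dirichlet S.vonMangoldt (s.re : ℂ)
      = 1 / ((s.re : ℂ) - 1) - logDeriv (S.regularizedZeta A) (s.re : ℂ) := by
    rw [h5]
    ring
  have h8 : ‖1 / ((s.re : ℂ) - 1)‖ = 1 / (s.re - 1) := by
    rw [← Complex.ofReal_one, ← Complex.ofReal_sub, ← Complex.ofReal_div, Complex.norm_real,
      Real.norm_eq_abs, abs_of_pos (by apply one_div_pos.2; linarith)]
  have h9 : ‖S.dirichlet S.vonMangoldt (s.re : ℂ)‖ ≤ 1 / (s.re - 1) + C := by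
    rw [h7]
    exact (norm_sub_le _ _).trans (by rw [h8]; gcongr)
  refine (h3.trans h4).trans (h9.trans ?_)
  rw [add_div]
  gcongr
  rw [le_div_iff₀ (by linarith)]
  nlinarith

lemma WellBehaved.regularizedZeta_ne_zero_of_one_le (h : S.WellBehaved A θ K₀) {s : ℂ}
    (hs : 1 ≤ s.re) : S.regularizedZeta A s ≠ 0 := by
  rcases hs.lt_or_eq with hs | hs
  · exact h.regularizedZeta_ne_zero hs
  rcases eq_or_ne s 1 with rfl | hs1
  · rw [regularizedZeta_one]
    exact_mod_cast h.1.ne'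
  set t := s.im with ht
  have hst : s = 1 + t * Complex.I := Complex.ext (by simp [hs]) (by simp [ht])
  have ht0 : t ≠ 0 := by
    intro h0
    rw [h0] at hst
    simp at hst
    exact hs1 hst
  intro h0
  obtain ⟨c, hc0, hc⟩ := exists_le_norm_three_four_one (S := S) fun x hx => h.cnt_le hx
  have hθ := h.2.2.1
  have hline : ∀ u : ℝ, ∀ σ : ℝ, θ < σ →
      DifferentiableAt ℝ (fun σ : ℝ => S.regularizedZeta A (σ + u * Complex.I)) σ := by
    intro u σ hσ
    have h1 : DifferentiableAt ℂ (fun z : ℂ => S.regularizedZeta A (z + u * Complex.I)) (σ : ℂ) :=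
      DifferentiableAt.comp (σ : ℂ) (g := S.regularizedZeta A) (f := fun z : ℂ => z + u * Complex.I)
        (h.differentiableAt_regularizedZeta (s := σ + u * Complex.I) (by simpa using hσ))
        (by fun_prop)
    exact h1.hasDerivAt.comp_ofReal.differentiableAt
  have e1 : Tendsto (fun σ : ℝ => ‖S.regularizedZeta A (σ : ℂ)‖) (𝓝[>] 1) (𝓝 A) := by
    have h1 := (hline 0 1 hθ).continuousAt.norm.tendsto
    simp only [Complex.ofReal_zero, zero_mul, add_zero, Complex.ofReal_one,
      regularizedZeta_one] at h1
    rw [Complex.norm_real, Real.norm_eq_abs, abs_of_pos h.1] at h1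
    exact h1.mono_left nhdsWithin_le_nhds
  have e2 : Tendsto (fun σ : ℝ => ‖(σ - 1)⁻¹ • S.regularizedZeta A (σ + t * Complex.I)‖) (𝓝[>] 1)
      (𝓝 ‖deriv (fun σ : ℝ => S.regularizedZeta A (σ + t * Complex.I)) 1‖) := by
    have h1 := (hline t 1 hθ).hasDerivAt.tendsto_slope.norm
    refine (h1.mono_left (nhdsWithin_mono _ fun x hx => (ne_of_gt hx : x ≠ 1))).congr fun σ => ?_
    rw [slope_def_module, Complex.ofReal_one, ← hst, h0, sub_zero]
  have e3 : Tendsto (fun σ : ℝ => ‖S.regularizedZeta A (σ + (2 * t : ℝ) * Complex.I)‖) (𝓝[>] 1)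
      (𝓝 ‖S.regularizedZeta A ((1 : ℝ) + (2 * t : ℝ) * Complex.I)‖) :=
    (hline (2 * t) 1 hθ).continuousAt.norm.tendsto.mono_left nhdsWithin_le_nhds
  have e4 : Tendsto (fun σ : ℝ => σ - 1) (𝓝[>] 1) (𝓝 0) := by
    have : Tendsto (fun σ : ℝ => σ - 1) (𝓝 1) (𝓝 (1 - 1)) := by
      exact (continuous_id.sub continuous_const).tendsto 1
    rw [sub_self] at this
    exact this.mono_left nhdsWithin_le_nhds
  have e5 := (((e1.pow 3).mul (e2.pow 4)).mul e3).mul e4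
  rw [mul_zero] at e5
  have e6 : ∀ᶠ σ : ℝ in 𝓝[>] 1, c * (|t| ^ 4 * |2 * t|) ≤ ‖S.regularizedZeta A (σ : ℂ)‖ ^ 3
      * ‖(σ - 1)⁻¹ • S.regularizedZeta A (σ + t * Complex.I)‖ ^ 4
      * ‖S.regularizedZeta A (σ + (2 * t : ℝ) * Complex.I)‖ * (σ - 1) := by
    filter_upwards [self_mem_nhdsWithin] with σ hσ
    have hσ1 : 0 < σ - 1 := sub_pos.2 hσ
    have him : ∀ u : ℝ, |u| ≤ ‖(σ : ℂ) + u * Complex.I - 1‖ := by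
      intro u
      have := Complex.abs_im_le_norm ((σ : ℂ) + u * Complex.I - 1)
      simpa using this
    have h4 : ‖(σ : ℂ) - 1‖ = σ - 1 := by
      rw [← Complex.ofReal_one, ← Complex.ofReal_sub, Complex.norm_real, Real.norm_eq_abs,
        abs_of_pos hσ1]
    rw [norm_smul, Real.norm_eq_abs, abs_of_pos (inv_pos.2 hσ1),
      h.regularizedZeta_eq (s := (σ : ℂ)) (by simpa using hσ),
      h.regularizedZeta_eq (s := σ + t * Complex.I) (by simpa using hσ),
      h.regularizedZeta_eq (s := σ + (2 * t : ℝ) * Complex.I) (by simpa using hσ),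
      norm_mul, norm_mul, norm_mul, h4]
    have h5 := hc σ t hσ
    set x := ‖S.dirichlet (fun _ => 1) (σ : ℂ)‖
    set y := ‖S.dirichlet (fun _ => 1) (σ + t * Complex.I)‖
    set z := ‖S.dirichlet (fun _ => 1) (σ + (2 * t : ℝ) * Complex.I)‖
    calc c * (|t| ^ 4 * |2 * t|)
        ≤ (x ^ 3 * y ^ 4 * z) * (‖(σ : ℂ) + t * Complex.I - 1‖ ^ 4
          * ‖(σ : ℂ) + (2 * t : ℝ) * Complex.I - 1‖) := by
          gcongr
          · exact him t
          · exact him (2 * t)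
      _ = _ := by
        field_simp
  have h7 := ge_of_tendsto e5 e6
  have h8 : 0 < c * (|t| ^ 4 * |2 * t|) := by positivity
  linarith

/-- Convexity bound near the line `Re s = 1`. -/
lemma IsZeta.exists_norm_le_near_one (h : S.WellBehaved A θ K₀) (hζ : S.IsZeta θ ζ) :
    ∃ C c δ : ℝ, 0 < C ∧ 0 < c ∧ 0 < δ ∧ ∀ (v τ : ℝ) (s : ℂ), 0 ≤ v → v ≤ δ → 3 ≤ τ →
      1 - v ≤ s.re → s.re ≤ 4 → 1 ≤ |s.im| → |s.im| ≤ τ →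
      ‖ζ s‖ ≤ C * τ ^ (c * v) * Real.log τ := by
  obtain ⟨hA, hθ0, hθ1, hK, hE⟩ := id h
  obtain ⟨C₁, hC₁0, hC₁⟩ := h.exists_dirichlet_one_le
  set c := 1 / (1 - θ) with hc
  have hc1 : 1 ≤ c := by
    rw [hc, le_div_iff₀ (by linarith)]
    linarith
  refine ⟨Real.exp 1 * C₁ * c + (A + K₀) + 2 * A + 3 * K₀ * (2 / (1 - θ)), c, (1 - θ) / 2, ?_,
    by linarith, by linarith, fun v τ s hv0 hvδ hτ hs1 hs4 him1 him2 => ?_⟩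
  · have : 0 < 1 - θ := by linarith
    positivity
  have hθ' : 0 < 1 - θ := by linarith
  have hτ0 : 0 < τ := by linarith
  have hlogτ : 1 ≤ Real.log τ := by
    rw [Real.le_log_iff_exp_le hτ0]
    linarith [Real.exp_one_lt_d9]
  set Y := τ ^ c with hYdef
  have hYτ : τ ≤ Y := by
    simpa using Real.rpow_le_rpow_of_exponent_le (by linarith : 1 ≤ τ) hc1
  have hY : 1 ≤ Y := by linarith
  have hY0 : 0 < Y := by linarith
  have hlogY : Real.log Y = c * Real.log τ := Real.log_rpow hτ0 c
  have hlogY1 : 1 ≤ Real.log Y := by rw [hlogY]; nlinarith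
  have hYv : τ ^ (c * v) = Y ^ v := by rw [hYdef, Real.rpow_mul hτ0.le]
  have hYv1 : 1 ≤ Y ^ v := Real.one_le_rpow hY hv0
  have hsθ : θ < s.re := by linarith
  have hsne : s ≠ 1 := by
    rintro rfl
    simp at him1
    linarith
  rw [IsZeta.eq_truncatedZeta h hζ hY hsθ hsne, hYv]
  -- the finite sum
  set η := 1 / Real.log Y with hη
  have hη0 : 0 < η := by positivity
  have hη1 : η ≤ 1 := by
    rw [hη, div_le_one (by linarith)]
    exact hlogY1
  have hYη : Y ^ η = Real.exp 1 := by
    rw [Real.rpow_def_of_pos hY0, hη, mul_one_div_cancel (by linarith)]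
  have hsum : ∑ n ∈ (S.finite_val_le Y).toFinset, S.val n ^ (-s.re)
      ≤ Real.exp 1 * C₁ * c * Y ^ v * Real.log τ := by
    have h1 : ∀ n ∈ (S.finite_val_le Y).toFinset,
        S.val n ^ (-s.re) ≤ (Y ^ v * Real.exp 1) * S.val n ^ (-(1 + η)) := by
      intro n hn
      simp only [Set.Finite.mem_toFinset, Set.mem_ofPred_eq] at hn
      have hn0 := S.val_pos n
      calc S.val n ^ (-s.re) ≤ S.val n ^ (v - 1) :=
            Real.rpow_le_rpow_of_exponent_le (S.one_le_val n) (by linarith)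
        _ = S.val n ^ (v + η) * S.val n ^ (-(1 + η)) := by
            rw [← Real.rpow_add hn0]
            congr 1
            ring
        _ ≤ Y ^ (v + η) * S.val n ^ (-(1 + η)) := by
            gcongr
        _ = _ := by rw [Real.rpow_add hY0, hYη]
    refine (Finset.sum_le_sum h1).trans ?_
    rw [← Finset.mul_sum]
    have hsm := summable_val_rpow (S := S) (fun x hx => h.cnt_le hx) (σ := 1 + η) (by linarith)
    have h2 : ∑ n ∈ (S.finite_val_le Y).toFinset, S.val n ^ (-(1 + η)) ≤ ∑' n, S.val n ^ (-(1 + η)) :=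
      hsm.sum_le_tsum _ fun n _ => Real.rpow_nonneg (S.val_pos n).le _
    have h3 : ∑' n, S.val n ^ (-(1 + η)) = (S.dirichlet (fun _ => 1) ((1 + η : ℝ) : ℂ)).re := by
      have := re_dirichlet (abs_one_summable (S := S) fun x hx => h.cnt_le hx)
        (s := ((1 + η : ℝ) : ℂ)) (by simpa using hη0)
      rw [← this.tsum_eq]
      refine tsum_congr fun n => ?_
      rw [Complex.ofReal_re, Complex.ofReal_im]
      simp
    have h4 := (Complex.re_le_norm _).trans (hC₁ (1 + η) (by linarith) (by linarith))
    rw [h3] at h2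
    have h5 : C₁ / (1 + η - 1) = C₁ * c * Real.log τ := by
      rw [add_sub_cancel_left, hη, div_div_eq_mul_div, div_one, hlogY]
      ring
    rw [h5] at h4
    calc _ ≤ Y ^ v * Real.exp 1 * (C₁ * c * Real.log τ) := by
          gcongr
          exact h2.trans h4
      _ = _ := by ring
  have hYσ : Y ^ (1 - s.re) ≤ Y ^ v := Real.rpow_le_rpow_of_exponent_le hY (by linarith)
  have p1 : ‖∑ n ∈ (S.finite_val_le Y).toFinset, ((S.val n : ℂ) ^ (-s) - (Y : ℂ) ^ (-s))‖
      ≤ Real.exp 1 * C₁ * c * Y ^ v * Real.log τ + (A + K₀) * Y ^ v := by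
    rw [Finset.sum_sub_distrib]
    refine (norm_sub_le _ _).trans (add_le_add ?_ ?_)
    · refine (norm_sum_le _ _).trans ?_
      simp_rw [norm_val_cpow]
      exact hsum
    · rw [Finset.sum_const, nsmul_eq_mul, norm_mul, Complex.norm_natCast,
        Complex.norm_cpow_eq_rpow_re_of_pos hY0]
      have h1 : (((S.finite_val_le Y).toFinset.card : ℕ) : ℝ) = S.cnt Y := by
        unfold cnt
        rw [Set.ncard_eq_toFinset_card _ (S.finite_val_le Y)]
      rw [h1]
      calc S.cnt Y * Y ^ (-s).re ≤ ((A + K₀) * Y) * Y ^ (-s).re := by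
            gcongr
            exact h.cnt_le hY
        _ = (A + K₀) * Y ^ (1 - s.re) := by
            rw [mul_assoc, mul_comm Y, ← Real.rpow_add_one hY0.ne', Complex.neg_re]
            ring_nf
        _ ≤ _ := by gcongr
  have him' : 1 ≤ ‖s - 1‖ := by
    have := Complex.abs_im_le_norm (s - 1)
    simp at this
    linarith
  have p2 : ‖s * A * (Y : ℂ) ^ (1 - s) / (s - 1)‖ ≤ 2 * A * Y ^ v := by
    rw [norm_div, norm_mul, norm_mul, Complex.norm_real, Real.norm_eq_abs, abs_of_pos hA,
      Complex.norm_cpow_eq_rpow_re_of_pos hY0, div_le_iff₀ (by linarith)]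
    have h1 : ‖s‖ ≤ 2 * ‖s - 1‖ := by
      have := norm_add_le (s - 1) 1
      rw [sub_add_cancel, norm_one] at this
      linarith
    have h2 : (1 - s).re = 1 - s.re := by simp
    rw [h2]
    calc ‖s‖ * A * Y ^ (1 - s.re) ≤ (2 * ‖s - 1‖) * A * Y ^ v := by gcongr
      _ = _ := by ring
  have p3 : ‖s * S.remainderIntegral A Y s‖ ≤ 3 * K₀ * (2 / (1 - θ)) * Y ^ v := by
    rw [norm_mul]
    have h1 := h.norm_remainderIntegral_le hY hsθ
    have h2 : ‖s‖ ≤ 3 * τ := by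
      have := Complex.norm_le_abs_re_add_abs_im s
      have h3 : |s.re| ≤ 4 := abs_le.2 ⟨by linarith, hs4⟩
      linarith
    have h3 : Y ^ (θ - s.re) ≤ τ⁻¹ * Y ^ v := by
      have : τ⁻¹ = Y ^ (θ - 1) := by
        rw [hYdef, ← Real.rpow_mul hτ0.le, hc, ← Real.rpow_neg_one]
        congr 1
        field_simp
        ring
      rw [this, ← Real.rpow_add hY0]
      exact Real.rpow_le_rpow_of_exponent_le hY (by linarith)
    have h4 : 1 / (s.re - θ) ≤ 2 / (1 - θ) := by
      rw [div_le_div_iff₀ (by linarith) hθ']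
      linarith
    calc ‖s‖ * ‖S.remainderIntegral A Y s‖ ≤ (3 * τ) * (K₀ * (τ⁻¹ * Y ^ v) * (1 / (s.re - θ))) := by
          rw [mul_one_div]
          gcongr
          refine h1.trans ?_
          have : 0 < s.re - θ := by linarith
          gcongr
      _ ≤ (3 * τ) * (K₀ * (τ⁻¹ * Y ^ v) * (2 / (1 - θ))) := by gcongr
      _ = _ := by field_simp
  have hfin : ∀ x : ℝ, 0 ≤ x → x * Y ^ v ≤ x * Y ^ v * Real.log τ := fun x hx =>
    le_mul_of_one_le_right (by positivity) hlogτ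
  have q1 := hfin (A + K₀) (by linarith)
  have q2 := hfin (2 * A) (by linarith)
  have q3 := hfin (3 * K₀ * (2 / (1 - θ))) (by positivity)
  unfold truncatedZeta
  refine (norm_add_le _ _).trans ((add_le_add (norm_add_le _ _) le_rfl).trans ?_)
  linarith

end BeurlingSystem

namespace BeurlingSystem

open MeasureTheory

variable {S : BeurlingSystem} {A θ K₀ : ℝ} {ζ : ℂ → ℂ}

lemma WellBehaved.differentiableOn_regularizedZeta (h : S.WellBehaved A θ K₀) :
    DifferentiableOn ℂ (S.regularizedZeta A) {s : ℂ | θ < s.re} := fun _ hs =>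
  (h.differentiableAt_regularizedZeta hs).differentiableWithinAt

lemma WellBehaved.finite_zeros (h : S.WellBehaved A θ K₀) {b₁ : ℝ} (hb : θ < b₁) (T : ℝ) :
    {ρ : ℂ | b₁ ≤ ρ.re ∧ |ρ.im| ≤ T ∧ S.regularizedZeta A ρ = 0}.Finite := by
  by_contra hinf
  have hK : IsCompact (Set.Icc b₁ 1 ×ℂ Set.Icc (-T) T) := isCompact_Icc.reProdIm isCompact_Icc
  obtain ⟨z, hz, hacc⟩ := Set.Infinite.exists_accPt_of_subset_isCompact hinf hK (by
    rintro ρ ⟨h1, h2, h3⟩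
    refine ⟨⟨h1, ?_⟩, abs_le.mp h2⟩
    by_contra! h4
    exact h.regularizedZeta_ne_zero_of_one_le h4.le h3)
  have h1 : AnalyticOnNhd ℂ (S.regularizedZeta A) {s : ℂ | θ < s.re} :=
    h.differentiableOn_regularizedZeta.analyticOnNhd (isOpen_lt_re θ)
  have h2 := h1.eqOn_zero_of_preconnected_of_frequently_eq_zero
    (convex_halfSpace_re_gt θ).isPreconnected (show θ < z.re from hb.trans_le hz.1.1)
    ((accPt_iff_frequently_nhdsNE.mp hacc).mono fun ρ hρ => hρ.2.2)
  have hθ := h.2.2.1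
  exact h.regularizedZeta_ne_zero_of_one_le (s := 2) (by simp)
    (h2 (show θ < (2 : ℂ).re by simp; linarith))

/-- `Z` is the set of zeros of the regularized zeta function in `b₁ ≤ Re s`, `|Im s| ≤ T`,
and these zeros are split off with multiplicities `m`, leaving the cofactor `g`. -/
structure ZeroFactorization (S : BeurlingSystem) (A θ b₁ T : ℝ) (Z : Finset ℂ) (m : ℂ → ℕ)
    (g : ℂ → ℂ) : Prop where
  mem_iff : ∀ ρ, ρ ∈ Z ↔ b₁ ≤ ρ.re ∧ |ρ.im| ≤ T ∧ S.regularizedZeta A ρ = 0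
  differentiableOn : DifferentiableOn ℂ g {s : ℂ | θ < s.re}
  ne_zero : ∀ ρ ∈ Z, g ρ ≠ 0
  eq_mul : ∀ z, S.regularizedZeta A z = (∏ ρ ∈ Z, (z - ρ) ^ m ρ) * g z

lemma WellBehaved.exists_zeroFactorization (h : S.WellBehaved A θ K₀) {b₁ : ℝ} (hb : θ < b₁)
    (T : ℝ) : ∃ Z m g, S.ZeroFactorization A θ b₁ T Z m g := by
  have hθ := h.2.2.1
  obtain ⟨m, g, h1, h2, h3⟩ := exists_finset_zero_factorization (isOpen_lt_re θ)
    (convex_halfSpace_re_gt θ).isPreconnected h.differentiableOn_regularizedZeta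
    ⟨2, show θ < (2 : ℂ).re by simp; linarith, h.regularizedZeta_ne_zero_of_one_le (by simp)⟩
    (h.finite_zeros hb T).toFinset (fun ρ hρ => by
      rw [Set.Finite.mem_toFinset] at hρ
      exact hb.trans_le hρ.1)
  exact ⟨_, m, g, fun ρ => by simp, h1, h2, h3⟩

lemma ZeroFactorization.re_lt_one (h : S.WellBehaved A θ K₀) {b₁ T : ℝ} {Z : Finset ℂ} {m : ℂ → ℕ}
    {g : ℂ → ℂ} (hZ : S.ZeroFactorization A θ b₁ T Z m g) {ρ : ℂ} (hρ : ρ ∈ Z) : ρ.re < 1 := by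
  by_contra! h1
  exact h.regularizedZeta_ne_zero_of_one_le h1 ((hZ.mem_iff ρ).mp hρ).2.2

lemma ZeroFactorization.cofactor_ne_zero {b₁ T : ℝ} {Z : Finset ℂ} {m : ℂ → ℕ}
    {g : ℂ → ℂ} (hZ : S.ZeroFactorization A θ b₁ T Z m g) {s : ℂ} (hs : b₁ ≤ s.re)
    (hsT : |s.im| ≤ T) : g s ≠ 0 := by
  by_cases hm : s ∈ Z
  · exact hZ.ne_zero s hm
  · intro h0
    exact hm ((hZ.mem_iff s).mpr ⟨hs, hsT, by rw [hZ.eq_mul, h0, mul_zero]⟩)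

lemma ZeroFactorization.eq_mul_subset {b₁ T : ℝ} {Z : Finset ℂ} {m : ℂ → ℕ}
    {g : ℂ → ℂ} (hZ : S.ZeroFactorization A θ b₁ T Z m g) {D : Finset ℂ} (hD : D ⊆ Z) (z : ℂ) :
    S.regularizedZeta A z = (∏ ρ ∈ D, (z - ρ) ^ m ρ) *
      ((∏ ρ ∈ Z \ D, (z - ρ) ^ m ρ) * g z) := by
  rw [hZ.eq_mul, ← Finset.prod_sdiff hD]
  ring

lemma ZeroFactorization.differentiableOn_prod_mul {b₁ T : ℝ} {Z : Finset ℂ} {m : ℂ → ℕ}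
    {g : ℂ → ℂ} (hZ : S.ZeroFactorization A θ b₁ T Z m g) (D : Finset ℂ) :
    DifferentiableOn ℂ (fun z => (∏ ρ ∈ D, (z - ρ) ^ m ρ) * g z) {s : ℂ | θ < s.re} := by
  have h1 : Differentiable ℂ (fun z : ℂ => ∏ ρ ∈ D, (z - ρ) ^ m ρ) := by fun_prop
  exact h1.differentiableOn.mul hZ.differentiableOn

lemma WellBehaved.exists_disc_bounds (h : S.WellBehaved A θ K₀) {θ' : ℝ} (hθ' : θ < θ')
    (hθ1 : θ' < 1) : ∃ c C C' : ℝ, 0 < c ∧ 0 < C' ∧ ∀ T t : ℝ, 3 ≤ T → |t| ≤ 2 * T →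
      (∀ s ∈ Metric.sphere (2 + t * Complex.I) (2 - θ'), ‖S.regularizedZeta A s‖ ≤ C * T ^ 2) ∧
      c ≤ ‖S.regularizedZeta A (2 + t * Complex.I)‖ ∧ c < C * T ^ 2 ∧
      Real.log (C * T ^ 2 / c) ≤ C' * Real.log T := by
  obtain ⟨C, hC0, hC⟩ := h.exists_norm_regularizedZeta_le hθ'
  obtain ⟨c, hc0, hc⟩ := h.exists_le_norm_regularizedZeta
  have hθ0 := h.2.1
  set C₁ : ℝ := max (16 * C) c with hC₁
  have hC₁c : c ≤ C₁ := le_max_right _ _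
  have hC₁C : 16 * C ≤ C₁ := le_max_left _ _
  have hq : 0 ≤ Real.log (C₁ / c) := Real.log_nonneg ((one_le_div hc0).mpr hC₁c)
  refine ⟨c, C₁, Real.log (C₁ / c) + 2, hc0, by linarith, fun T t hT ht => ⟨?_, ?_, ?_, ?_⟩⟩
  · intro s hs
    rw [mem_sphere_iff_norm] at hs
    have h1 : |(s - (2 + t * Complex.I)).re| ≤ 2 - θ' := (Complex.abs_re_le_norm _).trans hs.le
    simp only [Complex.sub_re, Complex.add_re, Complex.re_ofNat, Complex.mul_re, Complex.ofReal_re,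
      Complex.I_re, mul_zero, Complex.ofReal_im, Complex.I_im, mul_one, sub_self, add_zero] at h1
    have h2 : ‖s‖ ≤ (2 - θ') + (2 + 2 * T) := by
      calc ‖s‖ = ‖(s - (2 + t * Complex.I)) + (2 + t * Complex.I)‖ := by congr 1; ring
        _ ≤ ‖s - (2 + t * Complex.I)‖ + ‖(2 + t * Complex.I : ℂ)‖ := norm_add_le _ _
        _ ≤ _ := by
          gcongr
          · exact hs.le
          · refine (norm_add_le _ _).trans ?_
            simpa using ht
    refine (hC s (by linarith [abs_le.mp h1])).trans ?_
    calc C * (1 + ‖s‖) ^ 2 ≤ C * (4 * T) ^ 2 := by gcongr; linarith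
      _ = 16 * C * T ^ 2 := by ring
      _ ≤ _ := by gcongr
  · have h1 := hc (2 + t * Complex.I) (by simp) (by simp; norm_num)
    refine le_trans ?_ h1
    have h2 := Complex.abs_re_le_norm (2 + t * Complex.I - 1)
    simp only [Complex.sub_re, Complex.add_re, Complex.re_ofNat, Complex.mul_re, Complex.ofReal_re,
      Complex.I_re, mul_zero, Complex.ofReal_im, Complex.I_im, mul_one, sub_self, add_zero,
      Complex.one_re] at h2 ⊢
    norm_num at h2 ⊢
    nlinarith
  · have hT2 : 9 ≤ T ^ 2 := by nlinarith
    nlinarith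
  · have hT0 : 0 < T := by linarith
    have hc1 : 0 < C₁ := hc0.trans_le hC₁c
    have h1 : 1 ≤ Real.log T := by
      rw [Real.le_log_iff_exp_le hT0]
      exact Real.exp_one_lt_three.le.trans hT
    rw [mul_div_right_comm, Real.log_mul (by positivity) (by positivity), Real.log_pow]
    push_cast
    nlinarith

lemma closedBall_subset_lt_re {θ' : ℝ} (hθ' : θ < θ') (t : ℝ) :
    Metric.closedBall (2 + t * Complex.I) (2 - θ') ⊆ {s : ℂ | θ < s.re} := by
  intro s hs
  rw [mem_closedBall_iff_norm] at hs
  have h1 : |(s - (2 + t * Complex.I)).re| ≤ 2 - θ' := (Complex.abs_re_le_norm _).trans hs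
  simp only [Complex.sub_re, Complex.add_re, Complex.re_ofNat, Complex.mul_re, Complex.ofReal_re,
    Complex.I_re, mul_zero, Complex.ofReal_im, Complex.I_im, mul_one, sub_self, add_zero] at h1
  show θ < s.re
  linarith [abs_le.mp h1]

lemma WellBehaved.exists_sum_multiplicity_le (h : S.WellBehaved A θ K₀) {b₁ : ℝ} (hb : θ < b₁)
    (hb1 : b₁ < 1) : ∃ η C : ℝ, 0 < η ∧ 0 < C ∧ ∀ (T : ℝ) (Z : Finset ℂ) (m : ℂ → ℕ) (g : ℂ → ℂ),
      3 ≤ T → S.ZeroFactorization A θ b₁ T Z m g → ∀ t : ℝ,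
        ∑ ρ ∈ Z with |ρ.im - t| ≤ η, (m ρ : ℝ) ≤ C * Real.log T := by
  set θ' := (θ + b₁) / 2 with hθ'
  have hθ0 := h.2.1
  obtain ⟨c, C, C', hc0, hC', hb⟩ := h.exists_disc_bounds (θ' := θ') (by linarith) (by linarith)
  set η := (b₁ - θ') / 2 with hη
  have hη0 : 0 < η := by linarith
  set r := 2 - b₁ + η with hr
  have hr0 : 0 < r := by linarith
  have hrR : r < 2 - θ' := by linarith
  have hlog : 0 < Real.log ((2 - θ') / r) := Real.log_pos ((one_lt_div hr0).mpr hrR)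
  refine ⟨η, C' / Real.log ((2 - θ') / r), hη0, by positivity, fun T Z m g hT hZ t => ?_⟩
  have hlogT : 0 ≤ Real.log T := Real.log_nonneg (by linarith)
  by_cases ht : |t| ≤ 2 * T
  · obtain ⟨h1, h2, h3, h4⟩ := hb T t hT ht
    rw [div_mul_eq_mul_div, le_div_iff₀ hlog]
    refine le_trans ?_ h4
    have hs := hZ.eq_mul_subset (Finset.filter_subset (fun ρ : ℂ => |ρ.im - t| ≤ η) Z)
    refine sum_multiplicity_le hr0 hrR (closedBall_subset_lt_re (by linarith) t)
      (hZ.differentiableOn_prod_mul _) ?_ ?_ hc0 (by rw [← hs]; exact h2)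
    · intro ρ hρ
      rw [Finset.mem_filter] at hρ
      have h5 := hZ.re_lt_one h hρ.1
      have h6 := ((hZ.mem_iff ρ).mp hρ.1).1
      refine (Complex.norm_le_abs_re_add_abs_im _).trans ?_
      simp only [Complex.sub_re, Complex.add_re, Complex.re_ofNat, Complex.mul_re,
        Complex.ofReal_re, Complex.I_re, mul_zero, Complex.ofReal_im, Complex.I_im, mul_one,
        sub_self, add_zero, Complex.sub_im, Complex.add_im, Complex.im_ofNat, Complex.mul_im,
        zero_add]
      rw [abs_of_nonpos (by linarith)]
      linarith [hρ.2]
    · intro s hs'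
      rw [← hs]
      exact h1 s hs'
  · rw [Finset.filter_false_of_mem, Finset.sum_empty]
    · positivity
    · intro ρ hρ h5
      have h6 := ((hZ.mem_iff ρ).mp hρ).2.1
      have h7 := abs_sub_abs_le_abs_sub t ρ.im
      rw [abs_sub_comm] at h7
      linarith

lemma WellBehaved.exists_sum_multiplicity_mul_le (h : S.WellBehaved A θ K₀) {b₁ : ℝ} (hb : θ < b₁)
    (hb1 : b₁ < 1) : ∃ η C : ℝ, 0 < η ∧ 0 < C ∧ ∀ (T : ℝ) (Z : Finset ℂ) (m : ℂ → ℕ) (g : ℂ → ℂ),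
      3 ≤ T → S.ZeroFactorization A θ b₁ T Z m g → ∀ (t : ℝ) (φ : ℝ → ℝ) (N : ℕ),
        (∀ u v, 0 ≤ u → u ≤ v → φ v ≤ φ u) → (∀ u, 0 ≤ u → 0 ≤ φ u) →
        (∀ ρ ∈ Z, |ρ.im - t| < N * η) →
        ∑ ρ ∈ Z, m ρ * φ |ρ.im - t| ≤ C * Real.log T * ∑ k ∈ Finset.range N, φ (k * η) := by
  obtain ⟨η, C, hη, hC, hw⟩ := h.exists_sum_multiplicity_le hb hb1
  refine ⟨η, 2 * C, hη, by positivity, fun T Z m g hT hZ t φ N hφ hφ0 hN => ?_⟩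
  rw [Finset.mul_sum, ← Finset.sum_fiberwise_of_maps_to
    (s := Z) (t := Finset.range N) (g := fun ρ : ℂ => ⌊|ρ.im - t| / η⌋₊) (fun ρ hρ => by
      rw [Finset.mem_range, Nat.floor_lt (by positivity), div_lt_iff₀ hη]
      exact hN ρ hρ)]
  refine Finset.sum_le_sum fun k _ => ?_
  have hk0 : 0 ≤ (k : ℝ) * η := by positivity
  calc ∑ ρ ∈ Z with ⌊|ρ.im - t| / η⌋₊ = k, m ρ * φ |ρ.im - t|
      ≤ ∑ ρ ∈ Z with ⌊|ρ.im - t| / η⌋₊ = k, m ρ * φ (k * η) := by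
        refine Finset.sum_le_sum fun ρ hρ => ?_
        rw [Finset.mem_filter, Nat.floor_eq_iff (by positivity), le_div_iff₀ hη] at hρ
        gcongr
        exact hφ _ _ hk0 hρ.2.1
    _ = (∑ ρ ∈ Z with ⌊|ρ.im - t| / η⌋₊ = k, (m ρ : ℝ)) * φ (k * η) := by rw [Finset.sum_mul]
    _ ≤ (∑ ρ ∈ Z with |ρ.im - (t + k * η)| ≤ η, (m ρ : ℝ) +
          ∑ ρ ∈ Z with |ρ.im - (t - k * η)| ≤ η, (m ρ : ℝ)) * φ (k * η) := by
        refine mul_le_mul_of_nonneg_right ?_ (hφ0 _ hk0)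
        rw [← Finset.sum_union_inter]
        refine (Finset.sum_le_sum_of_subset_of_nonneg ?_ fun _ _ _ => by positivity).trans
          (le_add_of_nonneg_right (Finset.sum_nonneg fun _ _ => by positivity))
        intro ρ hρ
        rw [Finset.mem_filter, Nat.floor_eq_iff (by positivity), le_div_iff₀ hη,
          div_lt_iff₀ hη] at hρ
        rw [Finset.mem_union, Finset.mem_filter, Finset.mem_filter, abs_le, abs_le]
        rcases abs_cases (ρ.im - t) with h1 | h1
        · exact Or.inl ⟨hρ.1, by constructor <;> linarith⟩
        · exact Or.inr ⟨hρ.1, by constructor <;> linarith⟩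
    _ ≤ 2 * C * Real.log T * φ (k * η) := by
        refine mul_le_mul_of_nonneg_right ?_ (hφ0 _ hk0)
        linarith [hw T Z m g hT hZ (t + k * η), hw T Z m g hT hZ (t - k * η)]

lemma WellBehaved.exists_sum_multiplicity_le_mul_log (h : S.WellBehaved A θ K₀) {b₁ : ℝ}
    (hb : θ < b₁) (hb1 : b₁ < 1) : ∃ C : ℝ, 0 < C ∧
      ∀ (T : ℝ) (Z : Finset ℂ) (m : ℂ → ℕ) (g : ℂ → ℂ),
        3 ≤ T → S.ZeroFactorization A θ b₁ T Z m g →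
          ∑ ρ ∈ Z, (m ρ : ℝ) ≤ C * (T * Real.log T) := by
  obtain ⟨η, C, hη, hC, hw⟩ := h.exists_sum_multiplicity_mul_le hb hb1
  refine ⟨C * (1 / η + 1), by positivity, fun T Z m g hT hZ => ?_⟩
  have h1 := hw T Z m g hT hZ 0 (fun _ => 1) (⌊T / η⌋₊ + 1) (by simp) (by simp) (fun ρ hρ => by
    have h2 := ((hZ.mem_iff ρ).mp hρ).2.1
    have h3 := Nat.lt_floor_add_one (T / η)
    rw [div_lt_iff₀ hη] at h3
    push_cast
    rw [sub_zero]
    linarith)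
  simp only [mul_one, Finset.sum_const, Finset.card_range, nsmul_eq_mul] at h1
  refine h1.trans ?_
  have hlogT : 0 ≤ Real.log T := Real.log_nonneg (by linarith)
  have h3 := Nat.floor_le (show 0 ≤ T / η by positivity)
  push_cast
  calc C * Real.log T * (⌊T / η⌋₊ + 1) ≤ C * Real.log T * (T / η + T) := by
        gcongr; linarith
    _ = _ := by ring

/-- Far zeros contribute at most `O(log² T)` to the logarithmic derivative. -/
lemma WellBehaved.exists_sum_multiplicity_div_le (h : S.WellBehaved A θ K₀) {b₁ r₀ : ℝ}
    (hb : θ < b₁) (hb1 : b₁ < 1) (hr₀ : 0 < r₀) : ∃ C : ℝ, 0 < C ∧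
      ∀ (T : ℝ) (Z : Finset ℂ) (m : ℂ → ℕ) (g : ℂ → ℂ),
        3 ≤ T → S.ZeroFactorization A θ b₁ T Z m g → ∀ t, |t| ≤ T →
          ∑ ρ ∈ Z, m ρ * (max r₀ |ρ.im - t|)⁻¹ ≤ C * Real.log T ^ 2 := by
  obtain ⟨η, C, hη, hC, hw⟩ := h.exists_sum_multiplicity_mul_le hb hb1
  have hl : 0 ≤ |Real.log (2 / η + 1)| := abs_nonneg _
  refine ⟨C * (r₀⁻¹ + η⁻¹ * (2 + |Real.log (2 / η + 1)|)), by positivity,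
    fun T Z m g hT hZ t ht => ?_⟩
  have hT0 : 0 < T := by linarith
  have hlogT : 1 ≤ Real.log T := by
    rw [Real.le_log_iff_exp_le hT0]
    exact Real.exp_one_lt_three.le.trans hT
  set N := ⌊2 * T / η⌋₊ with hN
  have h1 := hw T Z m g hT hZ t (fun u => (max r₀ u)⁻¹) (N + 1)
    (fun u v _ huv => by gcongr)
    (fun u hu => by positivity) (fun ρ hρ => by
      have h2 := ((hZ.mem_iff ρ).mp hρ).2.1
      have h3 := Nat.lt_floor_add_one (2 * T / η)
      rw [div_lt_iff₀ hη] at h3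
      push_cast
      linarith [abs_sub ρ.im t])
  refine h1.trans ?_
  have h2 : ∑ k ∈ Finset.range (N + 1), (max r₀ (k * η))⁻¹ ≤ r₀⁻¹ + η⁻¹ * (1 + Real.log N) := by
    rw [Finset.sum_range_succ', add_comm]
    refine add_le_add (by gcongr; exact le_max_left _ _) ?_
    have h3 := harmonic_le_one_add_log N
    unfold harmonic at h3
    push_cast at h3
    refine le_trans ?_ (mul_le_mul_of_nonneg_left h3 (by positivity))
    rw [Finset.mul_sum]
    refine Finset.sum_le_sum fun k _ => ?_
    rw [← mul_inv]
    gcongr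
    push_cast
    rw [mul_comm]
    exact le_max_right _ _
  have h3 : Real.log N ≤ Real.log T + |Real.log (2 / η + 1)| := by
    rcases Nat.eq_zero_or_pos N with h0 | h0
    · rw [h0]
      simp only [Nat.cast_zero, Real.log_zero]
      positivity
    · have h4 : (N : ℝ) ≤ T * (2 / η + 1) := by
        have h3 := Nat.floor_le (show 0 ≤ 2 * T / η by positivity)
        rw [← hN] at h3
        calc (N : ℝ) ≤ 2 * T / η := h3
          _ ≤ 2 * T / η + T := by linarith
          _ = _ := by ring
      have h5 := Real.log_le_log (by exact_mod_cast h0) h4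
      rw [Real.log_mul (by positivity) (by positivity)] at h5
      linarith [le_abs_self (Real.log (2 / η + 1))]
  have h4 : ∑ k ∈ Finset.range (N + 1), (max r₀ (k * η))⁻¹ ≤
      (r₀⁻¹ + η⁻¹ * (2 + |Real.log (2 / η + 1)|)) * Real.log T := by
    refine h2.trans ?_
    rw [add_mul, mul_assoc η⁻¹]
    refine add_le_add (le_mul_of_one_le_right (by positivity) hlogT) ?_
    gcongr
    nlinarith
  calc C * Real.log T * ∑ k ∈ Finset.range (N + 1), (max r₀ (k * η))⁻¹
      ≤ C * Real.log T * ((r₀⁻¹ + η⁻¹ * (2 + |Real.log (2 / η + 1)|)) * Real.log T) := by gcongr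
    _ = _ := by ring

lemma WellBehaved.exists_norm_logDeriv_cofactor_le (h : S.WellBehaved A θ K₀) {b₁ b₂ : ℝ}
    (hb : θ < b₁) (hb12 : b₁ < b₂) (hb2 : b₂ < 1) : ∃ C : ℝ, 0 < C ∧
      ∀ (T : ℝ) (Z : Finset ℂ) (m : ℂ → ℕ) (g : ℂ → ℂ),
        3 ≤ T → S.ZeroFactorization A θ b₁ (T + 2) Z m g → ∀ s : ℂ, b₂ ≤ s.re → s.re ≤ 2 →
          |s.im| ≤ T → ‖logDeriv g s‖ ≤ C * Real.log T ^ 2 := by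
  have hb1 : b₁ < 1 := by linarith
  have hθ0 := h.2.1
  set θ' := (θ + b₁) / 2 with hθ'
  obtain ⟨c₀, M, C₁, hc0, hC1, hdisc⟩ := h.exists_disc_bounds (θ' := θ') (by linarith) (by linarith)
  obtain ⟨C₂, hC2, hfar⟩ := h.exists_sum_multiplicity_div_le (r₀ := b₂ - b₁) hb hb1 (by linarith)
  obtain ⟨C₃, hC3, hnear⟩ := exists_norm_logDeriv_le (2 - b₂) (2 - b₁) (2 - θ') (by linarith)
    (by linarith) (by linarith)
  refine ⟨4 * (C₃ * C₁ + C₂), by positivity, fun T Z m g hT hZ s hs1 hs2 hsT => ?_⟩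
  set t := s.im with ht
  set c : ℂ := 2 + t * Complex.I with hc
  have hsc : ‖s - c‖ ≤ 2 - b₂ := by
    have : s - c = ((s.re - 2 : ℝ) : ℂ) := by
      apply Complex.ext <;> simp [hc, ht]
    rw [this, Complex.norm_real, Real.norm_eq_abs, abs_le]
    constructor <;> linarith
  have hT' : 3 ≤ T + 2 := by linarith
  obtain ⟨h1, h2, h3, h4⟩ := hdisc (T + 2) t hT' (by linarith)
  have hD : Z.filter (fun ρ => ‖ρ - c‖ ≤ 2 - b₁) ⊆ Z := Finset.filter_subset _ _
  set D := Z.filter (fun ρ => ‖ρ - c‖ ≤ 2 - b₁) with hDdef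
  have hfac := hZ.eq_mul_subset hD
  have hfarρ : ∀ ρ ∈ Z \ D, 2 - b₁ < ‖ρ - c‖ := by
    intro ρ hρ
    rw [Finset.mem_sdiff, hDdef, Finset.mem_filter] at hρ
    by_contra! h5
    exact hρ.2 ⟨hρ.1, h5⟩
  have hne : ∀ z ∈ Metric.ball c (2 - b₁), ∀ ρ ∈ Z \ D, z - ρ ≠ 0 := by
    intro z hz ρ hρ h0
    rw [sub_eq_zero.mp h0, mem_ball_iff_norm] at hz
    exact absurd hz (hfarρ ρ hρ).not_gt
  have hgne : ∀ z ∈ Metric.ball c (2 - b₁), g z ≠ 0 := by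
    intro z hz
    rw [mem_ball_iff_norm] at hz
    have e1 := (Complex.abs_re_le_norm _).trans hz.le
    have e2 := (Complex.abs_im_le_norm _).trans hz.le
    simp only [hc, Complex.sub_re, Complex.add_re, Complex.re_ofNat, Complex.mul_re,
      Complex.ofReal_re, Complex.I_re, mul_zero, Complex.ofReal_im, Complex.I_im, mul_one,
      sub_self, add_zero, Complex.sub_im, Complex.add_im, Complex.im_ofNat, Complex.mul_im,
      zero_add] at e1 e2
    refine hZ.cofactor_ne_zero (by linarith [abs_le.mp e1]) ?_
    have e3 := abs_sub_abs_le_abs_sub z.im t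
    linarith
  have hsball : s ∈ Metric.ball c (2 - b₁) := by
    rw [mem_ball_iff_norm]
    linarith
  have hUR := closedBall_subset_lt_re (θ := θ) (θ' := θ') (by linarith) t
  have h5 := hnear (fun z => (∏ ρ ∈ Z \ D, (z - ρ) ^ m ρ) * g z) _ c D m (M * (T + 2) ^ 2) c₀
    (isOpen_lt_re θ) hUR (hZ.differentiableOn_prod_mul _)
    (fun ρ hρ => (Finset.mem_filter.mp hρ).2) (fun z hz => by rw [← hfac]; exact h1 z hz) hc0 h3
    (by rw [← hfac]; exact h2)
    (fun z hz => mul_ne_zero (Finset.prod_ne_zero_iff.mpr fun ρ hρ =>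
      pow_ne_zero _ (hne z hz ρ hρ)) (hgne z hz)) s (by
        rw [mem_closedBall_iff_norm]
        exact hsc)
  have hgd : DifferentiableAt ℂ g s := hZ.differentiableOn.differentiableAt
    ((isOpen_lt_re θ).mem_nhds (show θ < s.re by linarith))
  rw [logDeriv_mul s (f := fun z : ℂ => ∏ ρ ∈ Z \ D, (z - ρ) ^ m ρ)
    (Finset.prod_ne_zero_iff.mpr fun ρ hρ => pow_ne_zero _ (hne s hsball ρ hρ)) (hgne s hsball)
    (by fun_prop) hgd, logDeriv_prod_pow (Z \ D) m (fun ρ z => z - ρ) s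
    (fun ρ hρ => hne s hsball ρ hρ) (fun ρ _ => by fun_prop)] at h5
  have h6 : ‖∑ ρ ∈ Z \ D, (m ρ : ℂ) * logDeriv (fun z : ℂ => z - ρ) s‖ ≤
      C₂ * Real.log (T + 2) ^ 2 := by
    refine (norm_sum_le _ _).trans (le_trans ?_ (hfar (T + 2) Z m g hT' hZ t (by linarith)))
    refine le_trans ?_ (Finset.sum_le_sum_of_subset_of_nonneg (Finset.sdiff_subset (s := Z) (t := D))
      fun ρ _ _ => mul_nonneg (by positivity) (inv_nonneg.mpr ((sub_pos.mpr hb12).le.trans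
        (le_max_left _ _))))
    refine Finset.sum_le_sum fun ρ hρ => ?_
    have e1 : logDeriv (fun z : ℂ => z - ρ) s = (s - ρ)⁻¹ := by
      simp [logDeriv_apply]
    rw [e1, norm_mul, norm_inv, Complex.norm_natCast]
    gcongr
    · refine max_le ?_ ?_
      · have := norm_sub_le_norm_sub_add_norm_sub ρ s c
        rw [norm_sub_rev ρ s] at this
        linarith [hfarρ ρ hρ]
      · have := Complex.abs_im_le_norm (s - ρ)
        rw [Complex.sub_im, abs_sub_comm] at this
        exact this
  have hlog : Real.log (T + 2) ≤ 2 * Real.log T := by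
    have e1 := Real.log_le_log (by linarith) (show T + 2 ≤ T ^ 2 by nlinarith)
    rwa [Real.log_pow] at e1
  have hlogT : 1 ≤ Real.log (T + 2) := by
    rw [Real.le_log_iff_exp_le (by linarith)]
    exact Real.exp_one_lt_three.le.trans hT'
  have h7 : ‖logDeriv g s‖ ≤ C₃ * (C₁ * Real.log (T + 2)) + C₂ * Real.log (T + 2) ^ 2 := by
    have e1 : logDeriv g s = (∑ ρ ∈ Z \ D, (m ρ : ℂ) * logDeriv (fun z : ℂ => z - ρ) s +
      logDeriv g s) - ∑ ρ ∈ Z \ D, (m ρ : ℂ) * logDeriv (fun z : ℂ => z - ρ) s := by ring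
    rw [e1]
    refine (norm_sub_le _ _).trans (add_le_add (h5.trans ?_) h6)
    gcongr
  calc ‖logDeriv g s‖ ≤ C₃ * (C₁ * Real.log (T + 2)) + C₂ * Real.log (T + 2) ^ 2 := h7
    _ ≤ (C₃ * C₁ + C₂) * Real.log (T + 2) ^ 2 := by
        have : C₃ * C₁ * Real.log (T + 2) ≤ C₃ * C₁ * Real.log (T + 2) ^ 2 := by
          gcongr; nlinarith
        linarith
    _ ≤ (C₃ * C₁ + C₂) * (2 * Real.log T) ^ 2 := by gcongr
    _ = _ := by ring

end BeurlingSystem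

section ContourShift

open MeasureTheory

lemma norm_intervalIntegral_vertical_le {G : ℂ → ℂ} {σ₁ σ₂ T B₁ B₂ : ℝ} (hσ : σ₁ ≤ σ₂) (hT : 0 ≤ T)
    (hG : ∀ s : ℂ, σ₁ ≤ s.re → s.re ≤ σ₂ → |s.im| ≤ T → DifferentiableAt ℂ G s)
    (h1 : ∀ t : ℝ, |t| ≤ T → ‖G (σ₁ + t * Complex.I)‖ ≤ B₁)
    (h2 : ∀ σ t : ℝ, σ₁ ≤ σ → σ ≤ σ₂ → |t| = T → ‖G (σ + t * Complex.I)‖ ≤ B₂) :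
    ‖∫ t in (-T)..T, G (σ₂ + t * Complex.I)‖ ≤ 2 * T * B₁ + 2 * (σ₂ - σ₁) * B₂ := by
  have h3 := Complex.integral_boundary_rect_eq_zero_of_differentiableOn G
    (σ₁ + (-T : ℝ) * Complex.I) (σ₂ + T * Complex.I) (fun s hs => by
      rw [Complex.mem_reProdIm] at hs
      simp only [Complex.add_re, Complex.ofReal_re, Complex.mul_re, Complex.I_re, mul_zero,
        Complex.ofReal_im, Complex.I_im, mul_one, sub_self, add_zero, Complex.add_im,
        Complex.mul_im, zero_add] at hs
      rw [Set.uIcc_of_le hσ, Set.uIcc_of_le (by linarith)] at hs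
      exact (hG s hs.1.1 hs.1.2 (abs_le.mpr hs.2)).differentiableWithinAt)
  simp only [Complex.add_re, Complex.ofReal_re, Complex.mul_re, Complex.I_re, mul_zero,
    Complex.ofReal_im, Complex.I_im, mul_one, sub_self, add_zero, Complex.add_im,
    Complex.mul_im, zero_add, smul_eq_mul] at h3
  set I₁ := ∫ x in σ₁..σ₂, G (x + (-T : ℝ) * Complex.I)
  set I₂ := ∫ x in σ₁..σ₂, G (x + T * Complex.I)
  set I₃ := ∫ y in (-T)..T, G (σ₂ + y * Complex.I)
  set I₄ := ∫ y in (-T)..T, G (σ₁ + y * Complex.I)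
  have e1 : ‖I₁‖ ≤ B₂ * (σ₂ - σ₁) := by
    have := intervalIntegral.norm_integral_le_of_norm_le_const (a := σ₁) (b := σ₂) (C := B₂)
      (f := fun x : ℝ => G (x + (-T : ℝ) * Complex.I)) (fun x hx => by
        rw [Set.uIoc_of_le hσ] at hx
        exact h2 x (-T) hx.1.le hx.2 (by rw [abs_neg, abs_of_nonneg hT]))
    rwa [abs_of_nonneg (by linarith)] at this
  have e2 : ‖I₂‖ ≤ B₂ * (σ₂ - σ₁) := by
    have := intervalIntegral.norm_integral_le_of_norm_le_const (a := σ₁) (b := σ₂) (C := B₂)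
      (f := fun x : ℝ => G (x + T * Complex.I)) (fun x hx => by
        rw [Set.uIoc_of_le hσ] at hx
        exact h2 x T hx.1.le hx.2 (abs_of_nonneg hT))
    rwa [abs_of_nonneg (by linarith)] at this
  have e4 : ‖I₄‖ ≤ B₁ * (T - -T) := by
    have := intervalIntegral.norm_integral_le_of_norm_le_const (a := -T) (b := T) (C := B₁)
      (f := fun y : ℝ => G (σ₁ + y * Complex.I)) (fun x hx => by
        rw [Set.uIoc_of_le (by linarith)] at hx
        exact h1 x (abs_le.mpr ⟨hx.1.le, hx.2⟩))
    rwa [abs_of_nonneg (by linarith)] at this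
  have e3 : I₃ = I₄ + Complex.I * (I₁ - I₂) := by
    linear_combination (-Complex.I) * h3 + (I₃ - I₄) * Complex.I_mul_I
  rw [e3]
  refine (norm_add_le _ _).trans ?_
  rw [norm_mul, Complex.norm_I, one_mul]
  linarith [norm_sub_le I₁ I₂]

lemma norm_setIntegral_Ioi_le_of_pow {G : ℝ → ℂ} {T B : ℝ} {K : ℕ} (hT : 0 < T) (hK : 2 ≤ K)
    (hB : ∀ t, T < t → t ^ K * ‖G t‖ ≤ B) :
    ‖∫ t in Set.Ioi T, G t‖ ≤ B * T⁻¹ ^ (K - 1) := by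
  have hK' : (2 : ℝ) ≤ K := by exact_mod_cast hK
  have hB0 : 0 ≤ B := (by positivity : 0 ≤ (T + 1) ^ K * ‖G (T + 1)‖).trans (hB (T + 1) (by linarith))
  have h1 : IntegrableOn (fun t : ℝ => t ^ (-(K : ℝ))) (Set.Ioi T) :=
    integrableOn_Ioi_rpow_of_lt (by linarith) hT
  have h2 : ‖∫ t in Set.Ioi T, G t‖ ≤ ∫ t in Set.Ioi T, B * t ^ (-(K : ℝ)) := by
    refine norm_integral_le_of_norm_le (h1.const_mul B) ?_
    filter_upwards [ae_restrict_mem measurableSet_Ioi] with t ht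
    have ht0 : 0 < t := hT.trans ht
    rw [Real.rpow_neg ht0.le, Real.rpow_natCast, ← div_eq_mul_inv, le_div_iff₀ (by positivity),
      mul_comm]
    exact hB t ht
  rw [integral_const_mul, integral_Ioi_rpow_of_lt (by linarith) hT] at h2
  refine h2.trans (mul_le_mul_of_nonneg_left ?_ hB0)
  have h3 : T ^ (-(K : ℝ) + 1) = T⁻¹ ^ (K - 1) := by
    rw [← Real.rpow_natCast, Nat.cast_sub (by omega), Real.inv_rpow hT.le, ← Real.rpow_neg hT.le]
    congr 1
    push_cast
    ring
  rw [h3, neg_div, ← div_neg]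
  exact div_le_self (by positivity) (by linarith)

lemma norm_integral_vertical_le {G : ℂ → ℂ} {σ₁ σ₂ T B₁ B₂ B₃ : ℝ} {K : ℕ} (hσ : σ₁ ≤ σ₂)
    (hT : 0 < T) (hK : 2 ≤ K) (hint : Integrable fun t : ℝ => G (σ₂ + t * Complex.I))
    (hG : ∀ s : ℂ, σ₁ ≤ s.re → s.re ≤ σ₂ → |s.im| ≤ T → DifferentiableAt ℂ G s)
    (h1 : ∀ t : ℝ, |t| ≤ T → ‖G (σ₁ + t * Complex.I)‖ ≤ B₁)
    (h2 : ∀ σ t : ℝ, σ₁ ≤ σ → σ ≤ σ₂ → |t| = T → ‖G (σ + t * Complex.I)‖ ≤ B₂)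
    (h3 : ∀ t : ℝ, T < |t| → |t| ^ K * ‖G (σ₂ + t * Complex.I)‖ ≤ B₃) :
    ‖∫ t : ℝ, G (σ₂ + t * Complex.I)‖ ≤
      2 * T * B₁ + 2 * (σ₂ - σ₁) * B₂ + 2 * (B₃ * T⁻¹ ^ (K - 1)) := by
  have e1 := norm_intervalIntegral_vertical_le hσ hT.le hG h1 h2
  have e2 := norm_setIntegral_Ioi_le_of_pow (G := fun t : ℝ => G (σ₂ + t * Complex.I)) hT hK
    (B := B₃) (fun t ht => by
      have := h3 t (by rwa [abs_of_pos (hT.trans ht)])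
      rwa [abs_of_pos (hT.trans ht)] at this)
  have e3 := norm_setIntegral_Ioi_le_of_pow (G := fun t : ℝ => G (σ₂ + (-t : ℝ) * Complex.I)) hT hK
    (B := B₃) (fun t ht => by
      have := h3 (-t) (by rwa [abs_neg, abs_of_pos (hT.trans ht)])
      rwa [abs_neg, abs_of_pos (hT.trans ht)] at this)
  rw [integral_comp_neg_Ioi T (fun t : ℝ => G (σ₂ + t * Complex.I))] at e3
  rw [← intervalIntegral.integral_Iic_add_Ioi (b := -T) hint.integrableOn hint.integrableOn,
    ← intervalIntegral.integral_interval_add_Ioi (a := -T) (b := T) hint.integrableOn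
      hint.integrableOn]
  refine (norm_add_le _ _).trans ?_
  linarith [norm_add_le (∫ t in (-T)..T, G (σ₂ + t * Complex.I))
    (∫ t in Set.Ioi T, G (σ₂ + t * Complex.I))]

variable {a b δ : ℝ}

lemma differentiable_laplaceTransform_smoothWindow (hab : a ≤ b) (hδ : 0 < δ) :
    Differentiable ℂ (laplaceTransform (smoothWindow a b δ)) := fun s =>
  differentiableAt_laplaceTransform (smoothWindow_continuous a b δ)
    (smoothWindow_hasCompactSupport hab hδ) s

lemma integral_laplaceTransform_smoothWindow_div (ha : 0 < a) (hab : a ≤ b) (hδ : 0 < δ) {σ : ℝ}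
    {ρ : ℂ} (hρ : ρ.re < σ) :
    ∫ t : ℝ, laplaceTransform (smoothWindow a b δ) (σ + t * Complex.I) *
      (σ + t * Complex.I - ρ)⁻¹ = 2 * Real.pi * laplaceTransform (smoothWindow a b δ) ρ := by
  set W := laplaceTransform (smoothWindow a b δ) with hW
  have hWint : Integrable fun t : ℝ => W (σ + t * Complex.I) :=
    integrable_laplaceTransform_smoothWindow hab hδ σ
  have hexp : IntegrableOn (fun v : ℝ => Complex.exp ((ρ - σ) * v)) (Set.Ioi 0) :=
    integrableOn_exp_mul_complex_Ioi (by simpa using hρ) 0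
  have h1 : ∀ t : ℝ, W (σ + t * Complex.I) * (σ + t * Complex.I - ρ)⁻¹ =
      ∫ v in Set.Ioi (0 : ℝ), W (σ + t * Complex.I) * Complex.exp (-(σ + t * Complex.I - ρ) * v) := by
    intro t
    rw [integral_const_mul, integral_exp_mul_complex_Ioi (by simpa using hρ) 0]
    congr 1
    have : (σ + t * Complex.I - ρ : ℂ) ≠ 0 := by
      intro h0
      have := congrArg Complex.re h0
      simp at this
      linarith
    rw [Complex.ofReal_zero, mul_zero, Complex.exp_zero, neg_div_neg_eq, one_div]
  simp_rw [h1]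
  have hprod := hWint.mul_prod hexp
  rw [integral_integral_swap]
  · have h2 : ∀ v : ℝ, ∫ t : ℝ, W (σ + t * Complex.I) *
        Complex.exp (-(σ + t * Complex.I - ρ) * v) =
        2 * Real.pi * (smoothWindow a b δ v * Complex.exp (ρ * v)) := by
      intro v
      rw [← mul_assoc, ← integral_laplaceTransform_smoothWindow_mul_exp hab hδ σ v,
        ← integral_mul_const]
      refine integral_congr_ae (Eventually.of_forall fun t => ?_)
      dsimp only
      rw [mul_assoc, ← Complex.exp_add]
      congr 2
      ring
    simp_rw [h2]
    rw [integral_const_mul, setIntegral_eq_integral_of_forall_compl_eq_zero]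
    · rfl
    · intro v hv
      rw [smoothWindow_eq_zero_of_notMem hab hδ]
      · simp
      · intro hv'
        exact hv (ha.trans_le hv'.1)
  · have hc : Continuous fun z : ℝ × ℝ => Complex.exp (-(z.1 * z.2 : ℝ) * Complex.I) := by fun_prop
    have h3 := hprod.mul_bdd (c := 1) hc.aestronglyMeasurable (Eventually.of_forall fun z => by
      rw [← Complex.ofReal_neg, Complex.norm_exp_ofReal_mul_I])
    refine h3.congr (Eventually.of_forall fun z => ?_)
    simp only [Function.uncurry]
    rw [mul_assoc, ← Complex.exp_add]
    congr 2
    push_cast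
    ring

end ContourShift

namespace BeurlingSystem

open MeasureTheory

variable {S : BeurlingSystem} {A θ K₀ : ℝ} {ζ : ℂ → ℂ} {a b δ : ℝ}

lemma WellBehaved.integral_dirichlet_vonMangoldt_mul (h : S.WellBehaved A θ K₀) (hab : a ≤ b)
    (hδ : 0 < δ) {σ : ℝ} (hσ : 1 < σ) :
    ∫ t : ℝ, S.dirichlet S.vonMangoldt (σ + t * Complex.I) *
      laplaceTransform (smoothWindow a b δ) (σ + t * Complex.I) =
    2 * Real.pi * ∑' n, ((S.vonMangoldt n * smoothWindow a b δ (Real.log (S.val n)) : ℝ) : ℂ) := by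
  set W := laplaceTransform (smoothWindow a b δ) with hW
  have hWint : Integrable fun t : ℝ => W (σ + t * Complex.I) :=
    integrable_laplaceTransform_smoothWindow hab hδ σ
  have hsum := abs_vonMangoldt_summable (S := S) (fun x hx => h.cnt_le hx) σ hσ
  have hnorm : ∀ (n : ℕ →₀ ℕ) (t : ℝ), ‖(S.vonMangoldt n : ℂ) * (S.val n : ℂ) ^
      (-(σ + t * Complex.I) : ℂ) * W (σ + t * Complex.I)‖ =
      |S.vonMangoldt n| * S.val n ^ (-σ) * ‖W (σ + t * Complex.I)‖ := by
    intro n t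
    rw [norm_mul, norm_mul, norm_val_cpow, Complex.norm_real, Real.norm_eq_abs]
    simp
  have hint : ∀ n : ℕ →₀ ℕ, Integrable fun t : ℝ => (S.vonMangoldt n : ℂ) * (S.val n : ℂ) ^
      (-(σ + t * Complex.I) : ℂ) * W (σ + t * Complex.I) := by
    intro n
    refine hWint.bdd_mul (c := |S.vonMangoldt n| * S.val n ^ (-σ)) ?_ ?_
    · simp_rw [val_cpow]
      exact (by fun_prop : Continuous fun t : ℝ => (S.vonMangoldt n : ℂ) * Complex.exp
        (-(σ + t * Complex.I) * Real.log (S.val n))).aestronglyMeasurable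
    · refine Eventually.of_forall fun t => ?_
      rw [norm_mul, norm_val_cpow, Complex.norm_real, Real.norm_eq_abs]
      simp
  have h1 := hasSum_integral_of_summable_integral_norm hint (by
    simp_rw [hnorm, integral_const_mul]
    exact hsum.mul_right _)
  have h2 : ∀ t : ℝ, ∑' n, (S.vonMangoldt n : ℂ) * (S.val n : ℂ) ^
      (-(σ + t * Complex.I) : ℂ) * W (σ + t * Complex.I) =
      S.dirichlet S.vonMangoldt (σ + t * Complex.I) * W (σ + t * Complex.I) := by
    intro t
    rw [tsum_mul_right]
    rfl
  simp_rw [h2] at h1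
  rw [← h1.tsum_eq, ← tsum_mul_left]
  refine tsum_congr fun n => ?_
  have h3 := integral_laplaceTransform_smoothWindow_mul_exp hab hδ σ (Real.log (S.val n))
  push_cast
  rw [mul_left_comm, ← h3, ← integral_const_mul]
  refine integral_congr_ae (Eventually.of_forall fun t => ?_)
  dsimp only
  rw [val_cpow]
  ring

lemma ZeroFactorization.neg_logDeriv_cofactor_eq (h : S.WellBehaved A θ K₀) {b₁ T : ℝ}
    {Z : Finset ℂ} {m : ℂ → ℕ} {g : ℂ → ℂ} (hZ : S.ZeroFactorization A θ b₁ T Z m g) {s : ℂ}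
    (hs : 1 < s.re) :
    -logDeriv g s = S.dirichlet S.vonMangoldt s - (s - 1)⁻¹ + ∑ ρ ∈ Z, (m ρ : ℂ) * (s - ρ)⁻¹ := by
  have hne : ∀ ρ ∈ Z, s - ρ ≠ 0 := by
    intro ρ hρ h0
    have := hZ.re_lt_one h hρ
    rw [← sub_eq_zero.mp h0] at this
    linarith
  have hf := h.regularizedZeta_ne_zero hs
  have hg : g s ≠ 0 := by
    intro h0
    rw [hZ.eq_mul, h0, mul_zero] at hf
    exact hf rfl
  have hθ := h.2.2.1
  have hgd : DifferentiableAt ℂ g s := hZ.differentiableOn.differentiableAt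
    ((isOpen_lt_re θ).mem_nhds (show θ < s.re by linarith))
  have h1 := h.logDeriv_regularizedZeta hs
  have h2 : S.regularizedZeta A = fun z => (∏ ρ ∈ Z, (z - ρ) ^ m ρ) * g z := funext hZ.eq_mul
  rw [h2, logDeriv_mul s (f := fun z : ℂ => ∏ ρ ∈ Z, (z - ρ) ^ m ρ)
    (Finset.prod_ne_zero_iff.mpr fun ρ hρ => pow_ne_zero _ (hne ρ hρ)) hg
    (by fun_prop) hgd, logDeriv_prod_pow Z m (fun ρ z => z - ρ) s
    (fun ρ hρ => hne ρ hρ) (fun ρ _ => by fun_prop)] at h1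
  have h3 : ∀ ρ, logDeriv (fun z : ℂ => z - ρ) s = (s - ρ)⁻¹ := by simp [logDeriv_apply]
  simp_rw [h3] at h1
  rw [one_div] at h1
  linear_combination -h1

lemma WellBehaved.integrable_dirichlet_vonMangoldt_mul (h : S.WellBehaved A θ K₀) (hab : a ≤ b)
    (hδ : 0 < δ) {σ : ℝ} (hσ : 1 < σ) (hσ2 : σ ≤ 2) :
    Integrable fun t : ℝ => S.dirichlet S.vonMangoldt (σ + t * Complex.I) *
      laplaceTransform (smoothWindow a b δ) (σ + t * Complex.I) := by
  obtain ⟨C, hC0, hC⟩ := h.exists_norm_dirichlet_vonMangoldt_le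
  refine (integrable_laplaceTransform_smoothWindow hab hδ σ).bdd_mul (c := C / (σ - 1)) ?_ ?_
  · have h1 : Continuous fun t : ℝ => S.dirichlet S.vonMangoldt (σ + t * Complex.I) := by
      refine continuous_iff_continuousAt.2 fun t => ?_
      have h2 := (hasDerivAt_dirichlet (S := S) (abs_vonMangoldt_summable (S := S)
        (fun x hx => h.cnt_le hx)) (s := σ + t * Complex.I) (by simpa using hσ)).continuousAt
      exact ContinuousAt.comp (g := S.dirichlet S.vonMangoldt)
        (f := fun t : ℝ => (σ + t * Complex.I : ℂ)) h2 (by fun_prop)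
    exact h1.aestronglyMeasurable
  · refine Eventually.of_forall fun t => ?_
    simpa using hC (σ + t * Complex.I) (by simpa using hσ) (by simpa using hσ2)

lemma integrable_laplaceTransform_smoothWindow_div (hab : a ≤ b) (hδ : 0 < δ) {σ : ℝ}
    {ρ : ℂ} (hρ : ρ.re < σ) :
    Integrable fun t : ℝ => laplaceTransform (smoothWindow a b δ) (σ + t * Complex.I) *
      (σ + t * Complex.I - ρ)⁻¹ := by
  have hne : ∀ t : ℝ, (σ + t * Complex.I - ρ : ℂ) ≠ 0 := by
    intro t h0
    have := congrArg Complex.re h0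
    simp at this
    linarith
  refine (integrable_laplaceTransform_smoothWindow hab hδ σ).mul_bdd (c := (σ - ρ.re)⁻¹) ?_ ?_
  · exact (Continuous.inv₀ (by fun_prop) hne).aestronglyMeasurable
  · refine Eventually.of_forall fun t => ?_
    rw [norm_inv]
    have := sub_pos.mpr hρ
    gcongr
    have h1 := (le_abs_self _).trans (Complex.abs_re_le_norm (σ + t * Complex.I - ρ))
    simpa using h1

/-- The explicit formula with the zeros in a box split off. -/
lemma ZeroFactorization.integral_logDeriv_cofactor (h : S.WellBehaved A θ K₀) {b₁ T : ℝ}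
    {Z : Finset ℂ} {m : ℂ → ℕ} {g : ℂ → ℂ} (hZ : S.ZeroFactorization A θ b₁ T Z m g) (ha : 0 < a)
    (hab : a ≤ b) (hδ : 0 < δ) {σ : ℝ} (hσ : 1 < σ) (hσ2 : σ ≤ 2) :
    Integrable (fun t : ℝ => -logDeriv g (σ + t * Complex.I) *
      laplaceTransform (smoothWindow a b δ) (σ + t * Complex.I)) ∧
    ∫ t : ℝ, -logDeriv g (σ + t * Complex.I) *
      laplaceTransform (smoothWindow a b δ) (σ + t * Complex.I) =
    2 * Real.pi * (∑' n, ((S.vonMangoldt n * smoothWindow a b δ (Real.log (S.val n)) : ℝ) : ℂ) -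
      laplaceTransform (smoothWindow a b δ) 1 +
      ∑ ρ ∈ Z, (m ρ : ℂ) * laplaceTransform (smoothWindow a b δ) ρ) := by
  set W := laplaceTransform (smoothWindow a b δ) with hW
  have e : ∀ t : ℝ, -logDeriv g (σ + t * Complex.I) * W (σ + t * Complex.I) =
      S.dirichlet S.vonMangoldt (σ + t * Complex.I) * W (σ + t * Complex.I) -
      W (σ + t * Complex.I) * (σ + t * Complex.I - 1)⁻¹ +
      ∑ ρ ∈ Z, (m ρ : ℂ) * (W (σ + t * Complex.I) * (σ + t * Complex.I - ρ)⁻¹) := by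
    intro t
    rw [hZ.neg_logDeriv_cofactor_eq h (by simpa using hσ), add_mul, Finset.sum_mul, sub_mul,
      mul_comm (W _)]
    congr 1
    exact Finset.sum_congr rfl fun ρ _ => by ring
  have i1 := h.integrable_dirichlet_vonMangoldt_mul hab hδ hσ hσ2
  have i2 := integrable_laplaceTransform_smoothWindow_div hab hδ (σ := σ) (ρ := 1) (by simpa using hσ)
  have i3 : ∀ ρ ∈ Z, Integrable fun t : ℝ => (m ρ : ℂ) *
      (W (σ + t * Complex.I) * (σ + t * Complex.I - ρ)⁻¹) := fun ρ hρ =>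
    (integrable_laplaceTransform_smoothWindow_div hab hδ
      ((hZ.re_lt_one h hρ).trans hσ)).const_mul _
  have i12 : Integrable fun t : ℝ =>
      S.dirichlet S.vonMangoldt (σ + t * Complex.I) * W (σ + t * Complex.I) -
      W (σ + t * Complex.I) * (σ + t * Complex.I - 1)⁻¹ := i1.sub i2
  simp_rw [e]
  refine ⟨i12.add (integrable_finsetSum _ i3), ?_⟩
  rw [integral_add i12 (integrable_finsetSum _ i3), integral_sub i1 i2,
    integral_finsetSum _ i3, h.integral_dirichlet_vonMangoldt_mul hab hδ hσ,
    integral_laplaceTransform_smoothWindow_div ha hab hδ (by simpa using hσ)]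
  have e3 : ∀ ρ ∈ Z, ∫ t : ℝ, (m ρ : ℂ) * (W (σ + t * Complex.I) * (σ + t * Complex.I - ρ)⁻¹) =
      2 * Real.pi * (m ρ * W ρ) := by
    intro ρ hρ
    rw [integral_const_mul, integral_laplaceTransform_smoothWindow_div ha hab hδ
      ((hZ.re_lt_one h hρ).trans hσ)]
    ring
  rw [Finset.sum_congr rfl e3, ← Finset.mul_sum]
  ring

end BeurlingSystem

namespace BeurlingSystem

open MeasureTheory

variable {S : BeurlingSystem} {A θ K₀ : ℝ} {ζ : ℂ → ℂ} {a b δ : ℝ}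

lemma ZeroFactorization.norm_logDeriv_cofactor_le (h : S.WellBehaved A θ K₀) :
    ∃ C : ℝ, 0 < C ∧ ∀ (b₁ T : ℝ) (Z : Finset ℂ) (m : ℂ → ℕ) (g : ℂ → ℂ),
      S.ZeroFactorization A θ b₁ T Z m g → ∀ s : ℂ, 1 < s.re → s.re ≤ 2 →
        ‖logDeriv g s‖ ≤ (C + ∑ ρ ∈ Z, (m ρ : ℝ)) / (s.re - 1) := by
  obtain ⟨C, hC0, hC⟩ := h.exists_norm_dirichlet_vonMangoldt_le
  refine ⟨C + 1, by positivity, fun b₁ T Z m g hZ s hs hs2 => ?_⟩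
  have hs0 : 0 < s.re - 1 := by linarith
  have hle : ∀ ρ : ℂ, ρ.re ≤ 1 → ‖(s - ρ)⁻¹‖ ≤ (s.re - 1)⁻¹ := by
    intro ρ hρ
    rw [norm_inv]
    gcongr
    have := (le_abs_self _).trans (Complex.abs_re_le_norm (s - ρ))
    rw [Complex.sub_re] at this
    linarith
  rw [← norm_neg, hZ.neg_logDeriv_cofactor_eq h hs, add_div, add_div, Finset.sum_div]
  refine (norm_add_le _ _).trans (add_le_add ((norm_sub_le _ _).trans (add_le_add (hC s hs hs2) ?_))
    ((norm_sum_le _ _).trans (Finset.sum_le_sum fun ρ hρ => ?_)))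
  · rw [one_div]
    exact hle 1 (by simp)
  · rw [norm_mul, Complex.norm_natCast, div_eq_mul_inv]
    gcongr
    exact hle ρ (hZ.re_lt_one h hρ).le

lemma exp_mul_le_of_le_log_add {x σ v : ℝ} (hx : 0 < x) (hσ : 0 ≤ σ) (hσ2 : σ ≤ 2)
    (hv : v ≤ Real.log x + 3) : Real.exp (σ * v) ≤ Real.exp 6 * x ^ σ := by
  rw [Real.rpow_def_of_pos hx, ← Real.exp_add]
  gcongr
  nlinarith

set_option maxHeartbeats 1600000 in
/-- The smoothed prime counting function is `W(1)` up to a sum over zeros and small errors. -/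
theorem WellBehaved.exists_norm_tsum_sub_le (h : S.WellBehaved A θ K₀) {b₁ b₂ : ℝ}
    (hb : θ < b₁) (hb12 : b₁ < b₂) (hb2 : b₂ < 1) (K : ℕ) (hK : 2 ≤ K) :
    ∃ C : ℝ, 0 < C ∧ ∀ (x T a b δ : ℝ) (Z : Finset ℂ) (m : ℂ → ℕ) (g : ℂ → ℂ),
      Real.exp 3 ≤ x → 3 ≤ T → Real.log x - 1 ≤ a → a ≤ b → 0 < δ → b + δ ≤ Real.log x + 3 →
      S.ZeroFactorization A θ b₁ (T + 2) Z m g →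
      ‖∑' n, ((S.vonMangoldt n * smoothWindow a b δ (Real.log (S.val n)) : ℝ) : ℂ) -
        laplaceTransform (smoothWindow a b δ) 1‖ ≤
      C * ((b - a + δ) * x * ∑ ρ ∈ Z, m ρ * x ^ (ρ.re - 1) +
        (b - a + δ) * (T * Real.log T ^ 2 * x ^ b₂) +
        T * Real.log T ^ 2 * Real.log x * (x * δ⁻¹ ^ (K - 1) * T⁻¹ ^ (K - 1))) := by
  have hb1 : b₁ < 1 := by linarith
  have hθ0 := h.2.1
  obtain ⟨C₁, hC1, hlog⟩ := h.exists_norm_logDeriv_cofactor_le hb hb12 hb2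
  obtain ⟨C₂, hC2, hline⟩ := ZeroFactorization.norm_logDeriv_cofactor_le h
  obtain ⟨C₃, hC3, hcount⟩ := h.exists_sum_multiplicity_le_mul_log hb hb1
  obtain ⟨CK, hCK, hdecay⟩ := exists_norm_laplaceTransform_smoothWindow_le_pow K (by omega)
  have he6 := Real.exp_pos 6
  have he7 := Real.exp_pos 7
  refine ⟨Real.exp 6 + 2 * C₁ * Real.exp 6 + 4 * C₁ * (CK * Real.exp 7) +
    2 * (CK * Real.exp 7) * (C₂ + 4 * C₃), by positivity,
    fun x T a b δ Z m g hx hT ha hab hδ hbx hZ => ?_⟩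
  have hx0 : 0 < x := (Real.exp_pos 3).trans_le hx
  have hℓ : 3 ≤ Real.log x := (Real.le_log_iff_exp_le hx0).mpr hx
  set ℓ := Real.log x with hℓdef
  have hT0 : 0 < T := by linarith
  have hlogT : 1 ≤ Real.log T := by
    rw [Real.le_log_iff_exp_le hT0]
    exact Real.exp_one_lt_three.le.trans hT
  have ha0 : 0 < a := by linarith
  set σ := 1 + 1 / ℓ with hσdef
  have hℓ1 : 1 / ℓ ≤ 1 := by
    rw [div_le_one (by linarith)]
    linarith
  have hℓ0 : 0 < 1 / ℓ := by positivity
  have hσ1 : 1 < σ := by linarith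
  have hσ2 : σ ≤ 2 := by linarith
  set W := laplaceTransform (smoothWindow a b δ) with hW
  set Δ := b - a + δ with hΔ
  have hΔ0 : 0 < Δ := by linarith
  have hxσ : x ^ σ = Real.exp 1 * x := by
    rw [hσdef, Real.rpow_add hx0, Real.rpow_one, Real.rpow_def_of_pos hx0, ← hℓdef,
      mul_one_div_cancel (by linarith), mul_comm]
  have hWsmall : ∀ s : ℂ, 0 ≤ s.re → s.re ≤ 2 → ‖W s‖ ≤ Δ * (Real.exp 6 * x ^ s.re) :=
    fun s hs0 hs2 => norm_laplaceTransform_smoothWindow_le hab hδ fun v hv =>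
      exp_mul_le_of_le_log_add hx0 hs0 hs2 (hv.2.trans hbx)
  have hWdecay : ∀ s : ℂ, 0 ≤ s.re → s.re ≤ σ →
      |s.im| ^ K * ‖W s‖ ≤ CK * Real.exp 7 * (x * δ⁻¹ ^ (K - 1)) := by
    intro s hs0 hs2
    calc |s.im| ^ K * ‖W s‖ ≤ ‖s‖ ^ K * ‖W s‖ := by
          gcongr
          exact Complex.abs_im_le_norm s
      _ ≤ CK * (Real.exp 6 * x ^ σ) * δ⁻¹ ^ (K - 1) := hdecay a b δ _ s hab hδ fun v hv => by
          refine (exp_mul_le_of_le_log_add hx0 hs0 (hs2.trans hσ2) (hv.2.trans hbx)).trans ?_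
          have : 1 ≤ x := (Real.one_le_exp (by norm_num)).trans hx
          gcongr
      _ = _ := by
          rw [hxσ, show (7 : ℝ) = 6 + 1 by norm_num, Real.exp_add]
          ring
  obtain ⟨hint, heq⟩ := hZ.integral_logDeriv_cofactor h ha0 hab hδ hσ1 hσ2
  have hcontour := norm_integral_vertical_le (G := fun s => -logDeriv g s * W s) (σ₁ := b₂)
    (σ₂ := σ) (T := T) (K := K)
    (B₁ := C₁ * Real.log T ^ 2 * (Δ * (Real.exp 6 * x ^ b₂)))
    (B₂ := C₁ * Real.log T ^ 2 * (CK * Real.exp 7 * (x * δ⁻¹ ^ (K - 1)) * T⁻¹ ^ (K - 1)))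
    (B₃ := CK * Real.exp 7 * (x * δ⁻¹ ^ (K - 1)) * ((C₂ + ∑ ρ ∈ Z, (m ρ : ℝ)) * ℓ))
    (by linarith) hT0 hK hint ?_ ?_ ?_ ?_
  · rw [heq] at hcontour
    have hsumW : ‖∑ ρ ∈ Z, (m ρ : ℂ) * W ρ‖ ≤
        Real.exp 6 * (Δ * x * ∑ ρ ∈ Z, m ρ * x ^ (ρ.re - 1)) := by
      refine (norm_sum_le _ _).trans ?_
      rw [Finset.mul_sum, Finset.mul_sum]
      refine Finset.sum_le_sum fun ρ hρ => ?_
      have h1 := (hZ.mem_iff ρ).mp hρ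
      have h2 := hZ.re_lt_one h hρ
      rw [norm_mul, Complex.norm_natCast]
      calc (m ρ : ℝ) * ‖W ρ‖ ≤ m ρ * (Δ * (Real.exp 6 * x ^ ρ.re)) := by
            gcongr
            exact hWsmall ρ (by linarith) (by linarith)
        _ = _ := by
            rw [Real.rpow_sub_one hx0.ne']
            field_simp
    set Y := ∑' n, ((S.vonMangoldt n * smoothWindow a b δ (Real.log (S.val n)) : ℝ) : ℂ) with hY
    have hYW : ‖Y - W 1‖ ≤ ‖2 * Real.pi * (Y - W 1 + ∑ ρ ∈ Z, (m ρ : ℂ) * W ρ)‖ +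
        ‖∑ ρ ∈ Z, (m ρ : ℂ) * W ρ‖ := by
      have e1 : Y - W 1 = (Y - W 1 + ∑ ρ ∈ Z, (m ρ : ℂ) * W ρ) - ∑ ρ ∈ Z, (m ρ : ℂ) * W ρ := by ring
      rw [e1]
      refine (norm_sub_le _ _).trans (add_le_add ?_ le_rfl)
      rw [sub_add_cancel, norm_mul]
      refine le_mul_of_one_le_left (norm_nonneg _) ?_
      rw [norm_mul, Complex.norm_real, Real.norm_eq_abs, abs_of_pos Real.pi_pos]
      norm_num
      linarith [Real.pi_gt_three]
    have hm : ∑ ρ ∈ Z, (m ρ : ℝ) ≤ 4 * C₃ * (T * Real.log T ^ 2) := by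
      refine (hcount (T + 2) Z m g (by linarith) hZ).trans ?_
      have e1 : Real.log (T + 2) ≤ 2 * Real.log T := by
        have e1 := Real.log_le_log (by linarith) (show T + 2 ≤ T ^ 2 by nlinarith)
        rwa [Real.log_pow] at e1
      calc C₃ * ((T + 2) * Real.log (T + 2)) ≤ C₃ * ((2 * T) * (2 * Real.log T ^ 2)) := by
            have : 0 ≤ Real.log (T + 2) := Real.log_nonneg (by linarith)
            gcongr
            · linarith
            · nlinarith
        _ = _ := by ring
    set Q := T * Real.log T ^ 2 with hQ
    have hlog2 : 1 ≤ Real.log T ^ 2 := one_le_pow₀ hlogT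
    have hQlog : Real.log T ^ 2 ≤ Q := le_mul_of_one_le_left (by positivity) (by linarith)
    have hQ1 : 1 ≤ Q := hlog2.trans hQlog
    set X := x * δ⁻¹ ^ (K - 1) * T⁻¹ ^ (K - 1) with hX
    have hX0 : 0 ≤ X := by positivity
    have t1 : 2 * T * (C₁ * Real.log T ^ 2 * (Δ * (Real.exp 6 * x ^ b₂))) =
        2 * C₁ * Real.exp 6 * (Δ * (Q * x ^ b₂)) := by
      rw [hQ]; ring
    have t2 : 2 * (σ - b₂) * (C₁ * Real.log T ^ 2 *
        (CK * Real.exp 7 * (x * δ⁻¹ ^ (K - 1)) * T⁻¹ ^ (K - 1))) ≤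
        4 * C₁ * (CK * Real.exp 7) * (Q * ℓ * X) := by
      calc _ = 2 * (σ - b₂) * (C₁ * (CK * Real.exp 7)) * (Real.log T ^ 2 * 1 * X) := by
            rw [hX]; ring
        _ ≤ 2 * 2 * (C₁ * (CK * Real.exp 7)) * (Q * ℓ * X) := by
            gcongr
            · linarith
            · linarith
        _ = _ := by ring
    have t3 : 2 * (CK * Real.exp 7 * (x * δ⁻¹ ^ (K - 1)) * ((C₂ + ∑ ρ ∈ Z, (m ρ : ℝ)) * ℓ) *
        T⁻¹ ^ (K - 1)) ≤ 2 * (CK * Real.exp 7) * (C₂ + 4 * C₃) * (Q * ℓ * X) := by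
      calc _ = 2 * (CK * Real.exp 7) * ((C₂ + ∑ ρ ∈ Z, (m ρ : ℝ)) * (ℓ * X)) := by
            rw [hX]; ring
        _ ≤ 2 * (CK * Real.exp 7) * ((C₂ * Q + 4 * C₃ * Q) * (ℓ * X)) := by
            gcongr
            exact le_mul_of_one_le_right hC2.le hQ1
        _ = _ := by ring
    have p1 : 0 ≤ Δ * x * ∑ ρ ∈ Z, m ρ * x ^ (ρ.re - 1) := by positivity
    have p2 : 0 ≤ Δ * (Q * x ^ b₂) := by positivity
    have p3 : 0 ≤ Q * ℓ * X := by positivity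
    have q1 : 0 ≤ C₁ * Real.exp 6 := by positivity
    have q2 : 0 ≤ C₁ * (CK * Real.exp 7) := by positivity
    have q3 : 0 ≤ (CK * Real.exp 7) * (C₂ + 4 * C₃) := by positivity
    rw [t1] at hcontour
    have hfin : ‖Y - W 1‖ ≤ 2 * C₁ * Real.exp 6 * (Δ * (Q * x ^ b₂)) +
        4 * C₁ * (CK * Real.exp 7) * (Q * ℓ * X) +
        2 * (CK * Real.exp 7) * (C₂ + 4 * C₃) * (Q * ℓ * X) +
        Real.exp 6 * (Δ * x * ∑ ρ ∈ Z, m ρ * x ^ (ρ.re - 1)) := by linarith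
    refine hfin.trans ?_
    generalize Δ * x * ∑ ρ ∈ Z, m ρ * x ^ (ρ.re - 1) = P₁ at *
    generalize Δ * (Q * x ^ b₂) = P₂ at *
    generalize Q * ℓ * X = P₃ at *
    linarith [mul_nonneg q1 p1, mul_nonneg q1 p3, mul_nonneg q2 p1, mul_nonneg q2 p2,
      mul_nonneg q3 p1, mul_nonneg q3 p2, mul_nonneg he6.le p2, mul_nonneg he6.le p3]
  · intro s hs1 hs2 hsT
    have hgd : DifferentiableOn ℂ g {s : ℂ | θ < s.re} := hZ.differentiableOn
    have hmem := (isOpen_lt_re θ).mem_nhds (show s ∈ {s : ℂ | θ < s.re} from by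
      show θ < s.re
      linarith)
    have hga := hgd.analyticAt hmem
    have hg0 := hZ.cofactor_ne_zero (s := s) (by linarith) (by linarith)
    have h1 : DifferentiableAt ℂ (logDeriv g) s := hga.deriv.differentiableAt.div
      hga.differentiableAt hg0
    exact h1.neg.mul (differentiable_laplaceTransform_smoothWindow hab hδ s)
  · intro t ht
    rw [norm_mul, norm_neg]
    refine mul_le_mul (hlog T Z m g hT hZ _ (by simp) (by simp; linarith) (by simpa using ht)) ?_
      (norm_nonneg _) (by positivity)
    simpa using hWsmall (b₂ + t * Complex.I) (by simp; linarith) (by simp; linarith)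
  · intro σ' t h1 h2 ht
    rw [norm_mul, norm_neg]
    refine mul_le_mul (hlog T Z m g hT hZ _ (by simpa using h1) (by simp; linarith)
      (by simpa using ht.le)) ?_ (norm_nonneg _) (by positivity)
    have h3 := hWdecay (σ' + t * Complex.I) (by simp; linarith) (by simpa using h2)
    have h4 : ((σ' : ℂ) + t * Complex.I).im = t := by simp
    rw [h4, ht, mul_comm, ← le_div_iff₀ (by positivity)] at h3
    refine h3.trans ?_
    rw [div_eq_mul_inv, ← inv_pow]
    gcongr 1
    refine pow_le_pow_of_le_one (by positivity) ?_ (by omega)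
    exact inv_le_one_of_one_le₀ (by linarith)
  · intro t ht
    have h1 := hline b₁ (T + 2) Z m g hZ (σ + t * Complex.I) (by simpa using hσ1)
      (by simpa using hσ2)
    have h2 : ((σ : ℂ) + t * Complex.I).re - 1 = 1 / ℓ := by simp [hσdef]
    rw [h2, div_div_eq_mul_div, div_one] at h1
    have h3 := hWdecay (σ + t * Complex.I) (by simp; linarith) (by simp)
    have h4 : ((σ : ℂ) + t * Complex.I).im = t := by simp
    rw [h4] at h3
    rw [norm_mul, norm_neg]
    calc |t| ^ K * (‖logDeriv g (σ + t * Complex.I)‖ * ‖W (σ + t * Complex.I)‖)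
        = |t| ^ K * ‖W (σ + t * Complex.I)‖ * ‖logDeriv g (σ + t * Complex.I)‖ := by ring
      _ ≤ _ := by gcongr

end BeurlingSystem

lemma Real.tendsto_log_log_div_log_atTop :
    Tendsto (fun T => Real.log (Real.log T) / Real.log T) atTop (𝓝 0) :=
  Real.isLittleO_log_id_atTop.tendsto_div_nhds_zero.comp Real.tendsto_log_atTop

lemma Real.log_log_div_log_le_of_le {s t : ℝ} (hs : Real.exp (Real.exp 1) ≤ s) (hst : s ≤ t) :
    Real.log (Real.log t) / Real.log t ≤ Real.log (Real.log s) / Real.log s := by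
  have hs0 : 0 < s := (Real.exp_pos _).trans_le hs
  have h1 : Real.exp 1 ≤ Real.log s := (Real.le_log_iff_exp_le hs0).mpr hs
  have h2 : Real.log s ≤ Real.log t := Real.log_le_log hs0 hst
  exact Real.log_div_self_antitoneOn (Set.mem_Ici.mpr h1) (Set.mem_Ici.mpr (h1.trans h2)) h2

namespace BeurlingSystem

variable {S : BeurlingSystem} {A θ K₀ : ℝ} {ζ : ℂ → ℂ}

lemma WellBehaved.exists_re_le_one_sub (h : S.WellBehaved A θ K₀) {b₁ : ℝ} (hb : θ < b₁) (T : ℝ) :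
    ∃ δ : ℝ, 0 < δ ∧ ∀ ρ : ℂ, b₁ ≤ ρ.re → |ρ.im| ≤ T → S.regularizedZeta A ρ = 0 →
      ρ.re ≤ 1 - δ := by
  obtain hne | hne := {ρ : ℂ | b₁ ≤ ρ.re ∧ |ρ.im| ≤ T ∧ S.regularizedZeta A ρ = 0}.eq_empty_or_nonempty
  · refine ⟨1, one_pos, fun ρ h1 h2 h3 => ?_⟩
    have : ρ ∈ {ρ : ℂ | b₁ ≤ ρ.re ∧ |ρ.im| ≤ T ∧ S.regularizedZeta A ρ = 0} := ⟨h1, h2, h3⟩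
    rw [hne] at this
    exact this.elim
  · obtain ⟨ρ₀, hρ₀, hmax⟩ := Set.exists_max_image _ (fun ρ : ℂ => ρ.re) (h.finite_zeros hb T) hne
    refine ⟨1 - ρ₀.re, ?_, fun ρ h1 h2 h3 => ?_⟩
    · by_contra! hle
      exact h.regularizedZeta_ne_zero_of_one_le (by linarith) hρ₀.2.2
    · have := hmax ρ ⟨h1, h2, h3⟩
      linarith

/-- A Littlewood zero-free region in the upper half plane bounds the real part of all zeros up to
a given height. -/
lemma IsZeta.exists_re_le_of_zeroFree (h : S.WellBehaved A θ K₀) (hζ : S.IsZeta θ ζ)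
    {d₁ t₀ b₁ : ℝ} (hd₁ : 0 < d₁) (hb : θ < b₁)
    (hZeroFree : ∀ ρ : ℂ, θ < ρ.re → ρ ≠ 1 → t₀ < ρ.im →
      1 - d₁ * Real.log (Real.log ρ.im) / Real.log ρ.im < ρ.re → ζ ρ ≠ 0) :
    ∃ T₀ : ℝ, ∀ T, T₀ ≤ T → ∀ ρ : ℂ, b₁ ≤ ρ.re → |ρ.im| ≤ T → S.regularizedZeta A ρ = 0 →
      d₁ * (Real.log (Real.log T) / Real.log T) ≤ 1 - ρ.re := by
  obtain ⟨δ, hδ, hcompact⟩ := h.exists_re_le_one_sub hb (max t₀ (Real.exp (Real.exp 1)))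
  have htend := Real.tendsto_log_log_div_log_atTop.const_mul d₁
  rw [mul_zero] at htend
  obtain ⟨T₀, hT₀⟩ := eventually_atTop.mp (htend.eventually_le_const hδ)
  have hupper : ∀ T (ρ : ℂ), b₁ ≤ ρ.re → ρ.im ≤ T → max t₀ (Real.exp (Real.exp 1)) < ρ.im →
      S.regularizedZeta A ρ = 0 → d₁ * (Real.log (Real.log T) / Real.log T) ≤ 1 - ρ.re := by
    intro T ρ h1 h2 h3 h4
    obtain ⟨h5, h6⟩ := max_lt_iff.mp h3
    have h7 : ρ ≠ 1 := by
      rintro rfl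
      simp only [Complex.one_im] at h6
      exact (Real.exp_pos _).not_gt h6
    have h8 := mul_le_mul_of_nonneg_left (Real.log_log_div_log_le_of_le h6.le h2) hd₁.le
    by_contra! h9
    refine hZeroFree ρ (by linarith) h7 h5 ?_
      ((hζ.regularizedZeta_eq_zero_iff h (by linarith)).mp h4).1
    rw [mul_div_assoc]
    linarith
  refine ⟨T₀, fun T hT ρ h1 h2 h3 => ?_⟩
  obtain hle | hlt := le_or_gt |ρ.im| (max t₀ (Real.exp (Real.exp 1)))
  · linarith [hcompact ρ h1 hle h3, hT₀ T hT]
  · obtain h0 | h0 := le_total 0 ρ.im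
    · rw [abs_of_nonneg h0] at hlt h2
      exact hupper T ρ h1 h2 hlt h3
    · rw [abs_of_nonpos h0] at hlt h2
      have := hupper T ((starRingEnd ℂ) ρ) (by simpa using h1) (by simpa using h2)
        (by simpa using hlt) (by rw [regularizedZeta_conj, h3, map_zero])
      simpa using this

/-- The multiplicity of a zero close to the line `Re s = 1`. -/
lemma IsZeta.exists_multiplicity_mul_le (h : S.WellBehaved A θ K₀) (hζ : S.IsZeta θ ζ) {b₁ : ℝ}
    (hb : θ < b₁) :
    ∃ δ C c : ℝ, 0 < δ ∧ 0 < C ∧ 0 < c ∧ ∀ (T : ℝ) (Z : Finset ℂ) (m : ℂ → ℕ) (g : ℂ → ℂ), 3 ≤ T →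
      S.ZeroFactorization A θ b₁ T Z m g → ∀ ρ ∈ Z, ∀ u : ℝ, u = 1 - ρ.re → u ≤ δ →
        m ρ * Real.log 2 ≤ Real.log (C * (2 * T) ^ (c * u) * Real.log (2 * T) / u) := by
  obtain ⟨C₁, c₁, δ₁, hC₁, hc₁, hδ₁, hupper⟩ := hζ.exists_norm_le_near_one h
  obtain ⟨δ₀, hδ₀, hcompact⟩ := h.exists_re_le_one_sub hb 4
  obtain ⟨c₂, hc₂, hlower⟩ := h.exists_le_norm_regularizedZeta
  have hθ1 : θ < 1 := h.2.2.1
  refine ⟨min (min (δ₁ / 3) (δ₀ / 2)) (min (2 / 5) ((1 - θ) / 4)), 2 * C₁ / c₂, c₁ * 3,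
    lt_min (lt_min (by linarith) (by linarith)) (lt_min (by norm_num) (by linarith)), by positivity,
    by positivity,
    fun T Z m g hT hZ ρ hρ u hu huδ => ?_⟩
  simp only [le_min_iff] at huδ
  obtain ⟨⟨hu1, hu2⟩, hu3, hu4⟩ := huδ
  obtain ⟨hρb, hρT, hρ0⟩ := (hZ.mem_iff ρ).mp hρ
  have hρ1 := hZ.re_lt_one h hρ
  have hu0 : 0 < u := by linarith
  have him : 4 < |ρ.im| := by
    by_contra! hle
    linarith [hcompact ρ hρb hle hρ0]
  set z : ℂ := ρ + (2 * u : ℝ) with hz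
  have hzre : z.re = 1 + u := by
    rw [hz, Complex.add_re, Complex.ofReal_re]; linarith
  have hzim : z.im = ρ.im := by
    rw [hz, Complex.add_im, Complex.ofReal_im, add_zero]
  have hball : ∀ s ∈ Metric.closedBall z (4 * u), 1 - 3 * u ≤ s.re ∧ s.re ≤ 1 + 5 * u ∧
      |ρ.im| - 4 * u ≤ |s.im| ∧ |s.im| ≤ |ρ.im| + 4 * u := by
    intro s hs
    rw [mem_closedBall_iff_norm] at hs
    have h1 := (Complex.abs_re_le_norm (s - z)).trans hs
    have h2 := (Complex.abs_im_le_norm (s - z)).trans hs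
    rw [Complex.sub_re, hzre, abs_le] at h1
    rw [Complex.sub_im, hzim] at h2
    refine ⟨by linarith, by linarith, ?_, ?_⟩
    · have := abs_sub_abs_le_abs_sub ρ.im s.im
      rw [abs_sub_comm] at this
      linarith
    · have := abs_sub_abs_le_abs_sub s.im ρ.im
      linarith
  have hD : ({ρ} : Finset ℂ) ⊆ Z := Finset.singleton_subset_iff.mpr hρ
  have key := sum_multiplicity_le (h := fun z => (∏ ρ ∈ Z \ {ρ}, (z - ρ) ^ m ρ) * g z)
    (U := {s | θ < s.re}) (c := z) (R := 4 * u) (r := 2 * u) (D := {ρ}) (m := m)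
    (M := 2 * |ρ.im| * (C₁ * (2 * T) ^ (c₁ * (3 * u)) * Real.log (2 * T)))
    (M₀ := c₂ * (u * |ρ.im|)) (by linarith) (by linarith)
    (fun s hs => show θ < s.re by linarith [(hball s hs).1])
    (hZ.differentiableOn_prod_mul _) ?_ ?_ (by positivity) ?_
  · rw [Finset.sum_singleton, show 4 * u / (2 * u) = 2 by field_simp; norm_num] at key
    refine key.trans (le_of_eq ?_)
    congr 1
    rw [mul_assoc c₁ 3 u]
    field_simp
  · intro ρ' hρ'
    rw [Finset.mem_singleton.mp hρ', hz, sub_add_cancel_left, norm_neg, Complex.norm_real,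
      Real.norm_eq_abs, abs_of_pos (by linarith)]
  · intro s hs
    obtain ⟨h1, h2, h3, h4⟩ := hball s (Metric.sphere_subset_closedBall hs)
    rw [← hZ.eq_mul_subset hD]
    have hs1 : s ≠ 1 := by
      rintro rfl
      simp only [Complex.one_im, abs_zero] at h3
      linarith
    rw [hζ.regularizedZeta_eq h (by linarith) hs1, norm_mul]
    refine mul_le_mul ?_ (hupper (3 * u) (2 * T) s (by linarith) (by linarith) (by linarith)
      (by linarith) (by linarith) (by linarith) (by linarith)) (norm_nonneg _) (by positivity)
    have h5 := Complex.norm_le_abs_re_add_abs_im (s - 1)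
    rw [Complex.sub_re, Complex.sub_im, Complex.one_re, Complex.one_im, sub_zero] at h5
    have h6 : |s.re - 1| ≤ 5 * u := abs_le.mpr ⟨by linarith, by linarith⟩
    linarith
  · rw [← hZ.eq_mul_subset hD]
    refine le_trans ?_ (hlower z (by linarith) (by linarith))
    rw [hzre, add_sub_cancel_left]
    gcongr
    have h5 := Complex.abs_im_le_norm (z - 1)
    rwa [Complex.sub_im, hzim, Complex.one_im, sub_zero] at h5

/-- If all zeros up to height `T` satisfy a Littlewood bound, their multiplicities are at most
a constant times `(1 - Re ρ) log T`. -/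
lemma IsZeta.exists_multiplicity_le (h : S.WellBehaved A θ K₀) (hζ : S.IsZeta θ ζ) {b₁ : ℝ}
    (hb : θ < b₁) (hb1 : b₁ < 1) {d : ℝ} (hd : 0 < d) :
    ∃ C T₀ : ℝ, 0 < C ∧ ∀ (T : ℝ) (Z : Finset ℂ) (m : ℂ → ℕ) (g : ℂ → ℂ), T₀ ≤ T →
      S.ZeroFactorization A θ b₁ T Z m g → ∀ ρ ∈ Z,
        d * (Real.log (Real.log T) / Real.log T) ≤ 1 - ρ.re →
          m ρ ≤ C * ((1 - ρ.re) * Real.log T) := by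
  obtain ⟨δ, C₁, c₁, hδ, hC₁, hc₁, hmult⟩ := hζ.exists_multiplicity_mul_le h hb
  obtain ⟨η, C₂, hη, hC₂, hcount⟩ := h.exists_sum_multiplicity_le hb hb1
  have hlog2 := Real.log_pos one_lt_two
  have hll : Tendsto (fun T => Real.log (Real.log T)) atTop atTop :=
    Real.tendsto_log_atTop.comp Real.tendsto_log_atTop
  obtain ⟨T₀, hT₀⟩ := eventually_atTop.mp ((hll.eventually_ge_atTop (max 1 (max (1 / d)
    (Real.log C₁)))).and (eventually_ge_atTop (3 : ℝ)))
  refine ⟨C₂ / δ + (2 * c₁ + 4 / d) / Real.log 2, T₀, by positivity,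
    fun T Z m g hT hZ ρ hρ hu => ?_⟩
  obtain ⟨hT1, hT3⟩ := hT₀ T hT
  simp only [max_le_iff] at hT1
  obtain ⟨hll1, hlld, hllC⟩ := hT1
  have hℓ1 : 1 ≤ Real.log T := by
    rw [Real.le_log_iff_exp_le (by linarith)]
    exact Real.exp_one_lt_three.le.trans hT3
  set ℓ := Real.log T with hℓ
  set u := 1 - ρ.re with hudef
  have hu0 : 0 < u := by linarith [hZ.re_lt_one h hρ]
  rw [add_mul]
  obtain hle | hlt := le_or_gt δ u
  · have h1 : (m ρ : ℝ) ≤ C₂ * ℓ := by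
      refine le_trans ?_ (hcount T Z m g hT3 hZ ρ.im)
      refine Finset.single_le_sum (f := fun ρ => (m ρ : ℝ)) (fun _ _ => Nat.cast_nonneg _) ?_
      simp [hρ, hη.le]
    have h2 : C₂ * ℓ ≤ C₂ / δ * (u * ℓ) := by
      rw [div_mul_eq_mul_div, le_div_iff₀ hδ]
      calc C₂ * ℓ * δ ≤ C₂ * ℓ * u := by gcongr
        _ = _ := by ring
    have h3 : 0 ≤ (2 * c₁ + 4 / d) / Real.log 2 * (u * ℓ) := by positivity
    linarith
  · have h1 := hmult T Z m g hT3 hZ ρ hρ u rfl hlt.le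
    have hdu : Real.log ℓ ≤ u * ℓ / d := by
      rw [le_div_iff₀ hd]
      rw [← mul_div_assoc, div_le_iff₀ (by linarith)] at hu
      linarith
    have h2T : Real.log (2 * T) ≤ 2 * ℓ := by
      have e1 := Real.log_le_log (by linarith) (show 2 * T ≤ T ^ 2 by nlinarith)
      rwa [Real.log_pow] at e1
    have h2T0 : 0 < Real.log (2 * T) := Real.log_pos (by linarith)
    have hll2 : Real.log (Real.log (2 * T)) ≤ 2 * Real.log ℓ := by
      have e1 := Real.log_le_log h2T0 h2T
      rw [Real.log_mul two_ne_zero (show ℓ ≠ 0 by linarith)] at e1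
      have e2 := Real.log_two_lt_d9
      linarith
    have hlu : -Real.log u ≤ Real.log ℓ := by
      rw [← Real.log_inv]
      refine Real.log_le_log (by positivity) ?_
      rw [inv_le_comm₀ hu0 (by linarith)]
      refine le_trans ?_ hu
      rw [← mul_div_assoc, inv_eq_one_div]
      gcongr
      rwa [div_le_iff₀' hd] at hlld
    have h3 : Real.log (C₁ * (2 * T) ^ (c₁ * u) * Real.log (2 * T) / u) =
        Real.log C₁ + c₁ * u * Real.log (2 * T) + Real.log (Real.log (2 * T)) - Real.log u := by
      have : 0 < (2 * T) ^ (c₁ * u) := by positivity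
      rw [Real.log_div (by positivity) hu0.ne', Real.log_mul (by positivity) h2T0.ne',
        Real.log_mul hC₁.ne' this.ne', Real.log_rpow (by linarith)]
    have h4 : c₁ * u * Real.log (2 * T) ≤ 2 * c₁ * (u * ℓ) := by
      calc c₁ * u * Real.log (2 * T) ≤ c₁ * u * (2 * ℓ) := by gcongr
        _ = _ := by ring
    have h5 : (m ρ : ℝ) ≤ (2 * c₁ + 4 / d) / Real.log 2 * (u * ℓ) := by
      rw [div_mul_eq_mul_div, le_div_iff₀ hlog2]
      have e1 : 4 / d * (u * ℓ) = 4 * (u * ℓ / d) := by ring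
      rw [add_mul, e1]
      linarith
    have h6 : 0 ≤ C₂ / δ * (u * ℓ) := by positivity
    linarith

end BeurlingSystem

lemma Finset.sum_exp_neg_le {ι : Type*} (Z : Finset ι) (w : ι → ℝ) (hw : ∀ i ∈ Z, 0 ≤ w i)
    {B c η : ℝ} (hB : 0 ≤ B) (hc : 0 < c) (hη : 0 < η)
    (hcard : ∀ y : ℝ, 0 ≤ y → ((Z.filter fun i => w i ≤ y).card : ℝ) ≤ B * Real.exp (c * y)) :
    ∑ i ∈ Z, Real.exp (-(c + η) * w i) ≤ B * Real.exp c * (1 - Real.exp (-η))⁻¹ := by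
  rw [← Finset.sum_fiberwise_of_maps_to (g := fun i => ⌊w i⌋₊) fun i hi =>
    Finset.mem_image_of_mem (fun i => ⌊w i⌋₊) hi]
  have hlt : Real.exp (-η) < 1 := Real.exp_lt_one_iff.mpr (by linarith)
  calc _ ≤ ∑ j ∈ Z.image fun i => ⌊w i⌋₊, B * Real.exp c * Real.exp (-η) ^ j := by
        refine Finset.sum_le_sum fun j _ => ?_
        have hbound : ∀ i ∈ Z.filter fun i => ⌊w i⌋₊ = j,
            Real.exp (-(c + η) * w i) ≤ Real.exp (-(c + η) * j) := by
          intro i hi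
          obtain ⟨hi, hij⟩ := Finset.mem_filter.mp hi
          have := Nat.floor_le (hw i hi)
          rw [hij] at this
          refine Real.exp_le_exp.mpr (mul_le_mul_of_nonpos_left this (by linarith))
        refine (Finset.sum_le_card_nsmul _ _ _ hbound).trans ?_
        rw [nsmul_eq_mul]
        have hsub : (Z.filter fun i => ⌊w i⌋₊ = j) ⊆ Z.filter fun i => w i ≤ j + 1 := by
          intro i hi
          obtain ⟨hi, hij⟩ := Finset.mem_filter.mp hi
          refine Finset.mem_filter.mpr ⟨hi, ?_⟩
          have := (Nat.lt_floor_add_one (w i)).le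
          rwa [hij] at this
        calc _ ≤ B * Real.exp (c * (j + 1)) * Real.exp (-(c + η) * j) := by
              gcongr
              exact (Nat.cast_le.mpr (Finset.card_le_card hsub)).trans
                (hcard (j + 1) (by positivity))
          _ = _ := by
              rw [mul_assoc, ← Real.exp_add, mul_assoc, ← Real.exp_nat_mul, ← Real.exp_add]
              congr 2
              ring
    _ ≤ _ := by
        rw [← Finset.mul_sum, ← tsum_geometric_of_lt_one (Real.exp_pos _).le hlt]
        gcongr
        exact (summable_geometric_of_lt_one (Real.exp_pos _).le hlt).sum_le_tsum _
          fun _ _ => by positivity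

namespace BeurlingSystem

variable {S : BeurlingSystem} {A θ K₀ : ℝ} {ζ : ℂ → ℂ}

lemma ZeroFactorization.card_filter_le_zeroCount (h : S.WellBehaved A θ K₀) (hζ : S.IsZeta θ ζ)
    {b T : ℝ} {Z : Finset ℂ} {m : ℂ → ℕ} {g : ℂ → ℂ} (hb : θ < b)
    (hZ : S.ZeroFactorization A θ b T Z m g) {α : ℝ} (hα : b ≤ α) :
    ((Z.filter fun ρ => α ≤ ρ.re).card : ℝ) ≤ zeroCount ζ α T := by
  rw [zeroCount, ← Set.ncard_coe_finset]
  refine Nat.cast_le.mpr (Set.ncard_le_ncard (fun ρ hρ => ?_)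
    ((h.finite_zeros hb T).subset fun ρ hρ => ?_))
  · obtain ⟨h1, h2⟩ := Finset.mem_filter.mp (Finset.mem_coe.mp hρ)
    obtain ⟨h3, h4, h5⟩ := (hZ.mem_iff ρ).mp h1
    obtain ⟨h6, h7⟩ := (hζ.regularizedZeta_eq_zero_iff h (by linarith)).mp h5
    exact ⟨h6, h7, h2, h4⟩
  · obtain ⟨h1, h2, h3, h4⟩ := hρ
    exact ⟨by linarith, h4, (hζ.regularizedZeta_eq_zero_iff h (by linarith)).mpr ⟨h1, h2⟩⟩

lemma ZeroFactorization.sum_exp_neg_le (h : S.WellBehaved A θ K₀) (hζ : S.IsZeta θ ζ)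
    {b c L C T η : ℝ} {Z : Finset ℂ} {m : ℂ → ℕ} {g : ℂ → ℂ} (hb : θ < b) (hb1 : b < 1)
    (hc : 0 < c) (hC : 0 ≤ C) (hη : 0 < η) (hT : 3 ≤ T)
    (hDensity : ∀ T α : ℝ, 2 < T → b ≤ α → α ≤ 1 →
      zeroCount ζ α T ≤ C * T ^ (c * (1 - α)) * Real.log T ^ L)
    (hZ : S.ZeroFactorization A θ b T Z m g) :
    ∑ ρ ∈ Z, Real.exp (-(c + η) * ((1 - ρ.re) * Real.log T)) ≤
      C * Real.log T ^ L * Real.exp c * (1 - Real.exp (-η))⁻¹ := by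
  have hlog : 0 < Real.log T := Real.log_pos (by linarith)
  refine Finset.sum_exp_neg_le Z (fun ρ => (1 - ρ.re) * Real.log T) (fun ρ hρ => ?_)
    (by positivity) hc hη fun y hy => ?_
  · have := hZ.re_lt_one h hρ
    exact mul_nonneg (by linarith) hlog.le
  · have hle : max b (1 - y / Real.log T) ≤ 1 :=
      max_le hb1.le (by linarith [div_nonneg hy hlog.le])
    have heq : (Z.filter fun ρ => (1 - ρ.re) * Real.log T ≤ y) =
        Z.filter fun ρ => max b (1 - y / Real.log T) ≤ ρ.re := by
      refine Finset.filter_congr fun ρ hρ => ?_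
      have := ((hZ.mem_iff ρ).mp hρ).1
      rw [← le_div_iff₀ hlog, max_le_iff]
      constructor
      · intro h1
        exact ⟨this, by linarith⟩
      · intro h1
        linarith [h1.2]
    rw [heq]
    refine (hZ.card_filter_le_zeroCount h hζ hb (le_max_left _ _)).trans
      ((hDensity T _ (by linarith) (le_max_left _ _) hle).trans ?_)
    rw [mul_right_comm, Real.rpow_def_of_pos (show 0 < T by linarith)]
    gcongr _ * Real.exp ?_
    have h1 : 1 - max b (1 - y / Real.log T) ≤ y / Real.log T := by
      linarith [le_max_right b (1 - y / Real.log T)]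
    calc Real.log T * (c * (1 - max b (1 - y / Real.log T)))
        ≤ Real.log T * (c * (y / Real.log T)) := by gcongr
      _ = c * y := by field_simp

/-- The sum over zeros is small when a Littlewood zero-free region beats the logarithmic loss in
the density estimate. -/
theorem IsZeta.exists_sum_multiplicity_mul_rpow_le (h : S.WellBehaved A θ K₀)
    (hζ : S.IsZeta θ ζ) {d₁ t₀ b c L κ : ℝ} (hd₁ : 0 < d₁) (hb : θ < b) (hb1 : b < 1) (hc : 0 < c)
    (hZeroFree : ∀ ρ : ℂ, θ < ρ.re → ρ ≠ 1 → t₀ < ρ.im →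
      1 - d₁ * Real.log (Real.log ρ.im) / Real.log ρ.im < ρ.re → ζ ρ ≠ 0)
    (hDensity : ∃ C : ℝ, ∀ T α : ℝ, 2 < T → b ≤ α → α ≤ 1 →
      zeroCount ζ α T ≤ C * T ^ (c * (1 - α)) * Real.log T ^ L)
    (hκ : L < (κ - c) * d₁) (hκc : c < κ) :
    ∃ C r T₀ : ℝ, 0 < C ∧ 0 < r ∧ ∀ (T x : ℝ) (Z : Finset ℂ) (m : ℂ → ℕ) (g : ℂ → ℂ), T₀ ≤ T →
      S.ZeroFactorization A θ b T Z m g → T ^ κ ≤ x →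
        ∑ ρ ∈ Z, m ρ * x ^ (ρ.re - 1) ≤ C * Real.log T ^ (-r) := by
  obtain ⟨C₀, hC₀⟩ := hDensity
  set C₁ := max C₀ 1 with hC₁
  have hC₁0 : 0 < C₁ := one_pos.trans_le (le_max_right _ _)
  have hDens : ∀ T α : ℝ, 2 < T → b ≤ α → α ≤ 1 →
      zeroCount ζ α T ≤ C₁ * T ^ (c * (1 - α)) * Real.log T ^ L := by
    intro T α hT h1 h2
    have : 0 < Real.log T := Real.log_pos (by linarith)
    refine (hC₀ T α hT h1 h2).trans ?_
    gcongr
    exact le_max_left _ _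
  obtain ⟨T₁, hT₁⟩ := hζ.exists_re_le_of_zeroFree h hd₁ hb hZeroFree
  obtain ⟨C₂, T₂, hC₂, hmult⟩ := hζ.exists_multiplicity_le h hb hb1 hd₁
  obtain ⟨η₁, hη1, hη2⟩ : ∃ η₁, L / d₁ < η₁ ∧ η₁ < κ - c := exists_between (by
    rwa [div_lt_iff₀ hd₁])
  rw [div_lt_iff₀ hd₁] at hη1
  obtain ⟨η₂, hη₂0, hη₂⟩ : ∃ η₂, 0 < η₂ ∧ κ = c + max η₁ 0 + 2 * η₂ := by
    refine ⟨(κ - c - max η₁ 0) / 2, ?_, by ring⟩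
    have : max η₁ 0 < κ - c := max_lt hη2 (by linarith)
    linarith
  set η := max η₁ 0 with hη
  have hη0 : 0 ≤ η := le_max_right _ _
  have hηL : L < η * d₁ := hη1.trans_le (by gcongr; exact le_max_left _ _)
  have hgeo : 0 < (1 - Real.exp (-η₂))⁻¹ :=
    inv_pos.mpr (by linarith [Real.exp_lt_one_iff.mpr (show -η₂ < 0 by linarith)])
  refine ⟨C₂ * (1 / η₂) * (C₁ * Real.exp c * (1 - Real.exp (-η₂))⁻¹), η * d₁ - L,
    max (max T₁ T₂) 3, by positivity, by linarith, fun T x Z m g hT hZ hx => ?_⟩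
  simp only [max_le_iff] at hT
  obtain ⟨⟨hTT1, hTT2⟩, hT3⟩ := hT
  have hT0 : 0 < T := by linarith
  have hx0 : 0 < x := (Real.rpow_pos_of_pos hT0 κ).trans_le hx
  set ℓ := Real.log T with hℓ
  have hℓ0 : 0 < ℓ := Real.log_pos (by linarith)
  have hterm : ∀ ρ ∈ Z, m ρ * x ^ (ρ.re - 1) ≤ C₂ * (1 / η₂) * ℓ ^ (-(η * d₁)) *
      Real.exp (-(c + η₂) * ((1 - ρ.re) * ℓ)) := by
    intro ρ hρ
    obtain ⟨h1, h2, h3⟩ := (hZ.mem_iff ρ).mp hρ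
    have hzf := hT₁ T hTT1 ρ h1 h2 h3
    have hm := hmult T Z m g hTT2 hZ ρ hρ hzf
    set w := (1 - ρ.re) * ℓ with hw
    have hw0 : d₁ * Real.log ℓ ≤ w := by
      rwa [← mul_div_assoc, div_le_iff₀ hℓ0] at hzf
    have hre := hZ.re_lt_one h hρ
    have hwpos : 0 < w := mul_pos (by linarith) hℓ0
    have hx1 : x ^ (ρ.re - 1) ≤ Real.exp (-κ * w) := by
      calc x ^ (ρ.re - 1) ≤ (T ^ κ) ^ (ρ.re - 1) :=
            Real.rpow_le_rpow_of_nonpos (by positivity) hx (by linarith)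
        _ = Real.exp (-κ * w) := by
            rw [← Real.rpow_mul hT0.le, Real.rpow_def_of_pos hT0, hw]
            congr 1
            ring
    have hw1 : w ≤ 1 / η₂ * Real.exp (η₂ * w) := by
      rw [one_div, inv_mul_eq_div, le_div_iff₀ hη₂0]
      linarith [Real.add_one_le_exp (η₂ * w)]
    calc m ρ * x ^ (ρ.re - 1) ≤ (C₂ * (1 / η₂ * Real.exp (η₂ * w))) * Real.exp (-κ * w) := by
          gcongr ?_ * ?_
          exact hm.trans (by gcongr)
      _ = C₂ * (1 / η₂) * Real.exp (-η * w) * Real.exp (-(c + η₂) * w) := by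
          have : Real.exp (η₂ * w) * Real.exp (-κ * w) =
              Real.exp (-η * w) * Real.exp (-(c + η₂) * w) := by
            rw [← Real.exp_add, ← Real.exp_add, hη₂]
            congr 1
            ring
          linear_combination C₂ * (1 / η₂) * this
      _ ≤ _ := by
          gcongr
          rw [Real.rpow_def_of_pos hℓ0]
          refine Real.exp_le_exp.mpr ?_
          nlinarith
  refine (Finset.sum_le_sum hterm).trans ?_
  rw [← Finset.mul_sum]
  calc _ ≤ C₂ * (1 / η₂) * ℓ ^ (-(η * d₁)) *
        (C₁ * ℓ ^ L * Real.exp c * (1 - Real.exp (-η₂))⁻¹) := by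
        gcongr
        exact hZ.sum_exp_neg_le h hζ hb hb1 hc hC₁0.le hη₂0 hT3 hDens
    _ = _ := by
        have : ℓ ^ (-(η * d₁ - L)) = ℓ ^ (-(η * d₁)) * ℓ ^ L := by
          rw [← Real.rpow_add hℓ0]
          congr 1
          ring
        rw [this]
        ring

end BeurlingSystem

lemma laplaceTransform_smoothWindow_one_eq_ofReal (a b δ : ℝ) :
    laplaceTransform (smoothWindow a b δ) 1 =
      ((∫ v, smoothWindow a b δ v * Real.exp v : ℝ) : ℂ) := by
  rw [laplaceTransform, ← integral_complex_ofReal]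
  simp

lemma integrable_smoothWindow_mul_exp {a b δ : ℝ} (hab : a ≤ b) (hδ : 0 < δ) :
    MeasureTheory.Integrable fun v => smoothWindow a b δ v * Real.exp v :=
  ((smoothWindow_continuous a b δ).mul Real.continuous_exp).integrable_of_hasCompactSupport
    (smoothWindow_hasCompactSupport hab hδ).mul_right

lemma integral_smoothWindow_mul_exp_le {a b δ : ℝ} (hab : a ≤ b) (hδ : 0 < δ) :
    ∫ v, smoothWindow a b δ v * Real.exp v ≤ Real.exp (b + δ) - Real.exp a := by
  rw [← integral_exp, intervalIntegral.integral_of_le (by linarith),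
    ← MeasureTheory.integral_Icc_eq_integral_Ioc,
    ← MeasureTheory.integral_indicator measurableSet_Icc]
  refine MeasureTheory.integral_mono (integrable_smoothWindow_mul_exp hab hδ)
    (Real.continuous_exp.integrableOn_Icc.integrable_indicator measurableSet_Icc) fun v => ?_
  by_cases hv : v ∈ Set.Icc a (b + δ)
  · rw [Set.indicator_of_mem hv]
    exact mul_le_of_le_one_left (Real.exp_pos v).le (smoothWindow_le_one v)
  · rw [Set.indicator_of_notMem hv]
    show smoothWindow a b δ v * Real.exp v ≤ 0
    rw [smoothWindow_eq_zero_of_notMem hab hδ hv, zero_mul]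

lemma le_integral_smoothWindow_mul_exp {a b δ : ℝ} (hab : a + δ ≤ b) (hδ : 0 < δ) :
    Real.exp b - Real.exp (a + δ) ≤ ∫ v, smoothWindow a b δ v * Real.exp v := by
  have hab' : a ≤ b := by linarith
  rw [← integral_exp, intervalIntegral.integral_of_le hab,
    ← MeasureTheory.integral_Icc_eq_integral_Ioc,
    ← MeasureTheory.integral_indicator measurableSet_Icc]
  refine MeasureTheory.integral_mono
    (Real.continuous_exp.integrableOn_Icc.integrable_indicator measurableSet_Icc)
    (integrable_smoothWindow_mul_exp hab' hδ) fun v => ?_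
  by_cases hv : v ∈ Set.Icc (a + δ) b
  · rw [Set.indicator_of_mem hv]
    show _ ≤ smoothWindow a b δ v * Real.exp v
    rw [smoothWindow_eq_one hδ hv.1 hv.2, one_mul]
  · rw [Set.indicator_of_notMem hv]
    exact mul_nonneg (smoothWindow_nonneg hab' hδ v) (Real.exp_pos v).le

namespace BeurlingSystem

variable (S : BeurlingSystem)

lemma psi_eq_sum (x : ℝ) : S.psi x = ∑ n ∈ (S.finite_val_le x).toFinset, S.vonMangoldt n :=
  finsum_mem_eq_finite_toFinset_sum _ (S.finite_val_le x)

lemma psi_sub_psi {x y : ℝ} (hxy : x ≤ y) : S.psi y - S.psi x =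
    ∑ n ∈ (S.finite_val_le y).toFinset \ (S.finite_val_le x).toFinset, S.vonMangoldt n := by
  rw [psi_eq_sum, psi_eq_sum, sub_eq_iff_eq_add, Finset.sum_sdiff]
  intro n hn
  rw [Set.Finite.mem_toFinset] at hn ⊢
  exact hn.trans hxy

lemma vonMangoldt_mul_smoothWindow_eq_zero {a b δ : ℝ} (hab : a ≤ b) (hδ : 0 < δ) {n : ℕ →₀ ℕ}
    (hn : n ∉ (S.finite_val_le (Real.exp (b + δ))).toFinset) :
    S.vonMangoldt n * smoothWindow a b δ (Real.log (S.val n)) = 0 := by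
  rw [smoothWindow_eq_zero_of_notMem hab hδ, mul_zero]
  intro hv
  refine hn ?_
  rw [Set.Finite.mem_toFinset]
  exact (Real.log_le_iff_le_exp (S.val_pos n)).mp hv.2

lemma psi_sub_psi_le_tsum {a b δ x y : ℝ} (hab : a ≤ b) (hδ : 0 < δ) (hx : 0 < x) (hxy : x ≤ y)
    (hax : a + δ ≤ Real.log x) (hyb : Real.log y ≤ b) :
    S.psi y - S.psi x ≤
      ∑' n, S.vonMangoldt n * smoothWindow a b δ (Real.log (S.val n)) := by
  rw [S.psi_sub_psi hxy]
  have hsum : Summable fun n => S.vonMangoldt n * smoothWindow a b δ (Real.log (S.val n)) :=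
    summable_of_ne_finset_zero fun n hn => S.vonMangoldt_mul_smoothWindow_eq_zero hab hδ hn
  refine le_trans (Finset.sum_le_sum fun n hn => ?_) (hsum.sum_le_tsum
    ((S.finite_val_le y).toFinset \ (S.finite_val_le x).toFinset) fun n _ =>
      mul_nonneg (S.vonMangoldt_nonneg n) (smoothWindow_nonneg hab hδ _))
  rw [Finset.mem_sdiff, Set.Finite.mem_toFinset, Set.Finite.mem_toFinset] at hn
  have h1 : S.val n ≤ y := hn.1
  have h2 : x < S.val n := not_le.mp hn.2
  rw [smoothWindow_eq_one hδ, mul_one]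
  · exact hax.trans (Real.log_le_log hx h2.le)
  · exact (Real.log_le_log (S.val_pos n) h1).trans hyb

lemma tsum_le_psi_sub_psi {a b δ x y : ℝ} (hab : a ≤ b) (hδ : 0 < δ) (hx : 0 < x) (hxy : x ≤ y)
    (hax : Real.log x ≤ a) (hyb : b + δ ≤ Real.log y) :
    ∑' n, S.vonMangoldt n * smoothWindow a b δ (Real.log (S.val n)) ≤ S.psi y - S.psi x := by
  rw [S.psi_sub_psi hxy, tsum_eq_sum
    (s := (S.finite_val_le y).toFinset \ (S.finite_val_le x).toFinset)]
  · exact Finset.sum_le_sum fun n _ =>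
      mul_le_of_le_one_right (S.vonMangoldt_nonneg n) (smoothWindow_le_one _)
  · intro n hn
    rw [Finset.mem_sdiff, Set.Finite.mem_toFinset, Set.Finite.mem_toFinset, not_and, not_not] at hn
    by_cases hy : S.val n ≤ y
    · have h1 : S.val n ≤ x := hn hy
      rw [smoothWindow_of_le hab hδ ((Real.log_le_log (S.val_pos n) h1).trans hax), mul_zero]
    · refine S.vonMangoldt_mul_smoothWindow_eq_zero hab hδ fun h1 => hy ?_
      rw [Set.Finite.mem_toFinset] at h1
      exact le_trans h1 ((Real.le_log_iff_exp_le (hx.trans_le hxy)).mp hyb)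

end BeurlingSystem

lemma Real.exp_le_one_add_two_mul {δ : ℝ} (h0 : 0 ≤ δ) (h1 : δ ≤ 1 / 2) :
    Real.exp δ ≤ 1 + 2 * δ := by
  have e1 : Real.exp δ * (1 - δ) ≤ 1 := by
    calc Real.exp δ * (1 - δ) ≤ Real.exp δ * Real.exp (-δ) := by
          gcongr
          exact Real.one_sub_le_exp_neg δ
      _ = 1 := by rw [← Real.exp_add, add_neg_cancel, Real.exp_zero]
  have e2 : 1 ≤ (1 + 2 * δ) * (1 - δ) := by nlinarith
  exact le_of_mul_le_mul_right (e1.trans e2) (by linarith)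

namespace BeurlingSystem

variable {S : BeurlingSystem} {A θ K₀ : ℝ} {ζ : ℂ → ℂ}

/-- If the smoothed counts approximate `∫ w(v) e^v dv` with error `E`, then the sharp count
approximates `h`. -/
lemma abs_psi_sub_psi_sub_le {x h ε₁ E : ℝ} (hx : 0 < x) (hh : 0 < h) (hhx : h ≤ 2 * x)
    (hε : 0 < ε₁) (hε4 : ε₁ ≤ 1 / 4)
    (hE : ∀ a b δ : ℝ, δ = ε₁ * (Real.log (x + h) - Real.log x) → a ≤ b → Real.log x - 1 ≤ a →
      b + δ ≤ Real.log x + 3 → b - a + δ ≤ 3 * (h / x) →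
      |∑' n, S.vonMangoldt n * smoothWindow a b δ (Real.log (S.val n)) -
        ∫ v, smoothWindow a b δ v * Real.exp v| ≤ E) :
    |S.psi (x + h) - S.psi x - h| ≤ 7 * ε₁ * h + E := by
  set a := Real.log x with ha
  set b := Real.log (x + h) with hb
  have hea : Real.exp a = x := Real.exp_log hx
  have heb : Real.exp b = x + h := Real.exp_log (by linarith)
  have hab : a < b := Real.log_lt_log hx (by linarith)
  have hbah : b - a ≤ h / x := by
    rw [hb, ha, ← Real.log_div (by linarith) hx.ne', add_div, div_self hx.ne']
    have := Real.log_le_sub_one_of_pos (show 0 < 1 + h / x by positivity)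
    linarith
  have hhx2 : h / x ≤ 2 := by rwa [div_le_iff₀ hx]
  obtain ⟨δ, hδ⟩ : ∃ δ, δ = ε₁ * (b - a) := ⟨_, rfl⟩
  have hδ0 : 0 < δ := by
    rw [hδ]
    exact mul_pos hε (by linarith)
  have hδ4 : δ ≤ (b - a) / 4 := by
    rw [hδ]
    nlinarith
  have hδx : δ * x ≤ ε₁ * h := by
    rw [hδ, mul_assoc]
    gcongr
    rwa [← le_div_iff₀ hx]
  have hexp := Real.exp_le_one_add_two_mul hδ0.le (by linarith)
  have hexp' := Real.one_sub_le_exp_neg δ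
  have hxh : δ * (x + h) ≤ δ * (3 * x) := by gcongr; linarith
  rw [abs_le]
  constructor
  · have h1 := hE a (b - δ) δ hδ (by linarith) (by linarith) (by linarith) (by linarith)
    have h2 := S.tsum_le_psi_sub_psi (a := a) (b := b - δ) (δ := δ) (x := x) (y := x + h)
      (by linarith) hδ0 hx (by linarith) le_rfl (by linarith)
    have h3 := le_integral_smoothWindow_mul_exp (a := a) (b := b - δ) (by linarith) hδ0
    rw [sub_eq_add_neg b, Real.exp_add, Real.exp_add, hea, heb, ← sub_eq_add_neg] at h3
    have h4 := (abs_le.mp h1).1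
    have h5 : (x + h) * (1 - δ) ≤ (x + h) * Real.exp (-δ) := by gcongr
    have h6 : x * Real.exp δ ≤ x * (1 + 2 * δ) := by gcongr
    have h7 : 0 ≤ ε₁ * h := by positivity
    linarith
  · have h1 := hE (a - δ) b δ hδ (by linarith) (by linarith) (by linarith) (by linarith)
    have h2 := S.psi_sub_psi_le_tsum (a := a - δ) (b := b) (δ := δ) (x := x) (y := x + h)
      (by linarith) hδ0 hx (by linarith) (by linarith) le_rfl
    have h3 := integral_smoothWindow_mul_exp_le (a := a - δ) (b := b) (by linarith) hδ0
    rw [sub_eq_add_neg a, Real.exp_add, Real.exp_add, hea, heb, ← sub_eq_add_neg] at h3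
    have h4 := (abs_le.mp h1).2
    have h5 : (x + h) * Real.exp δ ≤ (x + h) * (1 + 2 * δ) := by gcongr
    have h6 : x * (1 - δ) ≤ x * Real.exp (-δ) := by gcongr
    linarith

/-- The prime number theorem in short intervals, given control of the zeros up to a suitable
height. -/
theorem WellBehaved.psi_sub_psi_of_small_zero_sum (h : S.WellBehaved A θ K₀) {b₁ b₂ lam : ℝ}
    (hb : θ < b₁) (hb12 : b₁ < b₂) (hb2 : b₂ < 1) (K : ℕ) (hK : 2 ≤ K) {T : ℝ → ℝ}
    (hT : Tendsto T atTop atTop)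
    (hsum : ∀ ε : ℝ, 0 < ε → ∀ᶠ x in atTop, ∀ (Z : Finset ℂ) (m : ℂ → ℕ) (g : ℂ → ℂ),
      S.ZeroFactorization A θ b₁ (T x + 2) Z m g → ∑ ρ ∈ Z, m ρ * x ^ (ρ.re - 1) ≤ ε)
    (hline : Tendsto (fun x => T x * Real.log (T x) ^ 2 * x ^ (b₂ - 1)) atTop (𝓝 0))
    (htail : Tendsto (fun x => T x * Real.log (T x) ^ 2 * Real.log x *
      ((x ^ (1 - lam)) ^ K * (T x)⁻¹ ^ (K - 1))) atTop (𝓝 0))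
    {c₀ ε : ℝ} (hc₀ : 0 < c₀) (hε : 0 < ε) :
    ∃ x₀ : ℝ, ∀ x y : ℝ, x₀ ≤ x → c₀ * x ^ lam ≤ y → y ≤ 2 * x →
      |S.psi (x + y) - S.psi x - y| ≤ ε * y := by
  obtain ⟨C, hC, hmain⟩ := h.exists_norm_tsum_sub_le hb hb12 hb2 K hK
  obtain ⟨ε₁, hε₁, hε₁4, hε₁ε⟩ : ∃ ε₁ : ℝ, 0 < ε₁ ∧ ε₁ ≤ 1 / 4 ∧ ε₁ ≤ ε / 14 :=
    ⟨min (1 / 4) (ε / 14), lt_min (by norm_num) (by positivity), min_le_left _ _, min_le_right _ _⟩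
  set B := 1 / c₀ * (3 / (ε₁ * c₀)) ^ (K - 1) with hB
  have hB0 : 0 < B := by positivity
  set η := ε / (14 * C) with hη
  have hη0 : 0 < η := by positivity
  obtain ⟨x₀, hx₀⟩ := eventually_atTop.mp ((hsum η hη0).and
    ((hline.eventually_le_const hη0).and ((htail.eventually_le_const (div_pos hη0 hB0)).and
      ((hT.eventually_ge_atTop 3).and (eventually_ge_atTop (Real.exp 3))))))
  refine ⟨x₀, fun x y hx hy hyx => ?_⟩
  obtain ⟨hx1, hx2, hx3, hT3, hxe⟩ := hx₀ x hx
  have hx0 : 0 < x := (Real.exp_pos 3).trans_le hxe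
  have hy0 : 0 < y := lt_of_lt_of_le (by positivity) hy
  have hlogx : 0 ≤ Real.log x := Real.log_nonneg ((Real.one_le_exp (by norm_num)).trans hxe)
  have hT0 : 0 < T x := by linarith
  refine (abs_psi_sub_psi_sub_le hx0 hy0 hyx hε₁ hε₁4 (E := ε / 2 * y) ?_).trans ?_
  · intro a b δ hδ hab ha hbδ hΔ
    obtain ⟨Z, m, g, hZ⟩ := h.exists_zeroFactorization hb (T x + 2)
    have hdiff : y / x / 3 ≤ Real.log (x + y) - Real.log x := by
      rw [← Real.log_div (by linarith) hx0.ne']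
      refine le_trans ?_ (Real.one_sub_inv_le_log_of_pos (by positivity))
      rw [inv_div, one_sub_div (by linarith), add_sub_cancel_left, div_div]
      gcongr
      linarith
    have hδl : ε₁ * (y / x / 3) ≤ δ := by
      rw [hδ]
      gcongr
    have hδ0 : 0 < δ := lt_of_lt_of_le (by positivity) hδl
    have hxy : x / y ≤ x ^ (1 - lam) / c₀ := by
      rw [div_le_div_iff₀ hy0 hc₀, Real.rpow_sub hx0, Real.rpow_one, div_mul_eq_mul_div,
        le_div_iff₀ (by positivity), mul_assoc]
      gcongr
    have hδinv : δ⁻¹ ≤ 3 / (ε₁ * c₀) * x ^ (1 - lam) := by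
      calc δ⁻¹ ≤ (ε₁ * (y / x / 3))⁻¹ := by gcongr
        _ = 3 / ε₁ * (x / y) := by
            field_simp
        _ ≤ 3 / ε₁ * (x ^ (1 - lam) / c₀) := by gcongr
        _ = _ := by field_simp
    have hmain' := hmain x (T x) a b δ Z m g hxe hT3 ha hab hδ0 hbδ hZ
    rw [laplaceTransform_smoothWindow_one_eq_ofReal, ← Complex.ofReal_tsum, ← Complex.ofReal_sub,
      Complex.norm_real, Real.norm_eq_abs] at hmain'
    refine hmain'.trans ?_
    have hS0 : 0 ≤ ∑ ρ ∈ Z, m ρ * x ^ (ρ.re - 1) := by positivity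
    have hΔ0 : 0 ≤ b - a + δ := by linarith
    have e1 : (b - a + δ) * x * ∑ ρ ∈ Z, m ρ * x ^ (ρ.re - 1) ≤ 3 * y * η := by
      calc _ ≤ 3 * (y / x) * x * η := by
            gcongr
            exact hx1 Z m g hZ
        _ = _ := by field_simp
    have e2 : (b - a + δ) * (T x * Real.log (T x) ^ 2 * x ^ b₂) ≤ 3 * y * η := by
      calc _ ≤ 3 * (y / x) * (T x * Real.log (T x) ^ 2 * x ^ b₂) := by gcongr
        _ = 3 * y * (T x * Real.log (T x) ^ 2 * x ^ (b₂ - 1)) := by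
            rw [Real.rpow_sub_one hx0.ne']
            field_simp
        _ ≤ _ := by gcongr
    have e3 : T x * Real.log (T x) ^ 2 * Real.log x * (x * δ⁻¹ ^ (K - 1) * (T x)⁻¹ ^ (K - 1)) ≤
        y * η := by
      have hxy' : x ≤ y * (x ^ (1 - lam) / c₀) := by rwa [div_le_iff₀' hy0] at hxy
      calc _ ≤ T x * Real.log (T x) ^ 2 * Real.log x * (y * (x ^ (1 - lam) / c₀) *
            (3 / (ε₁ * c₀) * x ^ (1 - lam)) ^ (K - 1) * (T x)⁻¹ ^ (K - 1)) := by gcongr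
        _ = y * B * (T x * Real.log (T x) ^ 2 * Real.log x *
            ((x ^ (1 - lam)) ^ K * (T x)⁻¹ ^ (K - 1))) := by
            obtain ⟨k, rfl⟩ : ∃ k, K = k + 1 := ⟨K - 1, by omega⟩
            rw [hB, Nat.add_sub_cancel, mul_pow, pow_succ (x ^ (1 - lam))]
            ring
        _ ≤ y * B * (η / B) := by gcongr
        _ = _ := by field_simp
    calc C * _ ≤ C * (3 * y * η + 3 * y * η + y * η) := by gcongr
      _ = ε / 2 * y := by
          rw [hη]
          field_simp
          norm_num
  · nlinarith

/-- An interval asymptotic for lengths up to `2 x` extends to all lengths. -/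
lemma psi_sub_psi_of_le_two_mul {lam : ℝ}
    (hshort : ∀ c₀ ε : ℝ, 0 < c₀ → 0 < ε → ∃ x₀ : ℝ, ∀ x y : ℝ, x₀ ≤ x → c₀ * x ^ lam ≤ y →
      y ≤ 2 * x → |S.psi (x + y) - S.psi x - y| ≤ ε * y) (hlam : lam ≤ 1) {c₀ ε : ℝ}
    (hc₀ : 0 < c₀) (hε : 0 < ε) :
    ∃ x₀ : ℝ, ∀ x y : ℝ, x₀ ≤ x → c₀ * x ^ lam ≤ y → |S.psi (x + y) - S.psi x - y| ≤ ε * y := by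
  obtain ⟨x₀, hx₀⟩ := hshort (min c₀ (1 / 2)) ε (lt_min hc₀ (by norm_num)) hε
  have hind : ∀ n : ℕ, ∀ x y : ℝ, max x₀ 1 ≤ x → min c₀ (1 / 2) * x ^ lam ≤ y →
      y ≤ 2 ^ (n + 1) * x → |S.psi (x + y) - S.psi x - y| ≤ ε * y := by
    intro n
    induction n with
    | zero =>
      intro x y hx hy hyx
      exact hx₀ x y ((le_max_left _ _).trans hx) hy (by simpa using hyx)
    | succ n ih =>
      intro x y hx hy hyx
      obtain hle | hlt := le_or_gt y (2 * x)
      · exact hx₀ x y ((le_max_left _ _).trans hx) hy hle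
      have hx1 : 1 ≤ x := (le_max_right _ _).trans hx
      have hpow : ∀ z : ℝ, 1 ≤ z → min c₀ (1 / 2) * z ^ lam ≤ z / 2 := by
        intro z hz
        calc min c₀ (1 / 2) * z ^ lam ≤ 1 / 2 * z ^ (1 : ℝ) := by
              gcongr
              exact min_le_right _ _
          _ = z / 2 := by rw [Real.rpow_one]; ring
      have h1 := hx₀ x x ((le_max_left _ _).trans hx) ((hpow x hx1).trans (by linarith))
        (by linarith)
      have h2 := ih (2 * x) (y - x) (by linarith) ((hpow (2 * x) (by linarith)).trans (by linarith))
        (by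
          rw [pow_succ] at hyx
          linarith)
      rw [show 2 * x + (y - x) = x + y by ring] at h2
      rw [← two_mul] at h1
      calc |S.psi (x + y) - S.psi x - y|
          = |(S.psi (x + y) - S.psi (2 * x) - (y - x)) + (S.psi (2 * x) - S.psi x - x)| := by
            congr 1; ring
        _ ≤ ε * (y - x) + ε * x := (abs_add_le _ _).trans (add_le_add h2 h1)
        _ = ε * y := by ring
  refine ⟨max x₀ 1, fun x y hx hy => ?_⟩
  have hx1 : 1 ≤ x := (le_max_right _ _).trans hx
  obtain ⟨n, hn⟩ := pow_unbounded_of_one_lt (y / x) one_lt_two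
  refine hind n x y hx (le_trans ?_ hy) ?_
  · gcongr
    exact min_le_left _ _
  · rw [div_lt_iff₀ (by linarith)] at hn
    refine hn.le.trans ?_
    gcongr
    · norm_num
    · omega

end BeurlingSystem

lemma Real.tendsto_pow_log_mul_rpow_neg_atTop (n : ℕ) {r : ℝ} (hr : 0 < r) :
    Tendsto (fun x => Real.log x ^ n * x ^ (-r)) atTop (𝓝 0) := by
  refine (isLittleO_log_rpow_rpow_atTop (n : ℝ) hr).tendsto_div_nhds_zero.congr' ?_
  filter_upwards [eventually_ge_atTop 0] with x hx
  rw [Real.rpow_natCast, Real.rpow_neg hx, div_eq_mul_inv]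

namespace BeurlingSystem

variable {S : BeurlingSystem} {A θ K₀ : ℝ} {ζ : ℂ → ℂ}

/-- Only the zero-free region is needed for intervals of length proportional to `x`. -/
theorem IsZeta.psi_sub_psi_of_zeroFree (h : S.WellBehaved A θ K₀) (hζ : S.IsZeta θ ζ)
    {d₁ t₀ : ℝ} (hd₁ : 0 < d₁)
    (hZeroFree : ∀ ρ : ℂ, θ < ρ.re → ρ ≠ 1 → t₀ < ρ.im →
      1 - d₁ * Real.log (Real.log ρ.im) / Real.log ρ.im < ρ.re → ζ ρ ≠ 0)
    {c₀ ε : ℝ} (hc₀ : 0 < c₀) (hε : 0 < ε) :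
    ∃ x₀ : ℝ, ∀ x y : ℝ, x₀ ≤ x → c₀ * x ^ (1 : ℝ) ≤ y →
      |S.psi (x + y) - S.psi x - y| ≤ ε * y := by
  have hθ1 : θ < 1 := h.2.2.1
  obtain ⟨b₁, hb, hb1⟩ := exists_between hθ1
  obtain ⟨b₂, hb12, hb2⟩ := exists_between hb1
  refine psi_sub_psi_of_le_two_mul (fun c₀ ε hc₀ hε => h.psi_sub_psi_of_small_zero_sum hb hb12 hb2
    4 (by norm_num) Real.tendsto_log_atTop ?_ ?_ ?_ hc₀ hε) le_rfl hc₀ hε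
  · obtain ⟨C, hC, hcount⟩ := h.exists_sum_multiplicity_le_mul_log hb hb1
    obtain ⟨T₀, hT₀⟩ := hζ.exists_re_le_of_zeroFree h hd₁ hb hZeroFree
    have hT : Tendsto (fun x => Real.log x + 2) atTop atTop :=
      tendsto_atTop_add_const_right _ _ Real.tendsto_log_atTop
    have hlim : Tendsto (fun t : ℝ => C * ((t ^ (1 / 2 : ℝ)) ^ (4 : ℝ) *
        Real.exp (-(d₁ / 2) * t ^ (1 / 2 : ℝ)))) atTop (𝓝 0) := by
      have := ((tendsto_rpow_mul_exp_neg_mul_atTop_nhds_zero 4 (d₁ / 2) (by positivity)).comp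
        (tendsto_rpow_atTop (show (0 : ℝ) < 1 / 2 by norm_num))).const_mul C
      rwa [mul_zero] at this
    have hlog : ∀ᶠ t : ℝ in atTop, Real.log t ≤ t ^ (1 / 2 : ℝ) := by
      filter_upwards [(isLittleO_log_rpow_atTop (show (0 : ℝ) < 1 / 2 by norm_num)).bound one_pos,
        eventually_ge_atTop 1] with t ht ht1
      rw [one_mul, Real.norm_of_nonneg (Real.rpow_nonneg (zero_le_one.trans ht1) _)] at ht
      exact (le_abs_self _).trans ht
    have hll : ∀ᶠ t : ℝ in atTop, 1 ≤ Real.log (Real.log t) :=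
      (Real.tendsto_log_atTop.comp Real.tendsto_log_atTop).eventually_ge_atTop 1
    intro ε hε
    filter_upwards [hT.eventually (hlim.eventually_le_const hε), hT.eventually hlog,
      hT.eventually hll, hT.eventually_ge_atTop (max T₀ 4), eventually_gt_atTop 0]
      with x hx1 hx2 hx3 hx4 hx0 Z m g hZ
    obtain ⟨hx5, hx6⟩ := max_le_iff.mp hx4
    refine le_trans ?_ hx1
    have hxt : Real.log x = Real.log x + 2 - 2 := by ring
    set t := Real.log x + 2 with ht
    have ht0 : 0 < t := by linarith
    have hlogt : 1 ≤ Real.log t := by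
      rw [Real.le_log_iff_exp_le ht0]
      linarith [Real.exp_one_lt_three]
    have hs0 : 0 < t ^ (1 / 2 : ℝ) := by positivity
    have hst : t ^ (1 / 2 : ℝ) * t ^ (1 / 2 : ℝ) = t := by
      rw [← Real.rpow_add ht0]
      norm_num
    have hs4 : (t ^ (1 / 2 : ℝ)) ^ (4 : ℝ) = t * t := by
      rw [← Real.rpow_mul ht0.le]
      norm_num
      ring
    have hs1 : t ^ (1 / 2 : ℝ) ≤ t := by
      calc t ^ (1 / 2 : ℝ) ≤ t ^ (1 : ℝ) :=
            Real.rpow_le_rpow_of_exponent_le (by linarith) (by norm_num)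
        _ = t := Real.rpow_one t
    have hterm : ∀ ρ ∈ Z, m ρ * x ^ (ρ.re - 1) ≤
        m ρ * Real.exp (-(d₁ / 2) * t ^ (1 / 2 : ℝ)) := by
      intro ρ hρ
      obtain ⟨h1, h2, h3⟩ := (hZ.mem_iff ρ).mp hρ
      have h4 := hT₀ t hx5 ρ h1 h2 h3
      have h5 : d₁ * (1 / t ^ (1 / 2 : ℝ)) ≤ 1 - ρ.re := by
        refine le_trans ?_ h4
        gcongr
      gcongr
      rw [Real.rpow_def_of_pos hx0, hxt]
      refine Real.exp_le_exp.mpr ?_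
      have h6 : t / 2 * (d₁ * (1 / t ^ (1 / 2 : ℝ))) ≤ (t - 2) * (1 - ρ.re) :=
        mul_le_mul (by linarith) h5 (by positivity) (by linarith)
      have h7 : t / 2 * (d₁ * (1 / t ^ (1 / 2 : ℝ))) = d₁ / 2 * t ^ (1 / 2 : ℝ) := by
        field_simp
        linarith
      linarith
    refine (Finset.sum_le_sum hterm).trans ?_
    rw [← Finset.sum_mul, ← mul_assoc, hs4]
    gcongr
    refine (hcount t Z m g (by linarith) hZ).trans ?_
    gcongr
    exact hx2.trans hs1
  · have hlim := Real.tendsto_pow_log_mul_rpow_neg_atTop 3 (show 0 < 1 - b₂ by linarith)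
    refine tendsto_of_tendsto_of_tendsto_of_le_of_le' tendsto_const_nhds hlim ?_ ?_
    · filter_upwards [eventually_ge_atTop 1] with x hx
      have := Real.log_nonneg hx
      positivity
    · filter_upwards [eventually_ge_atTop (Real.exp 1)] with x hx
      have hx0 : 0 < x := (Real.exp_pos 1).trans_le hx
      have hl : 1 ≤ Real.log x := (Real.le_log_iff_exp_le hx0).mpr hx
      have hll : 0 ≤ Real.log (Real.log x) := Real.log_nonneg hl
      have hll2 : Real.log (Real.log x) ≤ Real.log x := Real.log_le_self (by linarith)
      rw [neg_sub, pow_succ' _ 2]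
      gcongr
  · have hlim := (Real.isLittleO_pow_log_id_atTop (n := 2)).tendsto_div_nhds_zero.comp
      Real.tendsto_log_atTop
    refine hlim.congr' ?_
    filter_upwards [eventually_gt_atTop 1] with x hx
    have := Real.log_pos hx
    simp only [Function.comp_apply, id, sub_self, Real.rpow_zero, one_pow, one_mul, Nat.add_one_sub_one]
    field_simp

/-- The zero-density estimate handles intervals of length `x ^ lam` with `lam < 1`. -/
theorem IsZeta.psi_sub_psi_of_density (h : S.WellBehaved A θ K₀) (hζ : S.IsZeta θ ζ)
    {d₁ t₀ b c L lam : ℝ} (hd₁ : 0 < d₁) (hb : θ < b) (hc : 0 < c) (hL : 0 < L)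
    (hZeroFree : ∀ ρ : ℂ, θ < ρ.re → ρ ≠ 1 → t₀ < ρ.im →
      1 - d₁ * Real.log (Real.log ρ.im) / Real.log ρ.im < ρ.re → ζ ρ ≠ 0)
    (hDensity : ∃ C : ℝ, ∀ T α : ℝ, 2 < T → b ≤ α → α ≤ 1 →
      zeroCount ζ α T ≤ C * T ^ (c * (1 - α)) * Real.log T ^ L)
    (hlb : b < lam) (hld : 1 - d₁ / (c * d₁ + L) < lam) (hlam : lam < 1)
    {c₀ ε : ℝ} (hc₀ : 0 < c₀) (hε : 0 < ε) :
    ∃ x₀ : ℝ, ∀ x y : ℝ, x₀ ≤ x → c₀ * x ^ lam ≤ y →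
      |S.psi (x + y) - S.psi x - y| ≤ ε * y := by
  obtain ⟨μ', hμ'1, hμ'2⟩ := exists_between (show 1 - lam < d₁ / (c * d₁ + L) by linarith)
  obtain ⟨μ, hμ1, hμ2⟩ := exists_between (show 1 - lam < min μ' (1 - b) from
    lt_min hμ'1 (by linarith))
  obtain ⟨hμμ', hμb⟩ := lt_min_iff.mp hμ2
  obtain ⟨b₂, hb12, hb2⟩ := exists_between (show b < 1 - μ by linarith)
  have hμ0 : 0 < μ := by linarith
  have hμ'0 : 0 < μ' := by linarith
  obtain ⟨K, hK⟩ := exists_nat_gt (max 2 (2 * μ / (μ - (1 - lam))))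
  obtain ⟨hK2, hKμ⟩ := max_lt_iff.mp hK
  rw [div_lt_iff₀ (by linarith)] at hKμ
  have hK2' : 2 < K := by exact_mod_cast hK2
  have hcd : 0 < c * d₁ + L := by positivity
  have hκ1 : L < (1 / μ' - c) * d₁ := by
    rw [lt_div_iff₀ hcd] at hμ'2
    rw [sub_mul, lt_sub_iff_add_lt, one_div, inv_mul_eq_div, lt_div_iff₀ hμ'0]
    linarith
  have hκ2 : c < 1 / μ' := by
    by_contra! hle
    nlinarith
  refine psi_sub_psi_of_le_two_mul (fun c₀ ε hc₀ hε => h.psi_sub_psi_of_small_zero_sum hb hb12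
    (by linarith) K hK2'.le (tendsto_rpow_atTop hμ0) ?_ ?_ ?_ hc₀ hε) hlam.le hc₀ hε
  · obtain ⟨C, r, T₀, hC, hr, hsum⟩ := hζ.exists_sum_multiplicity_mul_rpow_le h hd₁ hb
      (by linarith) hc hZeroFree hDensity hκ1 hκ2
    have hT : Tendsto (fun x : ℝ => x ^ μ + 2) atTop atTop :=
      tendsto_atTop_add_const_right _ _ (tendsto_rpow_atTop hμ0)
    have hlim : Tendsto (fun x : ℝ => C * Real.log (x ^ μ + 2) ^ (-r)) atTop (𝓝 0) := by
      have := ((tendsto_rpow_neg_atTop hr).comp (Real.tendsto_log_atTop.comp hT)).const_mul C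
      rwa [mul_zero] at this
    intro ε hε
    filter_upwards [hlim.eventually_le_const hε, hT.eventually_ge_atTop T₀,
      (tendsto_rpow_atTop hμ0).eventually_ge_atTop 2,
      (tendsto_rpow_atTop (sub_pos.mpr hμμ')).eventually_ge_atTop 2, eventually_gt_atTop 0]
      with x hx1 hx2 hx3 hx4 hx0 Z m g hZ
    refine (hsum _ x Z m g hx2 hZ ?_).trans hx1
    have hle : x ^ μ + 2 ≤ x ^ μ' := by
      calc x ^ μ + 2 ≤ 2 * x ^ μ := by linarith
        _ ≤ x ^ (μ' - μ) * x ^ μ := by gcongr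
        _ = x ^ μ' := by rw [← Real.rpow_add hx0, sub_add_cancel]
    calc (x ^ μ + 2) ^ (1 / μ') ≤ (x ^ μ') ^ (1 / μ') := by gcongr
      _ = x := by rw [← Real.rpow_mul hx0.le, mul_one_div_cancel hμ'0.ne', Real.rpow_one]
  · have hlim := (Real.tendsto_pow_log_mul_rpow_neg_atTop 2
      (show 0 < 1 - μ - b₂ by linarith)).const_mul (μ ^ 2)
    rw [mul_zero] at hlim
    refine hlim.congr' ?_
    filter_upwards [eventually_gt_atTop 0] with x hx
    rw [Real.log_rpow hx, show -(1 - μ - b₂) = μ + (b₂ - 1) by ring, Real.rpow_add hx]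
    ring
  · have hlim := (Real.tendsto_pow_log_mul_rpow_neg_atTop 3
      (show 0 < K * (μ - (1 - lam)) - 2 * μ by linarith)).const_mul (μ ^ 2)
    rw [mul_zero] at hlim
    refine hlim.congr' ?_
    filter_upwards [eventually_gt_atTop 0] with x hx
    have hexp : -(K * (μ - (1 - lam)) - 2 * μ) = μ + (1 - lam) * K + -μ * ((K - 1 : ℕ) : ℝ) := by
      rw [Nat.cast_sub (by omega), Nat.cast_one]
      ring
    rw [Real.log_rpow hx, hexp, Real.rpow_add hx, Real.rpow_add hx, Real.rpow_mul_natCast hx.le,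
      Real.rpow_mul_natCast hx.le, Real.rpow_neg hx.le]
    ring

end BeurlingSystem

/-- **PNT in short intervals from a Littlewood-type zero-free region and a
zero-density estimate** (Theorem 4.4(1)). -/
theorem beurling_pnt_short_intervals
    (S : BeurlingSystem) (A θ K₀ : ℝ) (hWB : S.WellBehaved A θ K₀)
    (ζ : ℂ → ℂ) (hζ : S.IsZeta θ ζ)
    (d₁ t₀ : ℝ) (hd₁ : 0 < d₁) (ht₀ : Real.exp 2 ≤ t₀)
    (hZeroFree : ∀ ρ : ℂ, θ < ρ.re → ρ ≠ 1 → t₀ < ρ.im →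
      1 - d₁ * Real.log (Real.log ρ.im) / Real.log ρ.im < ρ.re → ζ ρ ≠ 0)
    (b c L : ℝ) (hb : θ < b) (hc : 0 < c) (hL : 0 < L)
    (hDensity : ∃ C : ℝ, ∀ T α : ℝ, 2 < T → b ≤ α → α ≤ 1 →
      zeroCount ζ α T ≤ C * T ^ (c * (1 - α)) * Real.log T ^ L) :
    ∀ lam : ℝ, max b (1 - d₁ / (c * d₁ + L)) < lam →
      ∀ c₀ : ℝ, 0 < c₀ →
        ∀ ε : ℝ, 0 < ε →
          ∃ x₀ : ℝ, ∀ x h : ℝ, x₀ ≤ x → c₀ * x ^ lam ≤ h →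
            |S.psi (x + h) - S.psi x - h| ≤ ε * h := by
  intro lam hlam c₀ hc₀ ε hε
  obtain ⟨hlb, hld⟩ := max_lt_iff.mp hlam
  obtain hlt | hle := lt_or_ge lam 1
  · exact hζ.psi_sub_psi_of_density hWB hd₁ hb hc hL hZeroFree hDensity hlb hld hlt hc₀ hε
  · obtain ⟨x₀, hx₀⟩ := hζ.psi_sub_psi_of_zeroFree hWB hd₁ hZeroFree hc₀ hε
    refine ⟨max x₀ 1, fun x y hx hy => hx₀ x y ((le_max_left _ _).trans hx) (le_trans ?_ hy)⟩
    have hx1 : 1 ≤ x := (le_max_right _ _).trans hx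
    gcongr
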